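/- arXiv:math/0610294 — 3 statements merged into one kernel-verified Lean document; each statement's English description precedes it below -/
import Mathlib

section
/- Every finite p-group of order at least p^2 has an outer automorphism, i.e., Aut(G)/Inn(G) is nontrivial. -/
namespace Gaschutz

structure Gen {G : Type*} [Group G] (p : ℕ) (U : Subgroup G) (g : G) : Prop where
  nor : U.Normal
  pow : g ^ p ∈ U
  dvd : ∀ n : ℤ, g ^ n ∈ U → (p : ℤ) ∣ n
  gen : ∀ x : G, ∃ n : ℤ, x * g ^ n ∈ U

theorem ext_hom {V H : Type*} [Group V] [Group H] {p : ℕ} {U : Subgroup V} {g : V}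
    (hg : Gen p U g) (θ : U →* H) (h : H)
    (h1 : ∀ (u : V) (hu : u ∈ U) (hu' : g * u * g⁻¹ ∈ U), h * θ ⟨u, hu⟩ * h⁻¹ = θ ⟨g * u * g⁻¹, hu'⟩)
    (h2 : h ^ p = θ ⟨g ^ p, hg.pow⟩) :
    ∃ F : V →* H, (∀ u : U, F u = θ u) ∧ F g = h := by
  have := hg.nor
  let φ : Multiplicative ℤ →* MulAut U := (MulAut.conjNormal (H := U)).comp (zpowersHom V g)
  have hφ : ∀ (n : Multiplicative ℤ) (u : U), ((φ n u : U) : V) = g ^ (n.toAdd) * u * (g ^ n.toAdd)⁻¹ := by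
    intro n u
    simp only [φ, MonoidHom.comp_apply, zpowersHom_apply, MulAut.conjNormal_apply]
  have key1 : ∀ u : U, θ (MulAut.conjNormal g u) = h * θ u * h⁻¹ := by
    intro u
    rw [h1 u.1 u.2 (hg.nor.conj_mem _ u.2 g)]
    congr 1
  have keyS : ∀ n : Multiplicative ℤ, θ.comp (φ n).toMonoidHom
      = (MulAut.conj (zpowersHom H h n)).toMonoidHom.comp θ := by
    have nat : ∀ n : ℕ, ∀ u : U, θ (MulAut.conjNormal (g ^ n) u) = h ^ n * θ u * (h ^ n)⁻¹ := by
      intro n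
      induction n with
      | zero => intro u; simp
      | succ n ih =>
        intro u
        rw [pow_succ, map_mul, MulAut.mul_apply, ih, key1]
        group
    intro n
    ext u
    simp only [MonoidHom.comp_apply, MulEquiv.coe_toMonoidHom, MulAut.conj_apply, zpowersHom_apply, φ]
    obtain ⟨m, hm | hm⟩ := Int.eq_nat_or_neg n.toAdd
    · rw [hm]; simpa using nat m u
    · rw [hm, zpow_neg, zpow_natCast, zpow_neg, zpow_natCast]
      have := nat m (MulAut.conjNormal ((g ^ m)⁻¹) u)
      rw [← MulAut.mul_apply, ← map_mul, mul_inv_cancel, map_one, MulAut.one_apply] at this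
      rw [this]; group
  let P : U ⋊[φ] Multiplicative ℤ →* V := SemidirectProduct.lift U.subtype (zpowersHom V g) (by
    intro n; ext u
    simp only [MonoidHom.comp_apply, MulEquiv.coe_toMonoidHom, Subgroup.coe_subtype, hφ, zpowersHom_apply, MulAut.conj_apply])
  let Q : U ⋊[φ] Multiplicative ℤ →* H := SemidirectProduct.lift θ (zpowersHom H h) keyS
  have hP : Function.Surjective P := by
    intro x
    obtain ⟨n, hn⟩ := hg.gen x
    refine ⟨SemidirectProduct.inl ⟨_, hn⟩ * SemidirectProduct.inr (Multiplicative.ofAdd (-n)), ?_⟩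
    simp [P, zpowersHom_apply]
  have hk : P.ker ≤ Q.ker := by
    intro x hx
    rw [MonoidHom.mem_ker] at hx ⊢
    obtain ⟨u, n⟩ := x
    rw [SemidirectProduct.mk_eq_inl_mul_inr, map_mul] at hx ⊢
    simp only [P, Q, SemidirectProduct.lift_inl, SemidirectProduct.lift_inr, zpowersHom_apply,
      Subgroup.coe_subtype] at hx ⊢
    have hu : g ^ n.toAdd = (u : V)⁻¹ := (inv_eq_of_mul_eq_one_right hx).symm
    obtain ⟨k, hk⟩ := hg.dvd n.toAdd (by rw [hu]; exact U.inv_mem u.2)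
    rw [hk, zpow_mul, zpow_natCast] at hu ⊢
    rw [h2, ← map_zpow, ← map_mul]
    have : u * (⟨g ^ p, hg.pow⟩ : U) ^ k = 1 := by
      ext; simp [hu]
    rw [this, map_one]
  let F := P.liftOfSurjective hP ⟨Q, hk⟩
  have hF : ∀ x, F (P x) = Q x := fun x => MonoidHom.liftOfRightInverse_comp_apply _ _ _ ⟨Q, hk⟩ x
  refine ⟨F, fun u => ?_, ?_⟩
  · have := hF (SemidirectProduct.inl u)
    simpa [P, Q] using this
  · have := hF (SemidirectProduct.inr (Multiplicative.ofAdd 1))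
    simpa [P, Q, zpowersHom_apply] using this

theorem mem_of_coprime {G : Type*} [Group G] {p : ℕ} [Fact p.Prime] (hG : IsPGroup p G)
    {U : Subgroup G} {g : G} {n : ℤ} (hn : IsCoprime n (p : ℤ)) (h : g ^ n ∈ U) : g ∈ U := by
  obtain ⟨k, hk⟩ := hG.exists_pow_pow_eq_one g
  obtain ⟨a, b, hab⟩ := (hn.pow_right (n := k))
  have : g = (g ^ n) ^ a * (g ^ p ^ k) ^ b := by
    conv_lhs => rw [← zpow_one g, ← hab]
    rw [zpow_add, mul_comm a, zpow_mul, mul_comm b, zpow_mul]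
    congr 2
    exact_mod_cast (zpow_natCast g (p ^ k))
  rw [this, hk, one_zpow, mul_one]
  exact U.zpow_mem h a

theorem coprime_of {p : ℕ} [hp : Fact p.Prime] {n : ℤ} (h : ¬ (p : ℤ) ∣ n) : IsCoprime n (p : ℤ) :=
  ((Nat.prime_iff_prime_int.mp hp.out).irreducible.coprime_iff_not_dvd.mpr h).symm

theorem gen_of_coatom {G : Type*} [Group G] [Finite G] {p : ℕ} [hp : Fact p.Prime]
    (hG : IsPGroup p G) {U : Subgroup G} (hU : IsCoatom U) {g : G} (hg : g ∉ U) : Gen p U g := by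
  have := hG.isNilpotent
  have hnor : U.Normal := Subgroup.NormalizerCondition.normal_of_coatom U Group.normalizerCondition_of_isNilpotent hU
  have gen : ∀ y, y ∉ U → ∀ x : G, ∃ n : ℤ, x * y ^ n ∈ U := by
    intro y hy x
    have : U ⊔ Subgroup.zpowers y = ⊤ := hU.2 _ (by
      rw [left_lt_sup]; intro h; exact hy (h (Subgroup.mem_zpowers y)))
    have hx : x ∈ U ⊔ Subgroup.zpowers y := by rw [this]; trivial
    obtain ⟨u, hu, z, ⟨n, rfl⟩, rfl⟩ := Subgroup.mem_sup_of_normal_left.mp hx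
    exact ⟨-n, by simpa using hu⟩
  refine ⟨hnor, ?_, ?_, gen g hg⟩
  · by_contra h
    obtain ⟨n, hn⟩ := gen _ h g
    refine hg (mem_of_coprime hG (n := 1 + p * n) ⟨1, -n, by ring⟩ ?_)
    rwa [zpow_add, zpow_mul, zpow_one, zpow_natCast]
  · intro n hn
    by_contra h
    exact hg (mem_of_coprime hG (coprime_of h) hn)

theorem gen_mul {G : Type*} [Group G] {p : ℕ} {U : Subgroup G} {g b : G} (hg : Gen p U g)
    (hb : b ∈ U) : Gen p U (b * g) := by
  have := hg.nor
  have e : ∀ x : G, x ∈ U ↔ (QuotientGroup.mk' U x) = 1 := fun x => by simp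
  have e1 : QuotientGroup.mk' U (b * g) = QuotientGroup.mk' U g := by
    rw [map_mul, (e b).1 hb, one_mul]
  refine ⟨hg.nor, ?_, ?_, ?_⟩
  · rw [e, map_pow, e1, ← map_pow, ← e]; exact hg.pow
  · intro n; rw [e, map_zpow, e1, ← map_zpow, ← e]; exact hg.dvd n
  · intro x
    obtain ⟨n, hn⟩ := hg.gen x
    refine ⟨n, ?_⟩
    rw [e, map_mul, map_zpow, e1, ← map_zpow, ← map_mul, ← e]; exact hn

theorem norm_hom {G : Type*} [Group G] {A : Subgroup G} (hA : A.Normal)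
    (hc : ∀ a ∈ A, ∀ b ∈ A, a * b = b * a) (g : G) (p : ℕ) :
    ∃ N : A →* A, ∀ s : A, (N s : G) = (s * g) ^ p * (g ^ p)⁻¹ := by
  let ν : ℕ → G → G := fun n s => (s * g) ^ n * (g ^ n)⁻¹
  have νs : ∀ n s, ν (n + 1) s = ν n s * (g ^ n * s * (g ^ n)⁻¹) := by
    intro n s; simp only [ν, pow_succ]; group
  have νmem : ∀ n, ∀ s ∈ A, ν n s ∈ A := by
    intro n s hs
    induction n with
    | zero => simp [ν, A.one_mem]
    | succ n ih => rw [νs]; exact A.mul_mem ih (hA.conj_mem _ hs _)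
  have νmul : ∀ n, ∀ s ∈ A, ∀ t ∈ A, ν n (s * t) = ν n s * ν n t := by
    intro n s hs t ht
    induction n with
    | zero => simp [ν]
    | succ n ih =>
      rw [νs, νs, νs, ih]
      have := hc _ (νmem n t ht) _ (hA.conj_mem _ hs (g ^ n))
      calc ν n s * ν n t * (g ^ n * (s * t) * (g ^ n)⁻¹)
          = ν n s * (ν n t * (g ^ n * s * (g ^ n)⁻¹)) * (g ^ n * t * (g ^ n)⁻¹) := by group
        _ = _ := by rw [this]; group
  let N : A →* A := MonoidHom.mk' (fun s => ⟨ν p s, νmem p s s.2⟩) (by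
    intro a b; ext; exact νmul p a a.2 b b.2)
  exact ⟨N, fun s => rfl⟩

theorem norm_surj {G : Type*} [Group G] [Finite G] {p : ℕ} {U A : Subgroup G} {g : G}
    (hg : Gen p U g) (hA : A.Normal) (hAU : A ≤ U) (hcU : ∀ a ∈ A, ∀ u ∈ U, a * u = u * a)
    (H : ∀ s ∈ A, (s * g) ^ p = g ^ p → ∃ c ∈ A, s * g = c * g * c⁻¹) :
    ∀ t ∈ A, t * g = g * t → ∃ s ∈ A, (s * g) ^ p = t * g ^ p := by
  have hc : ∀ a ∈ A, ∀ b ∈ A, a * b = b * a := fun a ha b hb => hcU a ha b (hAU hb)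
  let ν : ℕ → G → G := fun n s => (s * g) ^ n * (g ^ n)⁻¹
  obtain ⟨N, hN⟩ := norm_hom hA hc g p
  let D : A →* A := MonoidHom.mk' (fun c => ⟨c * (g * (c : G)⁻¹ * g⁻¹), 
      A.mul_mem c.2 (hA.conj_mem _ (A.inv_mem c.2) _)⟩) (by
    intro a b; ext
    have h1 := hc _ b.2 _ (hA.conj_mem _ (A.inv_mem a.2) g)
    have h2 := hc _ a.2 _ b.2
    have h3 := hc _ (A.inv_mem a.2) _ (A.inv_mem b.2)
    simp only [Subgroup.coe_mul, mul_inv_rev]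
    calc (a : G) * b * (g * ((b : G)⁻¹ * (a : G)⁻¹) * g⁻¹)
        = a * (b * (g * (a : G)⁻¹ * g⁻¹)) * (g * (b : G)⁻¹ * g⁻¹) := by rw [← h3]; group
      _ = _ := by rw [h1]; group)
  have k1 : N.ker ≤ D.range := by
    intro s hs
    have hs' : ν p s = 1 := (hN s).symm.trans (congrArg Subtype.val (MonoidHom.mem_ker.mp hs))
    obtain ⟨c, hcA, e⟩ := H s s.2 (by simpa [ν, mul_inv_eq_one] using hs')
    refine ⟨⟨c, hcA⟩, ?_⟩
    ext
    change c * (g * c⁻¹ * g⁻¹) = s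
    rw [← eq_mul_inv_iff_mul_eq] at e
    rw [e]; group
  have k2 : N.range ≤ D.ker := by
    rintro _ ⟨s, rfl⟩
    rw [MonoidHom.mem_ker]
    ext
    change (N s : G) * (g * (N s : G)⁻¹ * g⁻¹) = 1
    have νmem : ν p s ∈ A := by
      have := (N s).2
      rwa [hN] at this
    rw [show (N s : G) = ν p s from hN s]
    have e1 : g ^ p * s * (g ^ p)⁻¹ = s := by rw [← hcU s s.2 _ hg.pow]; group
    have e2 : (s : G) * (g * ν p s * g⁻¹) = ν p s * s := by
      have e5 : (s : G) * (g ^ p)⁻¹ = (g ^ p)⁻¹ * s :=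
        (Commute.inv_right (show Commute (s : G) (g ^ p) from hcU s s.2 _ hg.pow)).eq
      calc (s : G) * (g * ((s * g) ^ p * (g ^ p)⁻¹) * g⁻¹)
          = ((s * g) * (s * g) ^ p) * ((g ^ p)⁻¹ * g⁻¹) := by group
        _ = (s * g) ^ p * (s * (g ^ p)⁻¹) := by rw [← pow_succ', pow_succ]; group
        _ = (s * g) ^ p * (g ^ p)⁻¹ * s := by rw [e5, mul_assoc]
    rw [← hc _ s.2 _ νmem] at e2
    have e3 := mul_left_cancel e2
    have e4 : g * (ν p s)⁻¹ * g⁻¹ = (g * ν p s * g⁻¹)⁻¹ := by group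
    rw [e4, e3, mul_inv_cancel]
  have k3 : N.range = D.ker := by
    have c1 := N.ker.card_mul_index
    have c2 := D.ker.card_mul_index
    rw [Subgroup.index_ker] at c1 c2
    apply Subgroup.eq_of_le_of_card_ge k2
    have c3 := Subgroup.card_le_of_le k1
    have c4 : 0 < Nat.card D.range := Nat.card_pos
    by_contra hlt
    push Not at hlt
    have c5 := Nat.mul_lt_mul_of_le_of_lt c3 hlt c4
    rw [c1, mul_comm, c2] at c5
    exact lt_irrefl _ c5
  intro t ht htg
  have : (⟨t, ht⟩ : A) ∈ N.range := by
    rw [k3, MonoidHom.mem_ker]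
    ext
    change t * (g * t⁻¹ * g⁻¹) = 1
    calc t * (g * t⁻¹ * g⁻¹) = (t * g) * t⁻¹ * g⁻¹ := by group
      _ = 1 := by rw [htg]; group
  obtain ⟨s, hs⟩ := this
  refine ⟨s, s.2, ?_⟩
  have := congrArg Subtype.val hs
  rw [hN] at this
  change (s * g) ^ p * (g ^ p)⁻¹ = t at this
  rw [← this]; group

def H1 {G : Type*} [Group G] (A : Subgroup G) : Prop :=
  ∀ F : G →* G, (∀ a ∈ A, F a = a) → (∀ x, F x * x⁻¹ ∈ A) → ∃ c ∈ A, ∀ x, F x = c * x * c⁻¹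

theorem mod_of_gen {G : Type*} [Group G] {p : ℕ} {U A : Subgroup G} {g : G}
    (hg : Gen p U g) (hA : A.Normal) (F : G →* G) (hU : ∀ u ∈ U, F u * u⁻¹ ∈ A)
    (h : F g * g⁻¹ ∈ A) : ∀ x, F x * x⁻¹ ∈ A := by
  have e : ∀ x : G, F x * x⁻¹ ∈ A ↔ x ∈ ((QuotientGroup.mk' A).comp F).eqLocus (QuotientGroup.mk' A) := by
    intro x
    have e0 : F x * x⁻¹ ∈ A ↔ QuotientGroup.mk' A (F x * x⁻¹) = 1 :=
      (QuotientGroup.eq_one_iff _).symm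
    rw [e0, map_mul, map_inv, mul_inv_eq_one]
    rfl
  intro x
  obtain ⟨n, hn⟩ := hg.gen x
  rw [e]
  have h1 := (e _).1 (hU _ hn)
  have h2 := (e _).1 h
  have := mul_mem h1 (inv_mem (zpow_mem h2 n))
  simpa using this

theorem norm_surj' {G : Type*} [Group G] [Finite G] {p : ℕ} {U A : Subgroup G} {g : G}
    (hg : Gen p U g) (hA : A.Normal) (hAU : A ≤ U) (hcU : ∀ a ∈ A, ∀ u ∈ U, a * u = u * a)
    (H : ∀ F : G →* G, (∀ u ∈ U, F u = u) → (∀ x, F x * x⁻¹ ∈ A) → ∃ c ∈ A, ∀ x, F x = c * x * c⁻¹) :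
    ∀ t ∈ A, t * g = g * t → ∃ s ∈ A, (s * g) ^ p = t * g ^ p := by
  refine norm_surj hg hA hAU hcU ?_
  intro s hs hsp
  obtain ⟨F, hF, hFg⟩ := ext_hom hg U.subtype (s * g) (by
    intro u hu hu'
    have := hcU s hs _ hu'
    calc s * g * u * (s * g)⁻¹ = s * (g * u * g⁻¹) * s⁻¹ := by group
      _ = g * u * g⁻¹ := by rw [this]; group) hsp
  have hF' : ∀ u ∈ U, F u = u := fun u hu => hF ⟨u, hu⟩
  obtain ⟨c, hc, h⟩ := H F hF' (mod_of_gen hg hA F (fun u hu => by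
    rw [hF' u hu, mul_inv_cancel]; exact A.one_mem) (by rw [hFg]; simpa using hs))
  exact ⟨c, hc, by rw [← h, hFg]⟩

theorem lemmaE {G : Type*} [Group G] [Finite G] {p : ℕ} {U A : Subgroup G} {g : G}
    (hg : Gen p U g) (hA : A.Normal) (hAU : A ≤ U) (hcA : ∀ a ∈ A, ∀ b ∈ A, a * b = b * a)
    (H : H1 A) (θ : U →* G) (hθ : ∀ u : U, θ u * (u : G)⁻¹ ∈ A) (b : G) (hb : b ∈ A)
    (h1 : ∀ (u : G) (hu : u ∈ U) (hu' : g * u * g⁻¹ ∈ U),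
      (b * g) * θ ⟨u, hu⟩ * (b * g)⁻¹ = θ ⟨g * u * g⁻¹, hu'⟩) :
    ∃ F : G →* G, (∀ u : U, F u = θ u) ∧ ∀ x, F x * x⁻¹ ∈ A := by
  have hnor := hg.nor
  set h := b * g with hh
  have hgh : Gen p U h := gen_mul hg (hAU hb)
  let A0 := A ⊓ Subgroup.centralizer (U : Set G)
  have hA0 : A0.Normal := inferInstance
  have memA0 : ∀ x, x ∈ A0 ↔ x ∈ A ∧ ∀ u ∈ U, u * x = x * u := by
    intro x; simp [A0, Subgroup.mem_centralizer_iff]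
  let t := h ^ p * (θ ⟨g ^ p, hg.pow⟩)⁻¹
  have htA : t ∈ A := by
    have e : ∀ x : G, x ∈ A ↔ (QuotientGroup.mk' A x) = 1 := fun x => by simp
    have e1 : QuotientGroup.mk' A h = QuotientGroup.mk' A g := by
      rw [hh, map_mul, (e b).1 hb, one_mul]
    have e2 := (e _).1 (hθ ⟨g ^ p, hg.pow⟩)
    rw [map_mul, map_inv, mul_inv_eq_one] at e2
    rw [e, map_mul, map_inv, mul_inv_eq_one, e2, map_pow, e1, map_pow]
  have hpow : ∀ n : ℕ, ∀ (u : G) (hu : u ∈ U), 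
      h ^ n * θ ⟨u, hu⟩ * (h ^ n)⁻¹ = θ ⟨g ^ n * u * (g ^ n)⁻¹, hnor.conj_mem u hu _⟩ := by
    intro n
    induction n with
    | zero => intro u hu; simp
    | succ n ih =>
      intro u hu
      have := ih _ (hnor.conj_mem u hu g)
      rw [← h1 u hu (hnor.conj_mem u hu g)] at this
      calc _ = h ^ n * (h * θ ⟨u, hu⟩ * h⁻¹) * (h ^ n)⁻¹ := by rw [pow_succ]; group
        _ = _ := by rw [this]; congr 2; rw [pow_succ]; group
  have chk : Commute h (θ ⟨g ^ p, hg.pow⟩) := by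
    have := h1 (g ^ p) hg.pow (hnor.conj_mem _ hg.pow _)
    have e2 : (⟨g * g ^ p * g⁻¹, hnor.conj_mem _ hg.pow _⟩ : U) = ⟨g ^ p, hg.pow⟩ := by 
      ext
      change g * g ^ p * g⁻¹ = g ^ p
      group
    rw [e2, mul_inv_eq_iff_eq_mul] at this
    exact this
  have hth : t * h = h * t := ((Commute.refl h).pow_right p |>.mul_right chk.inv_right).eq.symm
  have htθ : ∀ u : U, t * θ u = θ u * t := by
    intro u
    have := hpow p u u.2
    have e2 : (⟨g ^ p * u * (g ^ p)⁻¹, hnor.conj_mem u u.2 _⟩ : U) 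
      = ⟨g ^ p, hg.pow⟩ * u * ⟨g ^ p, hg.pow⟩⁻¹ := by ext; simp
    rw [e2, map_mul, map_mul, map_inv] at this
    set k := θ ⟨g ^ p, hg.pow⟩
    have e3 : t = k⁻¹ * h ^ p := ((chk.pow_left p).inv_right).eq
    calc t * θ u = k⁻¹ * (h ^ p * θ u * (h ^ p)⁻¹) * h ^ p := by rw [e3]; group
      _ = θ u * t := by rw [this, e3]; group
  have htU : ∀ u ∈ U, t * u = u * t := by
    intro u hu
    have e1 := htθ ⟨u, hu⟩
    have e2 := hcA _ htA _ (A.inv_mem (hθ ⟨u, hu⟩))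
    calc t * u = t * (θ ⟨u, hu⟩ * u⁻¹)⁻¹ * θ ⟨u, hu⟩ := by group
      _ = (θ ⟨u, hu⟩ * u⁻¹)⁻¹ * (t * θ ⟨u, hu⟩) := by rw [e2, mul_assoc]
      _ = u * t := by rw [e1]; group
  obtain ⟨s, hs, hsp⟩ := norm_surj' hgh hA0 (fun x hx => hAU hx.1)
    (fun a ha u hu => (((memA0 a).1 ha).2 u hu).symm) (by
      intro F hFU hF
      obtain ⟨c, hcA', hc⟩ := H F (fun a ha => hFU a (hAU ha)) (fun x => (hF x).1)
      refine ⟨c, (memA0 c).2 ⟨hcA', fun u hu => ?_⟩, hc⟩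
      have := hc u
      rw [hFU u hu, eq_mul_inv_iff_mul_eq] at this
      exact this) t⁻¹ ((memA0 _).2 ⟨A.inv_mem htA, fun u hu => 
        (Commute.inv_left (show Commute t u from htU u hu)).eq.symm⟩)
        (Commute.inv_left (show Commute t h from hth)).eq
  have hsA := (memA0 s).1 hs
  obtain ⟨F, hF, hFg⟩ := ext_hom hg θ (s * h) (by
    intro u hu hu'
    rw [← h1 u hu hu']
    have e0 : h * θ ⟨u, hu⟩ * h⁻¹ ∈ U := by
      refine hnor.conj_mem _ ?_ _
      have := U.mul_mem (hAU (hθ ⟨u, hu⟩)) hu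
      simpa using this
    have := hsA.2 _ e0
    calc s * h * θ ⟨u, hu⟩ * (s * h)⁻¹ = s * (h * θ ⟨u, hu⟩ * h⁻¹) * s⁻¹ := by group
      _ = _ := by rw [← this]; group) (by
    rw [hsp]; simp [t])
  refine ⟨F, hF, mod_of_gen hg hA F (fun u hu => ?_) ?_⟩
  · rw [hF ⟨u, hu⟩]; exact hθ ⟨u, hu⟩
  · rw [hFg, hh]
    have := A.mul_mem hsA.1 hb
    simpa [mul_assoc] using this

theorem two_hom {G : Type*} [Group G] {A : Subgroup G} (hA : A.Normal)
    (hcA : ∀ a ∈ A, ∀ b ∈ A, a * b = b * a) (H : H1 A) (σ τ : G →* G)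
    (hσ : ∀ x, σ x * x⁻¹ ∈ A) (hτ : ∀ x, τ x * x⁻¹ ∈ A) (hst : ∀ a ∈ A, σ a = τ a) :
    ∃ c ∈ A, ∀ x, τ x = c * σ x * c⁻¹ := by
  -- conjugation on `A` by `σ x` and `x` agree
  have conj_eq : ∀ (y x : G), y * x⁻¹ ∈ A → ∀ a ∈ A, y * a * y⁻¹ = x * a * x⁻¹ := by
    intro y x hyx a ha
    have := hcA _ hyx _ (hA.conj_mem a ha x)
    calc y * a * y⁻¹ = (y * x⁻¹) * (x * a * x⁻¹) * (y * x⁻¹)⁻¹ := by group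
      _ = _ := by rw [this]; group
  have hδ : ∀ x, τ x * (σ x)⁻¹ ∈ A := by
    intro x
    have := A.mul_mem (hτ x) (A.inv_mem (hσ x))
    simpa using this
  let θ : G →* G := MonoidHom.mk' (fun x => τ x * (σ x)⁻¹ * x) (by
    intro x y
    rw [map_mul, map_mul]
    have e1 := conj_eq _ _ (hτ x) _ (hδ y)
    have e2 := hcA _ (hδ x) _ (hA.conj_mem _ (hδ y) x)
    calc τ x * τ y * (σ x * σ y)⁻¹ * (x * y)
        = (τ x * (τ y * (σ y)⁻¹) * (τ x)⁻¹) * (τ x * (σ x)⁻¹) * x * y := by group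
      _ = τ x * (σ x)⁻¹ * (x * (τ y * (σ y)⁻¹) * x⁻¹) * x * y := by rw [e1, ← e2]
      _ = _ := by group)
  obtain ⟨c, hc, h⟩ := H θ (fun a ha => by
    change τ a * (σ a)⁻¹ * a = a
    rw [hst a ha]; group) (fun x => by
    change τ x * (σ x)⁻¹ * x * x⁻¹ ∈ A
    simpa using hδ x)
  refine ⟨c, hc, fun x => ?_⟩
  have h' : τ x * (σ x)⁻¹ * x = c * x * c⁻¹ := h x
  have e1 := conj_eq _ _ (hσ x) _ (A.inv_mem hc)
  calc τ x = (τ x * (σ x)⁻¹ * x) * x⁻¹ * σ x := by group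
    _ = c * (x * c⁻¹ * x⁻¹) * σ x := by rw [h']; group
    _ = _ := by rw [← e1]; group

theorem descent {G : Type*} [Group G] [Finite G] {p : ℕ} [hp : Fact p.Prime] (hG : IsPGroup p G)
    {U A : Subgroup G} {g : G}
    (hg : Gen p U g) (hA : A.Normal) (hAU : A ≤ U) (hcA : ∀ a ∈ A, ∀ b ∈ A, a * b = b * a)
    (H : H1 A) : H1 (A.subgroupOf U) := by
  have hnor := hg.nor
  let Γ : Subgroup (MulAut U) :=
    { carrier := {θ | (∀ u : U, (u : G) ∈ A → θ u = u) ∧ ∀ u : U, (θ u : G) * (u : G)⁻¹ ∈ A}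
      one_mem' := ⟨fun _ _ => rfl, fun u => by simp [A.one_mem]⟩
      mul_mem' := by
        rintro a b ⟨ha, ha'⟩ ⟨hb, hb'⟩
        refine ⟨fun u hu => by rw [MulAut.mul_apply, hb u hu, ha u hu], fun u => ?_⟩
        have := A.mul_mem (ha' (b u)) (hb' u)
        simpa using this
      inv_mem' := by
        rintro a ⟨ha, ha'⟩
        refine ⟨fun u hu => ?_, fun u => ?_⟩
        · conv_lhs => rw [← ha u hu]
          exact MulAut.inv_apply_self _ a u
        · have := A.inv_mem (ha' (a⁻¹ u))
          rw [MulAut.apply_inv_self] at this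
          simpa using this }
  let P : Subgroup (MulAut U) := (A.subgroupOf U).map MulAut.conj
  have memP : ∀ θ, θ ∈ P ↔ ∃ c : U, (c : G) ∈ A ∧ ∀ u, θ u = c * u * c⁻¹ := by
    intro θ
    constructor
    · rintro ⟨c, hc, rfl⟩
      exact ⟨c, hc, fun u => rfl⟩
    · rintro ⟨c, hc, h⟩
      refine ⟨c, hc, ?_⟩
      ext u
      rw [h]; rfl
  have hΓconj : ∀ (x : G) (θ : MulAut U), θ ∈ Γ → 
      MulAut.conjNormal x * θ * (MulAut.conjNormal x)⁻¹ ∈ Γ := by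
    rintro x θ ⟨h1, h2⟩
    constructor
    · intro u hu
      rw [MulAut.mul_apply, MulAut.mul_apply, h1, ← MulAut.mul_apply, mul_inv_cancel, MulAut.one_apply]
      rw [MulAut.conjNormal_inv_apply]
      simpa using hA.conj_mem _ hu x⁻¹
    · intro u
      have := hA.conj_mem _ (h2 ((MulAut.conjNormal x)⁻¹ u)) x
      rw [MulAut.mul_apply, MulAut.mul_apply, MulAut.conjNormal_apply]
      rw [MulAut.conjNormal_inv_apply] at this
      convert this using 1
      group
  have hPconj : ∀ (x : G) (θ : MulAut U), θ ∈ P → 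
      MulAut.conjNormal x * θ * (MulAut.conjNormal x)⁻¹ ∈ P := by
    intro x θ h
    obtain ⟨c, hc, h⟩ := (memP θ).1 h
    rw [memP]
    refine ⟨MulAut.conjNormal x c, by rw [MulAut.conjNormal_apply]; exact hA.conj_mem _ hc x, fun u => ?_⟩
    rw [MulAut.mul_apply, MulAut.mul_apply, h, map_mul, map_mul, map_inv, MulAut.apply_inv_self]
  have hΓp : IsPGroup p Γ := by
    obtain ⟨k, hk⟩ := IsPGroup.iff_card.mp (hG.to_subgroup U)
    intro θ
    refine ⟨k, ?_⟩
    ext u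
    have key : ∀ n : ℕ, ((θ : MulAut U) ^ n) u = (θ.1 u * u⁻¹) ^ n * u := by
      intro n
      induction n with
      | zero => simp
      | succ n ih =>
        rw [pow_succ', MulAut.mul_apply, ih, map_mul, map_pow, 
          θ.2.1 (θ.1 u * u⁻¹) (by simpa using θ.2.2 u), pow_succ]
        group
    have := key (p ^ k)
    rw [← hk, pow_card_eq_one', one_mul] at this
    simp only [Subgroup.coe_pow, Subgroup.coe_one, MulAut.one_apply]
    rw [← hk, this]
  have hΓP : Γ ≤ P := by
    by_contra hne
    let act : MulAction G Γ :=
      { smul := fun x θ => ⟨_, hΓconj x θ θ.2⟩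
        one_smul := fun θ => by
          apply Subtype.ext
          change MulAut.conjNormal (1 : G) * (θ : MulAut U) * (MulAut.conjNormal (1 : G))⁻¹ = (θ : MulAut U)
          simp
        mul_smul := fun x y θ => by
          apply Subtype.ext
          change MulAut.conjNormal (x * y) * (θ : MulAut U) * (MulAut.conjNormal (x * y))⁻¹ = 
            MulAut.conjNormal x * (MulAut.conjNormal y * (θ : MulAut U) * (MulAut.conjNormal y)⁻¹) * (MulAut.conjNormal x)⁻¹
          rw [map_mul]; group }
    have smul_def : ∀ (x : G) (θ : Γ), ((x • θ : Γ) : MulAut U) =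
      MulAut.conjNormal x * (θ : MulAut U) * (MulAut.conjNormal x)⁻¹ := fun _ _ => rfl
    have qa : MulAction.QuotientAction G (P.subgroupOf Γ) := ⟨by
      intro x a b hab
      rw [Subgroup.mem_subgroupOf] at hab ⊢
      have := hPconj x _ hab
      simp only [Subgroup.coe_mul, Subgroup.coe_inv, smul_def] at this ⊢
      convert this using 1
      group⟩
    have hdvd : p ∣ Nat.card (Γ ⧸ P.subgroupOf Γ) := by
      obtain ⟨n, hn⟩ := hΓp.index (P.subgroupOf Γ)
      have h1 : (P.subgroupOf Γ).index ≠ 1 := by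
        rw [Ne, Subgroup.index_eq_one, Subgroup.subgroupOf_eq_top]; exact hne
      change p ∣ (P.subgroupOf Γ).index
      rw [hn] at h1 ⊢
      exact dvd_pow_self p (by rintro rfl; simp at h1)
    have hfix1 : ((1 : Γ) : Γ ⧸ P.subgroupOf Γ) ∈ MulAction.fixedPoints G (Γ ⧸ P.subgroupOf Γ) := by
      intro x
      rw [MulAction.Quotient.smul_coe]
      congr 1
      apply Subtype.ext
      rw [smul_def]; simp
    obtain ⟨q, hq, hq1⟩ := hG.exists_fixed_point_of_prime_dvd_card_of_fixed_point _ hdvd hfix1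
    induction q using QuotientGroup.induction_on with
    | H θ =>
    have hθP : (θ : MulAut U) ∉ P := by
      intro h
      apply hq1
      rw [QuotientGroup.eq, inv_one, one_mul, Subgroup.mem_subgroupOf]; exact h
    have h1 := hq g
    rw [MulAction.Quotient.smul_coe, eq_comm, QuotientGroup.eq, Subgroup.mem_subgroupOf] at h1
    obtain ⟨a, haA, ha⟩ := (memP _).1 h1
    simp only [Subgroup.coe_mul, Subgroup.coe_inv, smul_def] at ha
    obtain ⟨F, hF, hFm⟩ := lemmaE hg hA hAU hcA H (U.subtype.comp θ.1.toMonoidHom) θ.2.2 ((a : G)⁻¹)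
      (A.inv_mem haA) (by
        intro u hu hu'
        have h2 := ha ⟨g * u * g⁻¹, hu'⟩
        have h3 : (MulAut.conjNormal g)⁻¹ (⟨g * u * g⁻¹, hu'⟩ : U) = ⟨u, hu⟩ := by
          ext; rw [MulAut.conjNormal_inv_apply]; group
        rw [MulAut.mul_apply, MulAut.mul_apply, MulAut.mul_apply, h3] at h2
        have h4 := congrArg (fun z => ((θ.1 z : U) : G)) h2
        simp only [MulAut.apply_inv_self, map_mul, map_inv, MulAut.conjNormal_apply, θ.2.1 a haA] at h4
        simp only [MonoidHom.comp_apply, MulEquiv.coe_toMonoidHom, Subgroup.coe_subtype]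
        simp only [Subgroup.coe_mul, Subgroup.coe_inv] at h4
        calc _ = (a : G)⁻¹ * (g * (θ.1 ⟨u, hu⟩ : G) * g⁻¹) * a := by group
          _ = _ := by rw [h4]; group)
    obtain ⟨c, hc, hcF⟩ := H F (fun x hx => by
      have := hF ⟨x, hAU hx⟩
      simp only [MonoidHom.comp_apply, MulEquiv.coe_toMonoidHom, Subgroup.coe_subtype] at this
      rw [this, θ.2.1 ⟨x, hAU hx⟩ hx]) hFm
    apply hθP
    rw [memP]
    refine ⟨⟨c, hAU hc⟩, hc, fun u => ?_⟩
    ext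
    have := hF u
    rw [hcF] at this
    exact this.symm
  intro F hF1 hF2
  have hinj : Function.Injective F := by
    rw [injective_iff_map_eq_one]
    intro x hx
    have := hF2 x
    rw [hx, one_mul] at this
    rw [← hF1 x (by simpa using this), hx]
  let θ : MulAut U := MulEquiv.ofBijective F (Finite.injective_iff_bijective.mp hinj)
  have hθ : ∀ u, θ u = F u := fun _ => rfl
  obtain ⟨c, hc, h⟩ := (memP θ).1 (hΓP ⟨fun u hu => hF1 u hu, fun u => hF2 u⟩)
  exact ⟨c, hc, h⟩

theorem split (n : ℕ) : ∀ {G : Type*} [Group G] [Finite G] {p : ℕ} [Fact p.Prime] (_ : IsPGroup p G)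
    (A : Subgroup G) (_ : A.Normal) (_ : ∀ a ∈ A, ∀ b ∈ A, a * b = b * a)
    (_ : H1 A) (_ : Nat.card G = n), ∃ π : G →* G, (∀ a ∈ A, π a = 1) ∧ ∀ x, π x * x⁻¹ ∈ A := by
  induction n using Nat.strong_induction_on with
  | _ n ih =>
  intro G _ _ p _ hG A hA hcA H hn
  by_cases hAt : A = ⊤
  · exact ⟨1, fun _ _ => rfl, fun x => by rw [hAt]; trivial⟩
  obtain ⟨U, hU, hAU⟩ := (eq_top_or_exists_le_coatom A).resolve_left hAt
  obtain ⟨g, hgU⟩ : ∃ g, g ∉ U := by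
    by_contra! h
    exact hU.1 (eq_top_iff.2 fun x _ => h x)
  have hg := gen_of_coatom hG hU hgU
  have hnor := hg.nor
  have HU := descent hG hg hA hAU hcA H
  have hA' : (A.subgroupOf U).Normal := inferInstance
  have hcA' : ∀ a ∈ A.subgroupOf U, ∀ b ∈ A.subgroupOf U, a * b = b * a := by
    intro a ha b hb; ext; exact hcA a ha b hb
  have hlt : Nat.card U < n := by
    rw [← hn]
    refine lt_of_le_of_ne (Subgroup.card_le_card_group U) fun h => hU.1 (Subgroup.eq_top_of_card_eq U h)
  obtain ⟨π, hπ1, hπ2⟩ := ih _ hlt (hG.to_subgroup U) _ hA' hcA' HU rfl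
  let c : MulAut U := MulAut.conjNormal g
  let σ : U →* U := (c.toMonoidHom.comp π).comp (c⁻¹).toMonoidHom
  have hσ : ∀ u, σ u = c (π (c⁻¹ u)) := fun _ => rfl
  have hc : ∀ u : U, (c u : G) = g * u * g⁻¹ := fun u => MulAut.conjNormal_apply g u
  have hc' : ∀ u : U, ((c⁻¹ u : U) : G) = g⁻¹ * u * g := fun u => MulAut.conjNormal_inv_apply g u
  have memA' : ∀ u : U, u ∈ A.subgroupOf U → c⁻¹ u ∈ A.subgroupOf U := by
    intro u hu
    rw [Subgroup.mem_subgroupOf] at hu ⊢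
    rw [hc']; simpa using hA.conj_mem _ hu g⁻¹
  obtain ⟨b, hb, hbσ⟩ := two_hom hA' hcA' HU σ π (by
    intro u
    have := hπ2 (c⁻¹ u)
    rw [Subgroup.mem_subgroupOf] at this ⊢
    have := hA.conj_mem _ this g
    simp only [Subgroup.coe_mul, Subgroup.coe_inv, hc', hσ, hc] at this ⊢
    convert this using 1
    group) hπ2 (by
    intro a ha
    rw [hσ, hπ1 a ha, hπ1 _ (memA' a ha), map_one])
  obtain ⟨F, hF, hFm⟩ := lemmaE hg hA hAU hcA H (U.subtype.comp π) hπ2 b hb (by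
    intro u hu hu'
    have h2 := hbσ ⟨g * u * g⁻¹, hu'⟩
    have h3 : c⁻¹ (⟨g * u * g⁻¹, hu'⟩ : U) = ⟨u, hu⟩ := by
      ext; rw [hc']; group
    rw [hσ, h3] at h2
    simp only [MonoidHom.comp_apply, Subgroup.coe_subtype]
    rw [h2]
    simp only [Subgroup.coe_mul, Subgroup.coe_inv, hc]
    group)
  refine ⟨F, fun a ha => ?_, hFm⟩
  rw [hF ⟨a, hAU ha⟩]
  simp only [MonoidHom.comp_apply, Subgroup.coe_subtype]
  rw [hπ1 _ ha]; rfl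

theorem inner_of_hom {G : Type*} [Group G] [Finite G]
    (hin : ∀ φ : MulAut G, ∃ c, ∀ x, φ x = c * x * c⁻¹) (A : Subgroup G) (F : G →* G)
    (h1 : ∀ a ∈ A, F a = a) (h2 : ∀ x, F x * x⁻¹ ∈ A) : ∃ c, ∀ x, F x = c * x * c⁻¹ := by
  have hinj : Function.Injective F := by
    rw [injective_iff_map_eq_one]
    intro x hx
    have := h2 x
    rw [hx, one_mul] at this
    rw [← h1 x (by simpa using this), hx]
  exact hin (MulEquiv.ofBijective F (Finite.injective_iff_bijective.mp hinj))

theorem comm_of_eq {G : Type*} [Group G] {c x : G} (h : x = c * x * c⁻¹) : c * x = x * c :=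
  (eq_mul_inv_iff_mul_eq.mp h).symm

/-- extension by identity on `M` -/
theorem inner_ext {G : Type*} [Group G] [Finite G]
    (hin : ∀ φ : MulAut G, ∃ c, ∀ x, φ x = c * x * c⁻¹) {p : ℕ} {M : Subgroup G} {g : G}
    (hg : Gen p M g) {z : G} (hz : z ∈ M) (hzM : ∀ u ∈ M, z * u = u * z) (hzg : z * g = g * z)
    (hzp : z ^ p = 1) : ∃ c, (∀ u ∈ M, c * u = u * c) ∧ c * g * c⁻¹ = z * g := by
  obtain ⟨F, hF, hFg⟩ := ext_hom hg M.subtype (z * g) (by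
    intro u hu hu'
    have := hzM _ hu'
    calc z * g * u * (z * g)⁻¹ = z * (g * u * g⁻¹) * z⁻¹ := by group
      _ = g * u * g⁻¹ := by rw [this]; group) (by
    rw [(show Commute z g from hzg).mul_pow, hzp, one_mul]; rfl)
  have hF' : ∀ u ∈ M, F u = u := fun u hu => hF ⟨u, hu⟩
  obtain ⟨c, h⟩ := inner_of_hom hin M F hF' (mod_of_gen hg hg.nor F (fun u hu => by
    rw [hF' u hu, mul_inv_cancel]; exact M.one_mem) (by rw [hFg]; simpa using hz))
  refine ⟨c, fun u hu => comm_of_eq ?_, by rw [← h, hFg]⟩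
  rw [← h, hF' u hu]

theorem exists_order_p {G : Type*} [Group G] [Finite G] [Nontrivial G] {p : ℕ} [hp : Fact p.Prime]
    (hG : IsPGroup p G) : ∃ w : G, w ≠ 1 ∧ w ^ p = 1 ∧ ∀ x, w * x = x * w := by
  have := hG.center_nontrivial
  have hZ : IsPGroup p (Subgroup.center G) := hG.to_subgroup _
  have hd : p ∣ Nat.card (Subgroup.center G) := 
    hZ.card_eq_or_dvd.resolve_left (Finite.one_lt_card).ne'
  obtain ⟨w, hw⟩ := exists_prime_orderOf_dvd_card' p hd
  refine ⟨w, ?_, ?_, fun x => (Subgroup.mem_center_iff.mp w.2 x).symm⟩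
  · intro h
    have : w = 1 := Subtype.ext h
    rw [this, orderOf_one] at hw
    exact hp.out.one_lt.ne hw
  · have := pow_orderOf_eq_one w
    rw [hw] at this
    exact congrArg Subtype.val this

theorem cent_le {G : Type*} [Group G] [Finite G] {p : ℕ} [hp : Fact p.Prime]
    (hG : IsPGroup p G) (hcard : p ^ 2 ≤ Nat.card G)
    (hin : ∀ φ : MulAut G, ∃ c, ∀ x, φ x = c * x * c⁻¹) {M : Subgroup G} (hM : IsCoatom M)
    {g : G} (hgM : ∀ u ∈ M, g * u = u * g) : g ∈ M := by
  by_contra hgn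
  have hg := gen_of_coatom hG hM hgn
  have hcen : ∀ x, ∀ c : G, (∀ u ∈ M, c * u = u * c) → c * g = g * c → c * x = x * c := by
    intro x c hc hcg
    obtain ⟨n, hn⟩ := hg.gen x
    have h1 : Commute c (x * g ^ n) := hc _ hn
    have h2 : Commute c (g ^ n) := (show Commute c g from hcg).zpow_right n
    have := h1.mul_right h2.inv_right
    simpa using this.eq
  have hMn : Nontrivial M := by
    rw [Subgroup.nontrivial_iff_ne_bot]
    rintro rfl
    have hgp : g ^ p = 1 := by simpa using hg.pow
    have htop : Subgroup.zpowers g = ⊤ := by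
      rw [eq_top_iff]
      intro x _
      obtain ⟨n, hn⟩ := hg.gen x
      rw [Subgroup.mem_bot, mul_eq_one_iff_eq_inv] at hn
      rw [hn]; exact inv_mem (zpow_mem (Subgroup.mem_zpowers g) n)
    have h1 : Nat.card G ≤ p := by
      rw [← Subgroup.card_top, ← htop, Nat.card_zpowers]
      exact orderOf_le_of_pow_eq_one hp.out.pos hgp
    have := hp.out.one_lt
    nlinarith
  obtain ⟨z, hz1, hzp, hzc⟩ := exists_order_p (hG.to_subgroup M)
  have hzM : ∀ u ∈ M, (z : G) * u = u * z := fun u hu => congrArg Subtype.val (hzc ⟨u, hu⟩)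
  obtain ⟨c, hc, e⟩ := inner_ext hin hg z.2 hzM (hgM _ z.2).symm (congrArg Subtype.val hzp)
  have hgc : c * g = g * c := (hcen c g hgM rfl).symm
  rw [hgc, mul_inv_cancel_right] at e
  exact hz1 (Subtype.ext (by simpa using e.symm))

/-- elements whose commutators lie in the central cyclic group of `w` -/
def Xw {G : Type*} [Group G] (w : G) (hw : ∀ x, w * x = x * w) : Subgroup G where
  carrier := {x | ∀ y, ∃ n : ℤ, x * y * x⁻¹ = w ^ n * y}
  one_mem' := fun y => ⟨0, by simp⟩
  mul_mem' := by
    intro a b ha hb y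
    obtain ⟨n, hn⟩ := hb y
    obtain ⟨m, hm⟩ := ha y
    refine ⟨n + m, ?_⟩
    have : a * w ^ n = w ^ n * a := ((show Commute w a from hw a).zpow_left n).eq.symm
    calc a * b * y * (a * b)⁻¹ = a * (b * y * b⁻¹) * a⁻¹ := by group
      _ = (a * w ^ n) * y * a⁻¹ := by rw [hn]; group
      _ = w ^ n * (a * y * a⁻¹) := by rw [this]; group
      _ = _ := by rw [hm]; group
  inv_mem' := by
    intro a ha y
    obtain ⟨n, hn⟩ := ha y
    refine ⟨-n, ?_⟩
    have : a⁻¹ * w ^ n = w ^ n * a⁻¹ := ((show Commute w a⁻¹ from hw _).zpow_left n).eq.symm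
    have h2 : y = w ^ n * (a⁻¹ * y * a) := by
      calc y = a⁻¹ * (a * y * a⁻¹) * a := by group
        _ = (a⁻¹ * w ^ n) * y * a := by rw [hn]; group
        _ = _ := by rw [this]; group
    rw [inv_inv]
    conv_rhs => rw [h2]
    group

theorem Xw_normal {G : Type*} [Group G] (w : G) (hw : ∀ x, w * x = x * w) : (Xw w hw).Normal := by
  constructor
  intro a ha k y
  obtain ⟨n, hn⟩ := ha (k⁻¹ * y * k)
  refine ⟨n, ?_⟩
  have : k * w ^ n = w ^ n * k := ((show Commute w k from hw k).zpow_left n).eq.symm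
  calc k * a * k⁻¹ * y * (k * a * k⁻¹)⁻¹ = k * (a * (k⁻¹ * y * k) * a⁻¹) * k⁻¹ := by group
    _ = (k * w ^ n) * k⁻¹ * y := by rw [hn]; group
    _ = _ := by rw [this]; group

theorem coatom_cent {G : Type*} [Group G] [Finite G] {p : ℕ} [hp : Fact p.Prime]
    (hG : IsPGroup p G) (hcard : p ^ 2 ≤ Nat.card G)
    (hin : ∀ φ : MulAut G, ∃ c, ∀ x, φ x = c * x * c⁻¹) {M : Subgroup G} (hM : IsCoatom M)
    (w : G) (hw : ∀ x, w * x = x * w) (hw1 : w ≠ 1) (hwp : w ^ p = 1) :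
    ∃ x ∈ Xw w hw, ∀ y, x * y = y * x → y ∈ M := by
  obtain ⟨g, hgM⟩ : ∃ g, g ∉ M := by
    by_contra! h
    exact hM.1 (eq_top_iff.2 fun x _ => h x)
  have hg := gen_of_coatom hG hM hgM
  obtain ⟨c, hc, e⟩ := inner_ext hin hg (cent_le hG hcard hin hM (fun u _ => hw u)) (fun u _ => hw u)
    (hw g) hwp
  have hpow : ∀ n : ℤ, c * g ^ n * c⁻¹ = w ^ n * g ^ n := by
    intro n
    rw [← (show Commute w g from hw g).mul_zpow, ← e, conj_zpow]
  have hform : ∀ (y : G) (n : ℤ), y * g ^ n ∈ M → c * y * c⁻¹ = w ^ (-n) * y := by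
    intro y n hn
    have h1 := hc _ hn
    have h2 := hpow (-n)
    have h3 : (y * g ^ n) * w ^ (-n) = w ^ (-n) * (y * g ^ n) :=
      ((show Commute w _ from hw _).zpow_left _).eq.symm
    calc c * y * c⁻¹ = (c * (y * g ^ n)) * c⁻¹ * (c * g ^ (-n) * c⁻¹) := by group
      _ = (y * g ^ n) * w ^ (-n) * g ^ (-n) := by rw [h1, h2]; group
      _ = _ := by rw [h3]; group
  refine ⟨c, fun y => ?_, fun y hy => ?_⟩
  · obtain ⟨n, hn⟩ := hg.gen y
    exact ⟨_, hform y n hn⟩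
  · by_contra hyM
    have hy' := gen_of_coatom hG hM hyM
    obtain ⟨n, hn⟩ := hy'.gen g
    have h1 : Commute c (g * y ^ n) := hc _ hn
    have h2 : Commute c (y ^ n) := (show Commute c y from hy).zpow_right n
    have h3 := h1.mul_right h2.inv_right
    have h4 : c * g = g * c := by simpa using h3.eq
    rw [h4, mul_inv_cancel_right] at e
    exact hw1 (by simpa using e.symm)

theorem exists_max_abelian {G : Type*} [Group G] [Finite G] {p : ℕ} [hp : Fact p.Prime]
    (hG : IsPGroup p G) (X : Subgroup G) (hX : X.Normal) (hXc : ∀ a ∈ X, ∀ b ∈ X, a * b = b * a) :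
    ∃ A : Subgroup G, X ≤ A ∧ A.Normal ∧ (∀ a ∈ A, ∀ b ∈ A, a * b = b * a) ∧
      ∀ c, (∀ a ∈ A, c * a = a * c) → c ∈ A := by
  obtain ⟨A, hXA, hmax⟩ := Finite.exists_le_maximal
    (p := fun A : Subgroup G => A.Normal ∧ ∀ a ∈ A, ∀ b ∈ A, a * b = b * a) ⟨hX, hXc⟩
  obtain ⟨hA, hcA⟩ := hmax.prop
  refine ⟨A, hXA, hA, hcA, ?_⟩
  by_contra! hcon
  obtain ⟨c, hc, hcn⟩ := hcon
  let C : Subgroup G := Subgroup.centralizer (A : Set G)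
  have hC : ∀ x, x ∈ C ↔ ∀ a ∈ A, a * x = x * a := fun x => by
    simp [C, Subgroup.mem_centralizer_iff]
  have hCn : C.Normal := inferInstance
  let Q := QuotientGroup.mk' A
  let C' : Subgroup (G ⧸ A) := C.map Q
  have hC'n : C'.Normal := hCn.map Q (QuotientGroup.mk'_surjective A)
  have hpQ : IsPGroup p (G ⧸ A) := hG.to_quotient A
  have hnt : Nontrivial C' := by
    refine ⟨⟨⟨Q c, c, (hC c).2 fun a ha => (hc a ha).symm, rfl⟩, 1, fun h => hcn ?_⟩⟩
    have := congrArg Subtype.val h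
    exact (QuotientGroup.eq_one_iff c).1 this
  have hdvd : p ∣ Nat.card C' := (hpQ.to_subgroup C').card_eq_or_dvd.resolve_left Finite.one_lt_card.ne'
  have hpQ' : IsPGroup p (ConjAct (G ⧸ A)) := hpQ.of_equiv ConjAct.toConjAct
  obtain ⟨q, hq, hq1⟩ := hpQ'.exists_fixed_point_of_prime_dvd_card_of_fixed_point C' hdvd
    (a := 1) (by intro x; exact smul_one x)
  obtain ⟨q, y, hy, rfl⟩ := q
  have hyA : y ∉ A := fun h => hq1 (Subtype.ext ((QuotientGroup.eq_one_iff y).2 h).symm)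
  have hconj : ∀ k, k * y * k⁻¹ * y⁻¹ ∈ A := by
    intro k
    have := congrArg Subtype.val (hq (ConjAct.toConjAct (Q k)))
    rw [← QuotientGroup.eq_one_iff]
    have h2 : Q k * Q y * (Q k)⁻¹ = Q y := this
    change Q (k * y * k⁻¹ * y⁻¹) = 1
    rw [map_mul, map_mul, map_mul, map_inv, map_inv, h2, mul_inv_cancel]
  let B := A ⊔ Subgroup.zpowers y
  have hyB : y ∈ B := Subgroup.mem_sup_right (Subgroup.mem_zpowers y)
  have hAB : A ≤ B := le_sup_left
  have hB : ∀ b ∈ B, ∃ a ∈ A, ∃ n : ℤ, a * y ^ n = b := by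
    intro b hb
    obtain ⟨a, ha, z, ⟨n, rfl⟩, rfl⟩ := Subgroup.mem_sup_of_normal_left.mp hb
    exact ⟨a, ha, n, rfl⟩
  have hBn : B.Normal := by
    constructor
    intro b hb k
    obtain ⟨a, ha, n, rfl⟩ := hB b hb
    have h1 : k * y * k⁻¹ ∈ B := by
      have := B.mul_mem (hAB (hconj k)) hyB
      simpa using this
    have h2 : k * (a * y ^ n) * k⁻¹ = (k * a * k⁻¹) * (k * y * k⁻¹) ^ n := by
      rw [conj_zpow]; group
    rw [h2]
    exact B.mul_mem (hAB (hA.conj_mem a ha k)) (B.zpow_mem h1 n)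
  have hBc : ∀ a ∈ B, ∀ b ∈ B, a * b = b * a := by
    intro b hb d hd
    obtain ⟨a, ha, n, rfl⟩ := hB b hb
    obtain ⟨a', ha', n', rfl⟩ := hB d hd
    have c1 : Commute a a' := hcA a ha a' ha'
    have c2 : Commute a y := (hC y).1 hy a ha
    have c3 : Commute a' y := (hC y).1 hy a' ha'
    have c4 : Commute a (a' * y ^ n') := c1.mul_right (c2.zpow_right n')
    have c5 : Commute (y ^ n) (a' * y ^ n') := 
      (c3.symm.zpow_left n).mul_right (((Commute.refl y).zpow_left n).zpow_right n')
    exact (c4.mul_left c5).eq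
  exact hyA (hmax.2 ⟨hBn, hBc⟩ hAB hyB)

theorem abelian_case {G : Type*} [Group G] [Finite G] [Nontrivial G] {p : ℕ} [hp : Fact p.Prime]
    (hG : IsPGroup p G) (hcard : p ^ 2 ≤ Nat.card G)
    (hin : ∀ φ : MulAut G, ∃ c, ∀ x, φ x = c * x * c⁻¹) 
    (w : G) (hw : ∀ x, w * x = x * w) (hw1 : w ≠ 1) (hwp : w ^ p = 1) 
    (hX : ∀ a ∈ Xw w hw, ∀ b ∈ Xw w hw, a * b = b * a) : False := by
  obtain ⟨A, hXA, hA, hcA, hCA⟩ := exists_max_abelian hG _ (Xw_normal w hw) hX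
  have H : H1 A := by
    intro F h1 h2
    obtain ⟨c, hc⟩ := inner_of_hom hin A F h1 h2
    refine ⟨c, hCA c fun a ha => comm_of_eq ?_, hc⟩
    rw [← hc, h1 a ha]
  obtain ⟨π, hπ1, hπ2⟩ := split _ hG A hA hcA H rfl
  by_cases htop : π.range = ⊤
  · have hinj : Function.Injective π := 
      Finite.injective_iff_surjective.2 (MonoidHom.range_eq_top.1 htop)
    have hwA : w ∈ A := hCA w fun a _ => hw a
    exact hw1 (hinj (by rw [hπ1 w hwA, map_one]))
  · obtain ⟨M, hM, hle⟩ := (eq_top_or_exists_le_coatom π.range).resolve_left htop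
    obtain ⟨x, hx, hxM⟩ := coatom_cent hG hcard hin hM w hw hw1 hwp
    apply hM.1
    rw [eq_top_iff]
    intro y _
    have h1 : (π y * y⁻¹) ∈ M := hxM _ (hcA _ (hXA hx) _ (hπ2 y))
    have h2 : π y ∈ M := hle ⟨y, rfl⟩
    have := M.mul_mem (M.inv_mem h1) h2
    simpa using this

theorem core {G : Type*} [Group G] [Finite G] {p : ℕ} [hp : Fact p.Prime]
    (hin : ∀ φ : MulAut G, ∃ c, ∀ x, φ x = c * x * c⁻¹)
    (w : G) (hw : ∀ x, w * x = x * w) (hwp : w ^ p = 1)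
    {u v : G} (hu : u ∈ Xw w hw) (hv : v ∈ Xw w hw) (huv : u * v ≠ v * u) :
    ∀ t ∈ Subgroup.center G, ∃ i : ℤ, ∃ z ∈ Subgroup.center G,
      t = ((u * v) ^ p * (v ^ p)⁻¹) ^ i * z ^ p := by
  have cw : ∀ (n : ℤ) (x : G), Commute (w ^ n) x := fun n x => (show Commute w x from hw x).zpow_left n
  obtain ⟨k, hk⟩ := hu v
  have hwpz : ∀ n : ℤ, w ^ ((p : ℤ) * n) = 1 := by
    intro n; rw [zpow_mul, zpow_natCast, hwp, one_zpow]
  have hkp : ¬ (p : ℤ) ∣ k := by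
    rintro ⟨m, rfl⟩
    rw [hwpz, one_mul, mul_inv_eq_iff_eq_mul] at hk
    exact huv hk
  obtain ⟨k', b, hkb⟩ := coprime_of (p := p) hkp
  -- `w = (w ^ k) ^ k'`
  have hww : ∀ m : ℤ, w ^ m = w ^ (k * (k' * m)) := by
    intro m
    have : m = k * (k' * m) + p * (b * m) := by linear_combination (-m) * hkb
    conv_lhs => rw [this, zpow_add, hwpz, mul_one]
  have huvn : ∀ n : ℤ, u * v ^ n * u⁻¹ = w ^ (k * n) * v ^ n := by
    intro n
    rw [← conj_zpow, hk, (cw k v).mul_zpow, zpow_mul]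
  have hw1 : w ≠ 1 := by
    rintro rfl
    rw [one_zpow, one_mul, mul_inv_eq_iff_eq_mul] at hk
    exact huv hk
  have hord : orderOf w = p := orderOf_eq_prime hwp hw1
  let M : Subgroup G := Subgroup.centralizer {u}
  have hM : ∀ x, x ∈ M ↔ u * x * u⁻¹ = x := by
    intro x
    rw [Subgroup.mem_centralizer_singleton_iff, mul_inv_eq_iff_eq_mul]
    exact eq_comm
  have huM : u ∈ M := by rw [hM]; group
  have hnor : M.Normal := by
    constructor
    intro m hm x
    rw [hM] at hm ⊢
    obtain ⟨j, hj⟩ := hu x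
    calc u * (x * m * x⁻¹) * u⁻¹ = (u * x * u⁻¹) * (u * m * u⁻¹) * (u * x * u⁻¹)⁻¹ := by group
      _ = w ^ j * (x * m * x⁻¹) * (w ^ j)⁻¹ := by rw [hj, hm]; group
      _ = _ := by rw [(cw j _).eq]; group
  have hg : Gen p M v := by
    refine ⟨hnor, ?_, ?_, ?_⟩
    · rw [hM]
      have := huvn p
      rw [mul_comm k, hwpz, one_mul] at this
      exact_mod_cast this
    · intro n hn
      rw [hM, huvn] at hn
      have h1 : w ^ (k * n) = 1 := by simpa using hn
      rw [← orderOf_dvd_iff_zpow_eq_one, hord] at h1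
      exact ((Nat.prime_iff_prime_int.mp hp.out).dvd_or_dvd h1).resolve_left hkp
    · intro x
      obtain ⟨m, hm⟩ := hu x
      refine ⟨-(k' * m), ?_⟩
      rw [hM]
      have h1 := huvn (-(k' * m))
      have h2 : w ^ (k * (-(k' * m))) = (w ^ m)⁻¹ := by
        rw [hww m, ← zpow_neg]; congr 1; ring
      rw [h2] at h1
      calc u * (x * v ^ (-(k' * m))) * u⁻¹ = (u * x * u⁻¹) * (u * v ^ (-(k' * m)) * u⁻¹) := by group
        _ = w ^ m * (x * (w ^ m)⁻¹) * v ^ (-(k' * m)) := by rw [hm, h1]; group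
        _ = _ := by rw [← ((cw m x).inv_left).eq]; group
  let A : Subgroup G := Subgroup.centralizer (M : Set G)
  have hA : ∀ x, x ∈ A ↔ ∀ m ∈ M, m * x = x * m := by
    intro x; simp [A, Subgroup.mem_centralizer_iff]
  have hAn : A.Normal := inferInstance
  have hAM : A ≤ M := by
    intro a ha
    rw [hM, (hA a).1 ha u huM]; group
  have hAc : ∀ a ∈ A, ∀ m ∈ M, a * m = m * a := fun a ha m hm => ((hA a).1 ha m hm).symm
  have huA : u ∈ A := by
    rw [hA]
    intro m hm
    rw [hM, mul_inv_eq_iff_eq_mul] at hm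
    exact hm.symm
  intro t ht
  rw [Subgroup.mem_center_iff] at ht
  obtain ⟨s, hs, hst⟩ := norm_surj' hg hAn hAM hAc (by
    intro F h1 h2
    obtain ⟨c, hc⟩ := inner_of_hom hin M F h1 (fun x => hAM (h2 x))
    refine ⟨c, (hA c).2 fun m hm => (comm_of_eq ?_).symm, hc⟩
    rw [← hc, h1 m hm]) t ((hA t).2 fun m _ => ht m) (ht v).symm
  obtain ⟨N, hN⟩ := norm_hom hAn (fun a ha b hb => hAc a ha b (hAM hb)) v p
  obtain ⟨m, hm⟩ := hv s
  -- `v u v⁻¹ = w ^ (-k) u`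
  have hvu : ∀ n : ℤ, v * u ^ n * v⁻¹ = w ^ (-(k * n)) * u ^ n := by
    intro n
    have h1 : v * u * v⁻¹ = w ^ (-k) * u := by
      have : u * v = w ^ k * v * u := mul_inv_eq_iff_eq_mul.mp hk
      calc v * u * v⁻¹ = w ^ (-k) * (w ^ k * v * u) * v⁻¹ := by group
        _ = _ := by rw [← this]; group
    rw [← conj_zpow, h1, (cw _ u).mul_zpow, ← zpow_mul]; congr 2; ring
  -- choose the power
  let i : ℤ := -(k' * m)
  let d := s * u ^ (-i)
  have hdA : d ∈ A := A.mul_mem hs (A.zpow_mem huA _)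
  have hdv : v * d = d * v := by
    have h1 := hvu (-i)
    have h2 : w ^ (-(k * (-i))) = (w ^ m)⁻¹ := by
      rw [hww m, ← zpow_neg]; congr 1; simp only [i]; ring
    rw [h2] at h1
    rw [← mul_inv_eq_iff_eq_mul]
    calc v * d * v⁻¹ = (v * s * v⁻¹) * (v * u ^ (-i) * v⁻¹) := by simp only [d]; group
      _ = w ^ m * (s * (w ^ m)⁻¹) * u ^ (-i) := by rw [hm, h1]; group
      _ = _ := by rw [← ((cw m s).inv_left).eq]; simp only [d]; group
  have hdc : d ∈ Subgroup.center G := by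
    rw [Subgroup.mem_center_iff]
    intro x
    obtain ⟨n, hn⟩ := hg.gen x
    have h1 : Commute d (x * v ^ n) := hAc d hdA _ hn
    have h2 : Commute d (v ^ n) := (show Commute d v from hdv.symm).zpow_right n
    have := h1.mul_right h2.inv_right
    have h3 : d * x = x * d := by simpa using this.eq
    exact h3.symm
  refine ⟨i, d, hdc, ?_⟩
  have e1 : (⟨s, hs⟩ : A) = ⟨u, huA⟩ ^ i * ⟨d, hdA⟩ := by
    ext
    have : Commute (u ^ i) s := ((show Commute u s from (hA s).1 hs u huM).zpow_left i)
    simp only [Subgroup.coe_mul, Subgroup.coe_zpow, d]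
    rw [← mul_assoc, this.eq]; group
  have e2 := congrArg (fun x => (N x : G)) e1
  simp only [map_mul, map_zpow, Subgroup.coe_mul, Subgroup.coe_zpow, hN] at e2
  rw [hst, (show Commute d v from hdv.symm).mul_pow] at e2
  simpa using e2

theorem not_pow {G : Type*} [Group G] [Finite G] {p : ℕ} [hp : Fact p.Prime]
    (hin : ∀ φ : MulAut G, ∃ c, ∀ x, φ x = c * x * c⁻¹)
    (w : G) (hw : ∀ x, w * x = x * w) (hwp : w ^ p = 1)
    {u v : G} (hu : u ∈ Xw w hw) (hv : v ∈ Xw w hw) (huv : u * v ≠ v * u) 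
    {z : G} (hz : z ∈ Subgroup.center G) : (u * v) ^ p * (v ^ p)⁻¹ ≠ z ^ p := by
  intro h
  have hw1 : w ≠ 1 := by
    rintro rfl
    obtain ⟨k, hk⟩ := hu v
    rw [one_zpow, one_mul, mul_inv_eq_iff_eq_mul] at hk
    exact huv hk
  let f : Subgroup.center G → Subgroup.center G := fun x => x ^ p
  have hsurj : Function.Surjective f := by
    rintro ⟨t, ht⟩
    obtain ⟨i, y, hy, e⟩ := core hin w hw hwp hu hv huv t ht
    refine ⟨⟨z, hz⟩ ^ i * ⟨y, hy⟩, ?_⟩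
    simp only [f]
    ext
    simp only [Subgroup.coe_mul, Subgroup.coe_pow, Subgroup.coe_zpow]
    rw [(show Commute (z ^ i) y from Subgroup.mem_center_iff.1 hy _).mul_pow, e, h]
    congr 1
    rw [← zpow_natCast, ← zpow_mul, mul_comm, zpow_mul, zpow_natCast]
  have hinj := Finite.injective_iff_surjective.2 hsurj
  have hwc : w ∈ Subgroup.center G := Subgroup.mem_center_iff.2 fun x => (hw x).symm
  have : (⟨w, hwc⟩ : Subgroup.center G) = 1 := hinj (by
    simp only [f]; ext; simp [hwp])
  exact hw1 (congrArg Subtype.val this)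

theorem class_two {G : Type*} [Group G] {a b d : G} (hd : ∀ x, d * x = x * d)
    (h : b * a = d * (a * b)) (n : ℕ) : (a * b) ^ n = d ^ (n.choose 2) * (a ^ n * b ^ n) := by
  have cd : ∀ (m : ℕ) x, d ^ m * x = x * d ^ m := fun m x => ((show Commute d x from hd x).pow_left m).eq
  have key : ∀ m : ℕ, b ^ m * a = d ^ m * (a * b ^ m) := by
    intro m
    induction m with
    | zero => simp
    | succ m ih =>
      calc b ^ (m + 1) * a = b * (b ^ m * a) := by rw [pow_succ']; group
        _ = (b * d ^ m) * (a * b ^ m) := by rw [ih]; group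
        _ = d ^ m * (b * a) * b ^ m := by rw [← cd]; group
        _ = d ^ m * d * (a * (b * b ^ m)) := by rw [h]; group
        _ = _ := by rw [← pow_succ, ← pow_succ']
  induction n with
  | zero => simp
  | succ n ih =>
    rw [Nat.choose_succ_succ' n 1, Nat.choose_one_right, pow_succ, ih]
    calc d ^ n.choose 2 * (a ^ n * b ^ n) * (a * b) 
        = d ^ n.choose 2 * a ^ n * (b ^ n * a) * b := by group
      _ = d ^ n.choose 2 * (a ^ n * d ^ n) * a * b ^ n * b := by rw [key]; group
      _ = d ^ n * d ^ n.choose 2 * ((a ^ n * a) * (b ^ n * b)) := by rw [← cd, cd n (d ^ _)]; group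
      _ = _ := by rw [← pow_add, ← pow_succ, ← pow_succ]

theorem nonabelian_case {G : Type*} [Group G] [Finite G] {p : ℕ} [hp : Fact p.Prime]
    (hin : ∀ φ : MulAut G, ∃ c, ∀ x, φ x = c * x * c⁻¹)
    (w : G) (hw : ∀ x, w * x = x * w) (hwp : w ^ p = 1)
    {x y : G} (hx : x ∈ Xw w hw) (hy : y ∈ Xw w hw) (hxy : x * y ≠ y * x) : False := by
  have cw : ∀ (n : ℤ) (x : G), w ^ n * x = x * w ^ n := 
    fun n x => ((show Commute w x from hw x).zpow_left n).eq
  have hwn : ∀ n : ℤ, (w ^ n) ^ p = 1 := by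
    intro n; rw [← zpow_natCast, ← zpow_mul, mul_comm, zpow_mul, zpow_natCast, hwp, one_zpow]
  have hd : ∀ a ∈ Xw w hw, ∀ b, ∃ d : G, (∀ x, d * x = x * d) ∧ d ^ p = 1 ∧ a * b = d * (b * a) := by
    intro a ha b
    obtain ⟨n, hn⟩ := ha b
    refine ⟨w ^ n, cw n, hwn n, ?_⟩
    rw [mul_inv_eq_iff_eq_mul] at hn
    rw [hn, mul_assoc]
  have hpc : ∀ a ∈ Xw w hw, a ^ p ∈ Subgroup.center G := by
    intro a ha
    rw [Subgroup.mem_center_iff]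
    intro b
    obtain ⟨d, hdc, hdp, hdab⟩ := hd a ha b
    have key : ∀ m : ℕ, a ^ m * b = d ^ m * (b * a ^ m) := by
      intro m
      induction m with
      | zero => simp
      | succ m ih =>
        have c1 : a * d ^ m = d ^ m * a := ((show Commute d a from hdc a).pow_left m).eq.symm
        calc a ^ (m + 1) * b = a * (a ^ m * b) := by rw [pow_succ']; group
          _ = (a * d ^ m) * (b * a ^ m) := by rw [ih]; group
          _ = d ^ m * (a * b) * a ^ m := by rw [c1]; group
          _ = d ^ m * d * (b * (a * a ^ m)) := by rw [hdab]; group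
          _ = _ := by rw [← pow_succ, ← pow_succ']
    rw [key p, hdp, one_mul]
  have hzX : ∀ z ∈ Subgroup.center G, z ∈ Xw w hw := by
    intro z hz b
    refine ⟨0, ?_⟩
    rw [Subgroup.mem_center_iff] at hz
    rw [← hz b]; simp
  by_cases hp2 : p = 2
  · subst hp2
    obtain ⟨d, hdc, hd2, hdxy⟩ := hd y hy x
    -- `y * x = d * (x * y)`
    have hdx : x * y = d * (y * x) := by
      rw [hdxy, ← mul_assoc, ← pow_two, hd2, one_mul]
    have hdcen : d ∈ Subgroup.center G := Subgroup.mem_center_iff.2 fun x => (hdc x).symm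
    have N1 : (x * y) ^ 2 * (y ^ 2)⁻¹ = d * x ^ 2 := by
      rw [class_two hdc hdxy]; simp [mul_assoc]
    have N2 : (y * x) ^ 2 * (x ^ 2)⁻¹ = d * y ^ 2 := by
      rw [class_two hdc hdx]; simp [mul_assoc]
    have N3 : (x * y * y) ^ 2 * (y ^ 2)⁻¹ = x ^ 2 * y ^ 2 := by
      have h : y * (x * y) = d * (x * y * y) := by
        rw [← mul_assoc, hdxy]; group
      rw [class_two hdc h, class_two hdc hdxy]
      simp only [Nat.choose_self, pow_one]
      calc d * (d * (x ^ 2 * y ^ 2) * y ^ 2) * (y ^ 2)⁻¹ = d ^ 2 * (x ^ 2 * y ^ 2) := by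
            rw [pow_two d]; simp only [mul_assoc, mul_inv_cancel, mul_one]
        _ = _ := by rw [hd2, one_mul]
    have hdx2 := Subgroup.mul_mem _ hdcen (hpc x hx)
    have hdy2 := Subgroup.mul_mem _ hdcen (hpc y hy)
    have nx : ∀ z ∈ Subgroup.center G, d * x ^ 2 ≠ z ^ 2 := fun z hz => by
      rw [← N1]; exact not_pow hin w hw hwp hx hy hxy hz
    have nxy : ∀ z ∈ Subgroup.center G, x ^ 2 * y ^ 2 ≠ z ^ 2 := fun z hz => by
      rw [← N3]
      refine not_pow hin w hw hwp (Subgroup.mul_mem _ hx hy) hy ?_ hz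
      intro h
      rw [← mul_assoc] at h
      exact hxy (mul_right_cancel h)
    obtain ⟨i, z, hz, e⟩ := core hin w hw hwp hy hx (Ne.symm hxy) _ hdx2
    rw [N2] at e
    have cz : ∀ m : ℤ, Commute ((d * y ^ 2) ^ m) z := fun m => Subgroup.mem_center_iff.1 hz _
    rcases Int.even_or_odd' i with ⟨j, rfl | rfl⟩
    · refine nx ((d * y ^ 2) ^ j * z) (Subgroup.mul_mem _ (Subgroup.zpow_mem _ hdy2 _) hz) ?_
      rw [e, (cz j).mul_pow, mul_comm 2 j, zpow_mul, zpow_ofNat]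
    · refine nxy ((d * y ^ 2) ^ (j + 1) * z) (Subgroup.mul_mem _ (Subgroup.zpow_mem _ hdy2 _) hz) ?_
      have h1 : x ^ 2 * y ^ 2 = (d * y ^ 2) * (d * x ^ 2) := by
        have h2 : y ^ 2 * (d * x ^ 2) = (d * x ^ 2) * y ^ 2 := Subgroup.mem_center_iff.1 hdx2 _
        calc x ^ 2 * y ^ 2 = d ^ 2 * (x ^ 2 * y ^ 2) := by rw [hd2, one_mul]
          _ = d * ((d * x ^ 2) * y ^ 2) := by rw [pow_two d]; simp only [mul_assoc]
          _ = _ := by rw [← h2, mul_assoc]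
      rw [h1, e, (cz _).mul_pow, ← mul_assoc, ← zpow_one_add, ← zpow_natCast (_ ^ (j + 1)), ← zpow_mul]
      congr 2
      push_cast; ring
  · have hodd : p ∣ p.choose 2 := by
      have := hp.out.two_le
      exact hp.out.dvd_choose_self (by norm_num) (by omega)
    have mp : ∀ a, ∀ b ∈ Xw w hw, (a * b) ^ p = a ^ p * b ^ p := by
      intro a b hb
      obtain ⟨d, hdc, hdp, hdab⟩ := hd b hb a
      obtain ⟨m, hm⟩ := hodd
      rw [class_two hdc hdab, hm, pow_mul, hdp, one_pow, one_mul]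
    have N : ∀ a, ∀ b ∈ Xw w hw, (a * b) ^ p * (b ^ p)⁻¹ = a ^ p := by
      intro a b hb; rw [mp a b hb]; group
    obtain ⟨i, z, hz, e⟩ := core hin w hw hwp hy hx (Ne.symm hxy) _ (hpc x hx)
    rw [N y x hx] at e
    have hyi : (y ^ i)⁻¹ ∈ Xw w hw := Subgroup.inv_mem _ (Subgroup.zpow_mem _ hy i)
    have hzi : z⁻¹ ∈ Xw w hw := Subgroup.inv_mem _ (hzX z hz)
    refine not_pow hin w hw hwp (u := x * (y ^ i)⁻¹ * z⁻¹) (v := y) 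
      (Subgroup.mul_mem _ (Subgroup.mul_mem _ hx hyi) hzi) hy ?_ (Subgroup.one_mem _) ?_
    · intro h
      have c1 : Commute (x * (y ^ i)⁻¹ * z⁻¹) y := h
      have c2 : Commute z y := (Subgroup.mem_center_iff.1 hz y).symm
      have c3 : Commute (y ^ i) y := (Commute.refl y).zpow_left i
      have := (c1.mul_left c2).mul_left c3
      exact hxy (by simpa using this.eq)
    · rw [N _ y hy, mp _ _ hzi, mp _ _ hyi, e, one_pow, inv_pow, inv_pow]
      have cz : Commute (z ^ p) ((y ^ i) ^ p)⁻¹ := 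
        (Subgroup.mem_center_iff.1 (Subgroup.pow_mem _ hz p) _).symm
      have h3 : (y ^ p) ^ i = (y ^ i) ^ p := by
        rw [← zpow_natCast, ← zpow_mul, mul_comm, zpow_mul, zpow_natCast]
      rw [h3, mul_assoc ((y ^ i) ^ p), cz.eq]; group

end Gaschutz

/-- Gaschütz' theorem: every finite `p`-group of order at least `p ^ 2` has an outer
automorphism, i.e. some automorphism is not inner. -/
theorem exists_outer_automorphism (p : ℕ) [Fact p.Prime] (G : Type*) [Group G] [Finite G]
    (hG : IsPGroup p G) (hcard : p ^ 2 ≤ Nat.card G) :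
    ∃ φ : MulAut G, φ ∉ (MulAut.conj : G →* MulAut G).range := by
  by_contra! hcon
  have hin : ∀ φ : MulAut G, ∃ c, ∀ x, φ x = c * x * c⁻¹ := by
    intro φ
    obtain ⟨c, rfl⟩ := hcon φ
    exact ⟨c, fun x => rfl⟩
  have hp : p.Prime := Fact.out
  have hnt : Nontrivial G := by
    rw [← Finite.one_lt_card_iff_nontrivial]
    have := hp.one_lt
    nlinarith
  obtain ⟨w, hw1, hwp, hw⟩ := Gaschutz.exists_order_p hG
  by_cases hX : ∀ a ∈ Gaschutz.Xw w hw, ∀ b ∈ Gaschutz.Xw w hw, a * b = b * a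
  · exact Gaschutz.abelian_case hG hcard hin w hw hw1 hwp hX
  · push Not at hX
    obtain ⟨x, hx, y, hy, hxy⟩ := hX
    exact Gaschutz.nonabelian_case hin w hw hwp hx hy hxy
end

section
/- If G is a noncyclic finite p-group of order at least p^2, then G has an outer automorphism whose order is a power of p. -/
namespace Gas
variable {G : Type*} [Group G]

def HomOn (H : Subgroup G) (f : G → G) : Prop := ∀ a ∈ H, ∀ b ∈ H, f (a * b) = f a * f b

structure Step (p : ℕ) (M H : Subgroup G) (x : G) : Prop where
  le : M ≤ H
  mem : x ∈ H
  nmem : x ∉ M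
  pow : x ^ p ∈ M
  conj : ∀ m ∈ M, x * m * x⁻¹ ∈ M
  conj' : ∀ m ∈ M, x⁻¹ * m * x ∈ M
  gen : ∀ h ∈ H, ∃ m ∈ M, ∃ i : ℕ, h = m * x ^ i

theorem HomOn.one {H : Subgroup G} {f : G → G} (h : HomOn H f) : f 1 = 1 := by
  have := h 1 H.one_mem 1 H.one_mem
  simpa using this

theorem HomOn.pow {H : Subgroup G} {f : G → G} (h : HomOn H f) {a : G} (ha : a ∈ H) (n : ℕ) :
    f (a ^ n) = f a ^ n := by
  induction n with
  | zero => simp [h.one]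
  | succ n ih => rw [pow_succ, h _ (H.pow_mem ha n) _ ha, ih, pow_succ]

theorem HomOn.inv {H : Subgroup G} {f : G → G} (h : HomOn H f) {a : G} (ha : a ∈ H) :
    f a⁻¹ = (f a)⁻¹ := by
  have := h a⁻¹ (H.inv_mem ha) a ha
  rw [inv_mul_cancel, h.one] at this
  exact eq_inv_of_mul_eq_one_left this.symm

theorem dvd_of_pow_mem {p : ℕ} [hp : Fact p.Prime] {M : Subgroup G} {x : G} (h1 : x ∉ M)
    (h2 : x ^ p ∈ M) {n : ℕ} (h : x ^ n ∈ M) : p ∣ n := by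
  by_contra hn
  have hc : Nat.Coprime p n := (Nat.Prime.coprime_iff_not_dvd hp.out).2 hn
  apply h1
  have hz := Int.isCoprime_iff_gcd_eq_one.2 (show Int.gcd (p : ℤ) n = 1 by simpa using hc)
  obtain ⟨a, b, hab⟩ := hz
  have : x = (x ^ p) ^ a * (x ^ n) ^ b := by
    rw [← zpow_natCast, ← zpow_natCast, ← zpow_mul, ← zpow_mul, ← zpow_add, mul_comm (p : ℤ),
      mul_comm (n : ℤ), hab, zpow_one]
  rw [this]
  exact M.mul_mem (M.zpow_mem h2 _) (M.zpow_mem h _)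

theorem conj_pow_mem {M : Subgroup G} {x : G} (hc : ∀ m ∈ M, x * m * x⁻¹ ∈ M) (i : ℕ) :
    ∀ m ∈ M, x ^ i * m * (x ^ i)⁻¹ ∈ M := by
  induction i with
  | zero => simp
  | succ i ih =>
    intro m hm
    have := ih _ (hc m hm)
    simpa [pow_succ, mul_assoc] using this

theorem ext {p : ℕ} [Fact p.Prime] {M H : Subgroup G} {x : G} (hs : Step p M H x)
    {φ : G → G} (hφ : HomOn M φ) {y : G} (hc : ∀ m ∈ M, φ (x * m * x⁻¹) = y * φ m * y⁻¹)
    (hp : φ (x ^ p) = y ^ p) :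
    ∃ Φ : G → G, HomOn H Φ ∧ ∀ m ∈ M, ∀ i : ℕ, Φ (m * x ^ i) = φ m * y ^ i := by
  have aux : ∀ m ∈ M, ∀ m' ∈ M, ∀ i j : ℕ, i ≤ j → m * x ^ i = m' * x ^ j →
      φ m * y ^ i = φ m' * y ^ j := by
    intro m hm m' hm' i j hij h
    obtain ⟨k, rfl⟩ := Nat.exists_eq_add_of_le hij
    have h1 : m'⁻¹ * m = x ^ k := by
      rw [add_comm, pow_add, ← mul_assoc] at h
      have := mul_right_cancel h
      rw [this]; group
    have h2 : x ^ k ∈ M := h1 ▸ M.mul_mem (M.inv_mem hm') hm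
    obtain ⟨l, rfl⟩ := dvd_of_pow_mem hs.nmem hs.pow h2
    have h3 : m = m' * x ^ (p * l) := by rw [← h1]; group
    rw [h3, hφ _ hm' _ h2, pow_mul, hφ.pow hs.pow, hp, add_comm, pow_add, pow_mul, mul_assoc]
  have aux2 : ∀ m ∈ M, ∀ m' ∈ M, ∀ i j : ℕ, m * x ^ i = m' * x ^ j →
      φ m * y ^ i = φ m' * y ^ j := by
    intro m hm m' hm' i j h
    rcases le_total i j with hij | hij
    · exact aux m hm m' hm' i j hij h
    · exact (aux m' hm' m hm j i hij h.symm).symm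
  have aux3 : ∀ i : ℕ, ∀ m ∈ M, φ (x ^ i * m * (x ^ i)⁻¹) = y ^ i * φ m * (y ^ i)⁻¹ := by
    intro i
    induction i with
    | zero => simp
    | succ i ih =>
      intro m hm
      have := ih _ (hs.conj m hm)
      rw [hc m hm] at this
      simpa [pow_succ, mul_assoc] using this
  have ex : ∀ h : G, ∃ v : G, ∀ m ∈ M, ∀ i : ℕ, h = m * x ^ i → v = φ m * y ^ i := by
    intro h
    by_cases hh : ∃ m ∈ M, ∃ i : ℕ, h = m * x ^ i
    · obtain ⟨m, hm, i, rfl⟩ := hh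
      exact ⟨φ m * y ^ i, fun m' hm' j h => aux2 m hm m' hm' i j h⟩
    · exact ⟨1, fun m hm i h => (hh ⟨m, hm, i, h⟩).elim⟩
  choose Φ hΦ using ex
  have hΦ' : ∀ m ∈ M, ∀ i : ℕ, Φ (m * x ^ i) = φ m * y ^ i := fun m hm i => hΦ _ m hm i rfl
  refine ⟨Φ, ?_, hΦ'⟩
  intro a ha b hb
  obtain ⟨m, hm, i, rfl⟩ := hs.gen a ha
  obtain ⟨n, hn, j, rfl⟩ := hs.gen b hb
  have e : m * x ^ i * (n * x ^ j) = (m * (x ^ i * n * (x ^ i)⁻¹)) * x ^ (i + j) := by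
    rw [pow_add]; group
  have hq := conj_pow_mem hs.conj i n hn
  rw [e, hΦ' _ (M.mul_mem hm hq), hΦ' _ hm, hΦ' _ hn, hφ _ hm _ hq, aux3 i n hn, pow_add]
  group

/-- herbrand -/
theorem herbrand {p : ℕ} {B : Type*} [CommGroup B] [Finite B] (σ : B →* B)
    (hσ : ∀ b, σ^[p] b = b)
    (h : ∀ z, (∏ i ∈ Finset.range p, σ^[i] z) = 1 → ∃ a, z = a * (σ a)⁻¹)
    (c : B) (hc : σ c = c) : ∃ b, (∏ i ∈ Finset.range p, σ^[i] b) = c := by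
  let τ : B →* B := 
    { toFun := fun z => ∏ i ∈ Finset.range p, σ^[i] z
      map_one' := by simp
      map_mul' := by intro a b; simp [Finset.prod_mul_distrib] }
  let δ : B →* B := 
    { toFun := fun z => z * (σ z)⁻¹
      map_one' := by simp
      map_mul' := by intro a b; rw [map_mul, mul_inv]; exact mul_mul_mul_comm _ _ _ _ }
  have h1 : τ.ker ≤ δ.range := by
    intro z hz
    obtain ⟨a, ha⟩ := h z hz
    exact ⟨a, ha.symm⟩
  have h2 : τ.range ≤ δ.ker := by
    rintro _ ⟨b, rfl⟩
    show (∏ i ∈ Finset.range p, σ^[i] b) * (σ (∏ i ∈ Finset.range p, σ^[i] b))⁻¹ = 1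
    rw [mul_inv_eq_one, map_prod]
    simp only [← Function.iterate_succ_apply']
    have e1 := Finset.prod_range_succ (fun i => σ^[i] b) p
    have e2 := Finset.prod_range_succ' (fun i => σ^[i] b) p
    rw [e1, hσ] at e2
    simpa using e2
  have c1 := τ.ker.card_mul_index
  have c2 := δ.ker.card_mul_index
  rw [Subgroup.index_ker] at c1 c2
  have l1 := Subgroup.card_le_of_le h1
  have l2 := Subgroup.card_le_of_le h2
  have p1 : 0 < Nat.card τ.ker := Nat.card_pos
  have : Nat.card δ.ker ≤ Nat.card τ.range := by
    by_contra hlt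
    push Not at hlt
    have : Nat.card τ.ker * Nat.card τ.range < Nat.card δ.ker * Nat.card δ.range := by
      calc _ < Nat.card τ.ker * Nat.card δ.ker := Nat.mul_lt_mul_of_pos_left hlt p1
        _ ≤ _ := by rw [mul_comm]; exact Nat.mul_le_mul_left _ l1
    omega
  have e := Subgroup.eq_of_le_of_card_ge h2 this
  have : c ∈ τ.range := by
    rw [e]; show c * (σ c)⁻¹ = 1; rw [hc]; simp
  exact this

/-- The norm lemma in terms of subgroups. -/
theorem norm_lemma {p : ℕ} [Finite G] {B : Subgroup G} {x : G} (hB : ∀ a ∈ B, ∀ b ∈ B, a * b = b * a)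
    (hx : ∀ m ∈ B, x * m * x⁻¹ ∈ B) (hxp : ∀ b ∈ B, x ^ p * b = b * x ^ p)
    (h : ∀ z ∈ B, (z * x) ^ p = x ^ p → ∃ a ∈ B, z = a * x * a⁻¹ * x⁻¹)
    (c : G) (hc : c ∈ B) (hcx : x * c = c * x) : ∃ b ∈ B, (b * x) ^ p = c * x ^ p := by
  let : CommGroup B := { (inferInstance : Group B) with
    mul_comm := fun a b => Subtype.ext (hB a a.2 b b.2) }
  let σ : B →* B :=
    { toFun := fun b => ⟨x * b * x⁻¹, hx b b.2⟩
      map_one' := by ext; simp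
      map_mul' := by intro a b; ext; simp }
  have hσi : ∀ (i : ℕ) (b : B), ((σ^[i] b : B) : G) = x ^ i * b * (x ^ i)⁻¹ := by
    intro i b
    induction i with
    | zero => simp
    | succ i ih =>
      rw [Function.iterate_succ_apply']
      show x * ((σ^[i] b : B) : G) * x⁻¹ = _
      rw [ih, pow_succ']; group
  have hpw : ∀ (n : ℕ) (b : B), ((b : G) * x) ^ n = ((∏ i ∈ Finset.range n, σ^[i] b : B) : G) * x ^ n := by
    intro n b
    induction n with
    | zero => simp
    | succ n ih =>
      rw [pow_succ, ih, Finset.prod_range_succ, Subgroup.coe_mul, hσi, pow_succ]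
      group
  obtain ⟨b, hb⟩ := herbrand (p := p) σ
    (by
      intro b; ext; rw [hσi, hxp b b.2]; group)
    (by
      intro z hz
      obtain ⟨a, ha, hza⟩ := h z z.2 (by rw [hpw, hz]; simp)
      refine ⟨⟨a, ha⟩, ?_⟩
      ext
      show (z : G) = a * (x * a * x⁻¹)⁻¹
      rw [hza]; group)
    ⟨c, hc⟩ (by ext; show x * c * x⁻¹ = c; rw [hcx]; group)
  exact ⟨b, b.2, by rw [hpw, hb]⟩
end Gas

namespace Gas
variable {G : Type*} [Group G]

theorem normal_of_index {p : ℕ} [hp : Fact p.Prime] [Finite G] (hG : IsPGroup p G) {M : Subgroup G}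
    (hM : M.index = p) : M.Normal := by
  apply Subgroup.normal_of_index_eq_minFac_card
  obtain ⟨n, hn⟩ := IsPGroup.iff_card.1 hG
  have hd : p ∣ Nat.card G := hM ▸ M.index_dvd_card
  have : n ≠ 0 := by
    rintro rfl
    rw [hn, pow_zero] at hd
    exact hp.out.one_lt.ne' (Nat.dvd_one.1 hd)
  rw [hM, hn, Nat.Prime.pow_minFac hp.out this]

theorem step_of_index {p : ℕ} [hp : Fact p.Prime] [Finite G] (hG : IsPGroup p G) {M : Subgroup G}
    (hM : M.index = p) {x : G} (hx : x ∉ M) : Step p M ⊤ x := by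
  have hn := normal_of_index hG hM
  have hc : Nat.card (G ⧸ M) = p := hM
  have hp1 : x ^ p ∈ M := by
    rw [← QuotientGroup.eq_one_iff, QuotientGroup.mk_pow, ← hc, pow_card_eq_one']
  refine ⟨le_top, Subgroup.mem_top _, hx, hp1, fun m hm => hn.conj_mem m hm x, fun m hm => by
    simpa using hn.conj_mem m hm x⁻¹, fun h _ => ?_⟩
  have hx' : (x : G ⧸ M) ≠ 1 := by rwa [Ne, QuotientGroup.eq_one_iff]
  have := mem_powers_of_prime_card hc hx' (g' := (h : G ⧸ M))
  obtain ⟨i, hi⟩ := this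
  refine ⟨h * (x ^ i)⁻¹, ?_, i, by group⟩
  rw [← QuotientGroup.eq_one_iff]
  simp only at hi
  rw [QuotientGroup.mk_mul, QuotientGroup.mk_inv, QuotientGroup.mk_pow, hi, mul_inv_cancel]

theorem exists_index_prime {p : ℕ} [hp : Fact p.Prime] [Finite G] (hG : IsPGroup p G)
    {K : Subgroup G} (hK : K ≠ ⊤) : ∃ M : Subgroup G, K ≤ M ∧ M.index = p := by
  obtain ⟨n, hn⟩ := IsPGroup.iff_card.1 hG
  obtain ⟨k, hk⟩ := IsPGroup.iff_card.1 (hG.to_subgroup K)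
  have hlt : Nat.card K < Nat.card G := lt_of_le_of_ne (Subgroup.card_le_card_group K) (by
    intro h; exact hK (Subgroup.eq_top_of_card_eq K h))
  rw [hn, hk] at hlt
  have hkn : k < n := (Nat.pow_lt_pow_iff_right hp.out.one_lt).1 hlt
  obtain ⟨M, hM, hKM⟩ := Sylow.exists_subgroup_card_pow_prime_le p (m := n - 1)
    (by rw [hn]; exact pow_dvd_pow _ (by omega)) K hk (by omega)
  refine ⟨M, hKM, ?_⟩
  have := M.card_mul_index
  rw [hM, hn] at this
  have h2 : p ^ n = p ^ (n - 1) * p := by rw [← pow_succ]; congr 1; omega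
  rw [h2] at this
  exact Nat.eq_of_mul_eq_mul_left (pow_pos hp.out.pos _) this

theorem exists_step {p : ℕ} [hp : Fact p.Prime] [Finite G] (hG : IsPGroup p G)
    {K H : Subgroup G} (hK : K < H) : ∃ (M : Subgroup G) (x : G), K ≤ M ∧ Step p M H x := by
  have h1 : K.subgroupOf H ≠ ⊤ := by
    rw [Ne, Subgroup.subgroupOf_eq_top]; exact not_le_of_gt hK
  obtain ⟨M, hKM, hM⟩ := exists_index_prime (hG.to_subgroup H) h1
  have hne : M ≠ ⊤ := by
    rintro rfl
    rw [Subgroup.index_top] at hM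
    exact hp.out.one_lt.ne hM
  obtain ⟨x, hx⟩ : ∃ x, x ∉ M := by
    by_contra! h; exact hne (eq_top_iff.2 fun x _ => h x)
  have hs := step_of_index (hG.to_subgroup H) hM hx
  refine ⟨M.map H.subtype, x, ?_, ?_, x.2, ?_, ?_, ?_, ?_, ?_⟩
  · intro k hk
    exact ⟨⟨k, hK.le hk⟩, hKM (by simpa [Subgroup.mem_subgroupOf] using hk), rfl⟩
  · exact Subgroup.map_subtype_le _
  · rintro ⟨y, hy, hyx⟩
    exact hx (by rwa [← Subtype.ext hyx])
  · exact ⟨x ^ p, hs.pow, by simp⟩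
  · rintro _ ⟨m, hm, rfl⟩
    exact ⟨_, hs.conj m hm, by simp⟩
  · rintro _ ⟨m, hm, rfl⟩
    exact ⟨_, hs.conj' m hm, by simp⟩
  · intro h hh
    obtain ⟨m, hm, i, hi⟩ := hs.gen ⟨h, hh⟩ (Subgroup.mem_top _)
    refine ⟨m, ⟨m, hm, rfl⟩, i, ?_⟩
    have := congrArg Subtype.val hi
    simpa using this

def P (A H : Subgroup G) : Prop := ∀ φ : G → G, HomOn H φ → (∀ a ∈ A, φ a = a) →
  (∀ h ∈ H, φ h * h⁻¹ ∈ A) → ∃ a ∈ A, ∀ h ∈ H, φ h = a * h * a⁻¹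

theorem cos_iff {A : Subgroup G} [A.Normal] {x y : G} : y * x⁻¹ ∈ A ↔ (y : G ⧸ A) = x := by
  rw [← div_eq_mul_inv, QuotientGroup.eq_iff_div_mem]

theorem kernel_lemma {p : ℕ} [hp : Fact p.Prime] {A M H : Subgroup G} [A.Normal] (hAM : A ≤ M)
    {x : G} (hs : Step p M H x) (hP : P A H) {z : G} (hz : z ∈ A) (hzM : ∀ m ∈ M, z * m = m * z)
    (h : (z * x) ^ p = x ^ p) :
    ∃ a ∈ A, (∀ m ∈ M, a * m = m * a) ∧ z = a * x * a⁻¹ * x⁻¹ := by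
  obtain ⟨Φ, h1, h2⟩ := ext hs (φ := fun g => g) (fun _ _ _ _ => rfl) (y := z * x) (by
    intro m hm
    have := hzM _ (hs.conj m hm)
    have e : z * x * m * (z * x)⁻¹ = (z * (x * m * x⁻¹)) * z⁻¹ := by group
    rw [e, this]; group) h.symm
  have hM : ∀ m ∈ M, Φ m = m := by
    intro m hm; simpa using h2 m hm 0
  obtain ⟨a, ha, haH⟩ := hP Φ h1 (fun a ha => hM a (hAM ha)) (by
    intro g hg
    obtain ⟨m, hm, i, rfl⟩ := hs.gen g hg
    rw [h2 m hm, cos_iff]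
    have : (z : G ⧸ A) = 1 := (QuotientGroup.eq_one_iff z).2 hz
    simp [this])
  refine ⟨a, ha, ?_, ?_⟩
  · intro m hm
    have := haH m (hs.le hm)
    rw [hM m hm] at this
    rw [eq_mul_inv_iff_mul_eq] at this
    exact this.symm
  · have := haH x hs.mem
    have h3 := h2 1 M.one_mem 1
    simp only [one_mul, pow_one] at h3
    rw [h3] at this
    rw [← this]; group

theorem norm_onto {p : ℕ} [hp : Fact p.Prime] [Finite G] {A M H : Subgroup G} [A.Normal]
    (hAM : A ≤ M) {x : G} (hs : Step p M H x) (hP : P A H) {c : G} (hc : c ∈ A)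
    (hcM : ∀ m ∈ M, c * m = m * c) (hcx : x * c = c * x) :
    ∃ b ∈ A, (∀ m ∈ M, b * m = m * b) ∧ (b * x) ^ p = c * x ^ p := by
  have hmem : ∀ z, z ∈ A ⊓ Subgroup.centralizer (M : Set G) ↔ z ∈ A ∧ ∀ m ∈ M, z * m = m * z := by
    intro z
    rw [Subgroup.mem_inf, Subgroup.mem_centralizer_iff]
    simp only [SetLike.mem_coe, eq_comm]
  obtain ⟨b, hb, hb2⟩ := norm_lemma (p := p) (B := A ⊓ Subgroup.centralizer (M : Set G)) (x := x)
    (by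
      intro a ha b hb
      exact ((hmem a).1 ha).2 b (hAM ((hmem b).1 hb).1))
    (by
      intro b hb
      rw [hmem] at hb ⊢
      refine ⟨‹A.Normal›.conj_mem b hb.1 x, fun m hm => ?_⟩
      have := hb.2 _ (hs.conj' m hm)
      calc x * b * x⁻¹ * m = x * (b * (x⁻¹ * m * x)) * x⁻¹ := by group
        _ = m * (x * b * x⁻¹) := by rw [this]; group)
    (by
      intro b hb
      exact (((hmem b).1 hb).2 _ hs.pow).symm)
    (by
      intro z hz hzx
      rw [hmem] at hz
      obtain ⟨a, ha, ha2, ha3⟩ := kernel_lemma hAM hs hP hz.1 hz.2 hzx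
      exact ⟨a, (hmem a).2 ⟨ha, ha2⟩, ha3⟩)
    c ((hmem c).2 ⟨hc, hcM⟩) hcx
  exact ⟨b, ((hmem b).1 hb).1, ((hmem b).1 hb).2, hb2⟩

theorem step_mul {p : ℕ} {M H : Subgroup G} [Finite G] {x : G} (hs : Step p M H x) {u : G}
    (hu : u ∈ M) : Step p M H (u * x) := by
  have key : ∀ i : ℕ, (u * x) ^ i * (x ^ i)⁻¹ ∈ M := by
    intro i
    induction i with
    | zero => simp
    | succ i ih =>
      have e : (u * x) ^ (i + 1) * (x ^ (i + 1))⁻¹ = u * (x * ((u * x) ^ i * (x ^ i)⁻¹) * x⁻¹) := by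
        rw [pow_succ', pow_succ']; group
      rw [e]
      exact M.mul_mem hu (hs.conj _ ih)
  refine ⟨hs.le, H.mul_mem (hs.le hu) hs.mem, ?_, ?_, ?_, ?_, ?_⟩
  · intro h
    exact hs.nmem ((M.mul_mem_cancel_left hu).1 h)
  · have := M.mul_mem (key p) hs.pow
    simpa using this
  · intro m hm
    have := M.mul_mem (M.mul_mem hu (hs.conj m hm)) (M.inv_mem hu)
    simpa [mul_assoc] using this
  · intro m hm
    have := hs.conj' _ (M.mul_mem (M.mul_mem (M.inv_mem hu) hm) hu)
    simpa [mul_assoc] using this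
  · intro h hh
    obtain ⟨m, hm, i, rfl⟩ := hs.gen h hh
    refine ⟨m * ((u * x) ^ i * (x ^ i)⁻¹)⁻¹, M.mul_mem hm (M.inv_mem (key i)), i, ?_⟩
    group

theorem extend {p : ℕ} [hp : Fact p.Prime] [Finite G] {A M H : Subgroup G} [A.Normal]
    (hA : ∀ a ∈ A, ∀ b ∈ A, a * b = b * a)
    (hAM : A ≤ M) {x : G} (hs : Step p M H x) (hP : P A H) {ψ : G → G} (hψ : HomOn M ψ)
    (hψA : ∀ m ∈ M, ψ m * m⁻¹ ∈ A) {u : G} (hu : u ∈ A)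
    (hc : ∀ m ∈ M, ψ (x * m * x⁻¹) = (u * x) * ψ m * (u * x)⁻¹) :
    ∃ Φ : G → G, HomOn H Φ ∧ (∀ m ∈ M, Φ m = ψ m) ∧ ∀ h ∈ H, Φ h * h⁻¹ ∈ A := by
  have hs' := step_mul hs (hAM hu)
  set y := u * x with hy
  have hyA : (y : G ⧸ A) = x := by
    rw [← cos_iff, hy]; simpa using hu
  have hyx : ∀ i : ℕ, ∀ m ∈ M, ψ (x ^ i * m * (x ^ i)⁻¹) = y ^ i * ψ m * (y ^ i)⁻¹ := by
    intro i
    induction i with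
    | zero => simp
    | succ i ih =>
      intro m hm
      have := ih _ (hs.conj m hm)
      rw [hc m hm] at this
      simpa [pow_succ, mul_assoc] using this
  have hcomm : ∀ e ∈ A, (∀ m ∈ M, e * ψ m = ψ m * e) ↔ (∀ m ∈ M, e * m = m * e) := by
    intro e he
    refine forall₂_congr fun m hm => ?_
    have h1 := hA e he _ (hψA m hm)
    have e1 : ψ m = (ψ m * m⁻¹) * m := by group
    constructor
    · intro h
      have h2 : (ψ m * m⁻¹) * (e * m) = (ψ m * m⁻¹) * (m * e) := by
        calc _ = (e * (ψ m * m⁻¹)) * m := by rw [h1]; group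
          _ = e * ψ m := by group
          _ = _ := by rw [h]; group
      exact mul_left_cancel h2
    · intro h
      calc e * ψ m = e * (ψ m * m⁻¹) * m := by group
        _ = (ψ m * m⁻¹) * (e * m) := by rw [h1]; group
        _ = _ := by rw [h]; group
  set e := ψ (x ^ p) * (y ^ p)⁻¹ with he
  have heA : e ∈ A := by
    rw [he, cos_iff, QuotientGroup.mk_pow, hyA, ← QuotientGroup.mk_pow, ← cos_iff]
    exact hψA _ hs.pow
  have heM : ∀ m ∈ M, e * ψ m = ψ m * e := by
    -- take the preimage under conjugation
    intro m hm
    obtain ⟨n, hn, rfl⟩ : ∃ n ∈ M, m = x ^ p * n * (x ^ p)⁻¹ :=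
      ⟨(x ^ p)⁻¹ * m * x ^ p, M.mul_mem (M.mul_mem (M.inv_mem hs.pow) hm) hs.pow, by group⟩
    have h1 := hyx p n hn
    have h2 : ψ (x ^ p * n * (x ^ p)⁻¹) = ψ (x ^ p) * ψ n * (ψ (x ^ p))⁻¹ := by
      rw [hψ _ (M.mul_mem hs.pow hn) _ (M.inv_mem hs.pow), hψ _ hs.pow _ hn, hψ.inv hs.pow]
    have h3 : e * ψ (x ^ p * n * (x ^ p)⁻¹) = ψ (x ^ p) * ψ n * (y ^ p)⁻¹ := by
      rw [h1, he]; group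
    have h4 : ψ (x ^ p * n * (x ^ p)⁻¹) * e = ψ (x ^ p) * ψ n * (y ^ p)⁻¹ := by
      rw [h2, he]; group
    rw [h3, h4]
  have hey : y * e = e * y := by
    have h1 := hc _ hs.pow
    have h2 : x * x ^ p * x⁻¹ = x ^ p := by rw [← pow_succ', pow_succ]; group
    rw [h2] at h1
    have h3 : y * ψ (x ^ p) = ψ (x ^ p) * y := by
      nth_rw 2 [h1]; group
    have h4 : y * (y ^ p)⁻¹ = (y ^ p)⁻¹ * y :=
      ((Commute.refl y).pow_right p).inv_right.eq
    rw [he, ← mul_assoc, h3, mul_assoc, h4, mul_assoc]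
  obtain ⟨b, hb, hbM, hbp⟩ := norm_onto hAM hs' hP heA ((hcomm e heA).1 heM) hey
  have hbψ := (hcomm b hb).2 hbM
  obtain ⟨Φ, h1, h2⟩ := ext hs hψ (y := b * y) (by
    intro m hm
    have h5 := hbψ _ (hs.conj m hm)
    rw [hc m hm] at h5 ⊢
    calc y * ψ m * y⁻¹ = (y * ψ m * y⁻¹ * b) * b⁻¹ := by group
      _ = _ := by rw [← h5]; group) (by rw [hbp, he]; group)
  refine ⟨Φ, h1, fun m hm => by simpa using h2 m hm 0, ?_⟩
  intro g hg
  obtain ⟨m, hm, i, rfl⟩ := hs.gen g hg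
  rw [h2 m hm, cos_iff]
  have e1 : (b : G ⧸ A) = 1 := (QuotientGroup.eq_one_iff b).2 hb
  have e2 := cos_iff.1 (hψA m hm)
  simp [e1, e2, hyA]
end Gas

namespace Gas
variable {G : Type*} [Group G]

theorem nilp {R : Type*} [Ring R] {p : ℕ} (hp : p.Prime) {T : R} {k n : ℕ} (hT : T ^ p ^ k = 1)
    (hn : (p : R) ^ n = 0) : ∃ m : ℕ, (T - 1) ^ m = 0 := by
  obtain ⟨r, hr⟩ := (Commute.one_right (T - 1)).exists_add_pow_prime_pow_eq hp k
  rw [sub_add_cancel, hT, one_pow] at hr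
  have hr2 : ∃ r' : R, (T - 1) ^ p ^ k = p * r' := by
    refine ⟨-((T - 1) * 1 * r), ?_⟩
    have : (T - 1) ^ p ^ k = -(p * ((T - 1) * 1 * r)) := by
      rw [eq_neg_iff_add_eq_zero]
      simpa [mul_assoc, add_assoc, add_comm, add_left_comm] using hr
    rw [this]; noncomm_ring
  obtain ⟨r', h'⟩ := hr2
  refine ⟨p ^ k * n, ?_⟩
  rw [pow_mul, h', (Nat.cast_commute p r').mul_pow, hn, zero_mul]

def NN (x : G) (f : G → G) (m : G) : G := x * f (x⁻¹ * m * x) * x⁻¹ * (f m)⁻¹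

theorem NN_nilp {p : ℕ} [hp : Fact p.Prime] [Finite G] (hG : IsPGroup p G) {A : Subgroup G}
    [hAn : A.Normal] (hA : ∀ a ∈ A, ∀ b ∈ A, a * b = b * a) (x : G) :
    ∃ n : ℕ, ∀ f : G → G, (∀ g, f g ∈ A) → ∀ g, (NN x)^[n] f g = 1 := by
  let : CommGroup A := { (inferInstance : Group A) with
    mul_comm := fun a b => Subtype.ext (hA a a.2 b b.2) }
  let X := G → Additive A
  let T : AddMonoid.End X :=
    { toFun := fun f m => Additive.ofMul ⟨x * ((f (x⁻¹ * m * x)).toMul : A) * x⁻¹,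
        hAn.conj_mem _ (f (x⁻¹ * m * x)).toMul.2 x⟩
      map_zero' := by
        funext m
        apply Additive.toMul.injective
        apply Subtype.ext
        show x * (1 : G) * x⁻¹ = 1
        group
      map_add' := by
        intro f g
        funext m
        apply Additive.toMul.injective
        apply Subtype.ext
        show x * (((f (x⁻¹ * m * x)).toMul : G) * ((g (x⁻¹ * m * x)).toMul : G)) * x⁻¹ =
          (x * ((f (x⁻¹ * m * x)).toMul : G) * x⁻¹) * (x * ((g (x⁻¹ * m * x)).toMul : G) * x⁻¹)
        group }
  have hTi : ∀ (i : ℕ) (f : X) (m : G), (((T ^ i) f m).toMul : G) =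
      x ^ i * ((f ((x ^ i)⁻¹ * m * x ^ i)).toMul : G) * (x ^ i)⁻¹ := by
    intro i
    induction i with
    | zero => intro f m; simp
    | succ i ih =>
      intro f m
      rw [pow_succ']
      show x * (((T ^ i) f (x⁻¹ * m * x)).toMul : G) * x⁻¹ = _
      rw [ih, pow_succ x i]
      have e : (x ^ i)⁻¹ * (x⁻¹ * m * x) * x ^ i = (x ^ i * x)⁻¹ * m * (x ^ i * x) := by
        rw [← pow_succ, pow_succ']; group
      have e2 : x ^ i * x = x * x ^ i := by rw [← pow_succ, pow_succ']
      rw [e, e2]; group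
  obtain ⟨k, hk⟩ := hG x
  obtain ⟨n, hn⟩ := IsPGroup.iff_card.1 (hG.to_subgroup A)
  have h1 : T ^ p ^ k = 1 := by
    ext f m
    rw [hTi, hk]; simp
  have h2 : ((p : AddMonoid.End X)) ^ n = 0 := by
    rw [← Nat.cast_pow]
    ext f m
    rw [AddMonoid.End.natCast_apply, ← hn]
    have h3 : (f m).toMul ^ Nat.card A = 1 := pow_card_eq_one'
    exact congrArg Subtype.val h3
  obtain ⟨N, hN⟩ := nilp hp.out h1 h2
  refine ⟨N, fun f hf g => ?_⟩
  have key : ∀ (i : ℕ) (f : G → G) (hf : ∀ g, f g ∈ A) (g : G), (NN x)^[i] f g =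
      ((((T - 1) ^ i) (fun g => Additive.ofMul ⟨f g, hf g⟩) g).toMul : G) := by
    intro i f hf
    induction i with
    | zero => intro g; simp
    | succ i ih =>
      intro g
      rw [Function.iterate_succ_apply', pow_succ']
      show x * ((NN x)^[i] f (x⁻¹ * g * x)) * x⁻¹ * ((NN x)^[i] f g)⁻¹ = _
      rw [ih, ih]
      rw [← div_eq_mul_inv]
      rfl
  rw [key N f hf, hN]
  rfl

structure Deriv (A M : Subgroup G) (d : G → G) : Prop where
  mem : ∀ g, d g ∈ A
  mul : ∀ m ∈ M, ∀ n ∈ M, d (m * n) = d m * (m * d n * m⁻¹)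
  triv : ∀ a ∈ A, d a = 1

theorem P_down {p : ℕ} [hp : Fact p.Prime] [Finite G] (hG : IsPGroup p G) {A M H : Subgroup G}
    [hAn : A.Normal] (hA : ∀ a ∈ A, ∀ b ∈ A, a * b = b * a)
    (hAM : A ≤ M) {x : G} (hs : Step p M H x) (hP : P A H) : P A M := by
  classical
  have hN : ∀ d, Deriv A M d → Deriv A M (NN x d) := by
    intro d hd
    refine ⟨fun g => A.mul_mem (hAn.conj_mem _ (hd.mem _) x) (A.inv_mem (hd.mem _)), ?_, ?_⟩
    · intro m hm n hn
      unfold NN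
      have e1 : x⁻¹ * (m * n) * x = (x⁻¹ * m * x) * (x⁻¹ * n * x) := by group
      rw [e1, hd.mul _ (hs.conj' m hm) _ (hs.conj' n hn), hd.mul m hm n hn]
      have c := hA (m * (x * d (x⁻¹ * n * x) * x⁻¹ * (d n)⁻¹) * m⁻¹)
        (hAn.conj_mem _ (A.mul_mem (hAn.conj_mem _ (hd.mem _) x) (A.inv_mem (hd.mem _))) m)
        (d m)⁻¹ (A.inv_mem (hd.mem _))
      calc _ = x * d (x⁻¹ * m * x) * x⁻¹ *
          ((m * (x * d (x⁻¹ * n * x) * x⁻¹ * (d n)⁻¹) * m⁻¹) * (d m)⁻¹) := by group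
        _ = _ := by rw [c]; group
    · intro a ha
      unfold NN
      have : x⁻¹ * a * x ∈ A := by simpa using hAn.conj_mem a ha x⁻¹
      rw [hd.triv _ this, hd.triv a ha]; group
  have step : ∀ d, Deriv A M d → (∃ a ∈ A, ∀ m ∈ M, NN x d m = a * m * a⁻¹ * m⁻¹) →
      ∃ a ∈ A, ∀ m ∈ M, d m = a * m * a⁻¹ * m⁻¹ := by
    rintro d hd ⟨u, hu, hum⟩
    obtain ⟨Φ, h1, h2, h3⟩ := extend hA hAM hs hP (ψ := fun m => d m * m) (by
        intro m hm n hn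
        simp only
        rw [hd.mul m hm n hn]; group) (by
        intro m hm
        simpa using hd.mem m) (u := u⁻¹) (A.inv_mem hu) (by
        intro m hm
        have h := hum _ (hs.conj m hm)
        unfold NN at h
        have e1 : x⁻¹ * (x * m * x⁻¹) * x = m := by group
        rw [e1] at h
        set m' := x * m * x⁻¹ with hm'
        have h' : x * d m * x⁻¹ = u * (m' * u⁻¹ * m'⁻¹) * d m' := by
          rw [mul_inv_eq_iff_eq_mul] at h
          rw [h]; group
        have c := hA (m' * u⁻¹ * m'⁻¹) (hAn.conj_mem _ (A.inv_mem hu) m') (d m') (hd.mem _)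
        have : x * (d m * m) * x⁻¹ = u * (d m' * m') * u⁻¹ := by
          calc x * (d m * m) * x⁻¹ = (x * d m * x⁻¹) * m' := by rw [hm']; group
            _ = u * ((m' * u⁻¹ * m'⁻¹) * d m') * m' := by rw [h']; group
            _ = _ := by rw [c]; group
        calc d m' * m' = u⁻¹ * (u * (d m' * m') * u⁻¹) * u := by group
          _ = _ := by rw [← this]; group)
    obtain ⟨a, ha, hah⟩ := hP Φ h1 (fun a ha => by
      rw [h2 a (hAM ha)]; simp [hd.triv a ha]) h3
    refine ⟨a, ha, fun m hm => ?_⟩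
    rw [← hah m (hs.le hm), h2 m hm]; group
  have iter : ∀ (n : ℕ) (d : G → G), Deriv A M d → (∀ g, (NN x)^[n] d g = 1) →
      ∃ a ∈ A, ∀ m ∈ M, d m = a * m * a⁻¹ * m⁻¹ := by
    intro n
    induction n with
    | zero => intro d hd h; exact ⟨1, A.one_mem, fun m _ => by simpa using h m⟩
    | succ n ih =>
      intro d hd h
      exact step d hd (ih _ (hN d hd) h)
  intro φ h1 h2 h3
  have hd : Deriv A M (fun g => if g ∈ M then φ g * g⁻¹ else 1) := by
    refine ⟨?_, ?_, ?_⟩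
    · intro g
      by_cases hg : g ∈ M
      · simpa [hg] using h3 g hg
      · simp [hg]
    · intro m hm n hn
      simp only [hm, hn, M.mul_mem hm hn, if_true]
      rw [h1 m hm n hn]; group
    · intro a ha
      simp [hAM ha, h2 a ha]
  obtain ⟨n, hn⟩ := NN_nilp hG hA x
  obtain ⟨a, ha, h⟩ := iter n _ hd (hn _ hd.mem)
  refine ⟨a, ha, fun m hm => ?_⟩
  have := h m hm
  simp only [hm, if_true] at this
  exact mul_right_cancel this

def C (A H : Subgroup G) : Prop := ∃ ψ : G → G, HomOn H ψ ∧ (∀ a ∈ A, ψ a = 1) ∧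
  ∀ h ∈ H, ψ h * h⁻¹ ∈ A

theorem C_up {p : ℕ} [hp : Fact p.Prime] [Finite G] {A M H : Subgroup G}
    [hAn : A.Normal] (hA : ∀ a ∈ A, ∀ b ∈ A, a * b = b * a)
    (hAM : A ≤ M) {x : G} (hs : Step p M H x) (hP : P A H) (hP' : P A M) (hC : C A M) : C A H := by
  obtain ⟨ψ, h1, h2, h3⟩ := hC
  have hact : ∀ m ∈ M, ∀ a ∈ A, ψ m * a * (ψ m)⁻¹ = m * a * m⁻¹ := by
    intro m hm a ha
    have c := hA _ (h3 m hm) (m * a * m⁻¹) (hAn.conj_mem a ha m)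
    calc ψ m * a * (ψ m)⁻¹ = ((ψ m * m⁻¹) * (m * a * m⁻¹)) * (ψ m * m⁻¹)⁻¹ := by group
      _ = _ := by rw [c]; group
  let ψ' : G → G := fun m => x * ψ (x⁻¹ * m * x) * x⁻¹
  have hψ' : ∀ m ∈ M, ∀ n ∈ M, ψ' (m * n) = ψ' m * ψ' n := by
    intro m hm n hn
    show x * ψ (x⁻¹ * (m * n) * x) * x⁻¹ = x * ψ (x⁻¹ * m * x) * x⁻¹ * (x * ψ (x⁻¹ * n * x) * x⁻¹)
    have e1 : x⁻¹ * (m * n) * x = (x⁻¹ * m * x) * (x⁻¹ * n * x) := by group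
    rw [e1, h1 _ (hs.conj' m hm) _ (hs.conj' n hn)]; group
  have hψ'A : ∀ m ∈ M, ψ' m * m⁻¹ ∈ A := by
    intro m hm
    have := hAn.conj_mem _ (h3 _ (hs.conj' m hm)) x
    have e : ψ' m * m⁻¹ = x * (ψ (x⁻¹ * m * x) * (x⁻¹ * m * x)⁻¹) * x⁻¹ := by
      show x * ψ (x⁻¹ * m * x) * x⁻¹ * m⁻¹ = _
      group
    rw [e]; exact this
  have hd : ∀ m ∈ M, ψ' m * (ψ m)⁻¹ ∈ A := by
    intro m hm
    have := A.mul_mem (hψ'A m hm) (A.inv_mem (h3 m hm))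
    simpa using this
  obtain ⟨u, hu, hum⟩ := hP' (fun m => ψ' m * (ψ m)⁻¹ * m) (by
      intro m hm n hn
      simp only
      have := hact m hm _ (hd n hn)
      rw [hψ' m hm n hn, h1 m hm n hn]
      calc _ = ψ' m * (ψ m)⁻¹ * (ψ m * (ψ' n * (ψ n)⁻¹) * (ψ m)⁻¹) * m * n := by group
        _ = _ := by rw [this]; group) (by
      intro a ha
      have : x⁻¹ * a * x ∈ A := by simpa using hAn.conj_mem a ha x⁻¹
      show x * ψ (x⁻¹ * a * x) * x⁻¹ * (ψ a)⁻¹ * a = a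
      rw [h2 a ha, h2 _ this]; group) (by
      intro m hm
      simpa using hd m hm)
  have hconj : ∀ m ∈ M, ψ' m = u * ψ m * u⁻¹ := by
    intro m hm
    have h4 : ψ' m * (ψ m)⁻¹ * m = u * m * u⁻¹ := hum m hm
    have h5 := hact m hm _ (A.inv_mem hu)
    calc ψ' m = (ψ' m * (ψ m)⁻¹ * m) * m⁻¹ * ψ m := by group
      _ = u * (m * u⁻¹ * m⁻¹) * ψ m := by rw [h4]; group
      _ = _ := by rw [← h5]; group
  obtain ⟨Φ, k1, k2, k3⟩ := extend hA hAM hs hP h1 h3 (u := u⁻¹) (A.inv_mem hu) (by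
    intro m hm
    have h4 := hconj _ (hs.conj m hm)
    have h5 : ψ' (x * m * x⁻¹) = x * ψ m * x⁻¹ := by
      show x * ψ (x⁻¹ * (x * m * x⁻¹) * x) * x⁻¹ = _
      congr 3; group
    rw [h5] at h4
    calc ψ (x * m * x⁻¹) = u⁻¹ * (u * ψ (x * m * x⁻¹) * u⁻¹) * u := by group
      _ = _ := by rw [← h4]; group)
  exact ⟨Φ, k1, fun a ha => by rw [k2 a (hAM ha), h2 a ha], k3⟩

theorem complement {p : ℕ} [hp : Fact p.Prime] [Finite G] (hG : IsPGroup p G) {A : Subgroup G}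
    [hAn : A.Normal] (hA : ∀ a ∈ A, ∀ b ∈ A, a * b = b * a) :
    ∀ (n : ℕ) (H : Subgroup G), Nat.card H = n → A ≤ H → P A H → C A H := by
  intro n
  induction n using Nat.strong_induction_on with
  | _ n ih =>
    intro H hn hAH hP
    rcases eq_or_lt_of_le hAH with rfl | hlt
    · exact ⟨fun _ => 1, fun _ _ _ _ => by simp, fun _ _ => rfl, fun h hh => by simpa using hh⟩
    · obtain ⟨M, x, hAM, hs⟩ := exists_step hG hlt
      have hP' := P_down hG hA hAM hs hP
      have hlt : M < H := lt_of_le_of_ne hs.le (by rintro rfl; exact hs.nmem hs.mem)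
      have hcard : Nat.card M < n := by
        rw [← hn]
        exact Set.ncard_lt_ncard (s := (M : Set G)) (t := (H : Set G)) hlt (Set.toFinite _)
      exact C_up hA hAM hs hP hP' (ih _ hcard M rfl hAM hP')
end Gas

namespace Gas
variable {G : Type*} [Group G]

theorem normal_meets_center {p : ℕ} [hp : Fact p.Prime] [Finite G] (hG : IsPGroup p G)
    {K : Subgroup G} [hK : K.Normal] (h : K ≠ ⊥) : ∃ e ∈ K, e ≠ 1 ∧ ∀ g, g * e = e * g := by
  have hC : IsPGroup p (ConjAct G) := hG.of_equiv ConjAct.toConjAct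
  have hnt : Nontrivial K := (Subgroup.nontrivial_iff_ne_bot K).2 h
  have hd : p ∣ Nat.card K := by
    rcases (hG.to_subgroup K).card_eq_or_dvd with h1 | h1
    · exact absurd h1 (Finite.one_lt_card).ne'
    · exact h1
  obtain ⟨b, hb, hne⟩ := hC.exists_fixed_point_of_prime_dvd_card_of_fixed_point K hd (a := 1)
    (by intro g; simp)
  refine ⟨b, b.2, fun h => hne (Subtype.ext h.symm), fun g => ?_⟩
  have := congrArg Subtype.val (hb (ConjAct.toConjAct g))
  rw [ConjAct.Subgroup.val_conj_smul, ConjAct.toConjAct_smul] at this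
  rw [mul_inv_eq_iff_eq_mul] at this
  exact this

theorem quot_central {p : ℕ} [hp : Fact p.Prime] [Finite G] (hG : IsPGroup p G)
    {A K : Subgroup G} [hA : A.Normal] [hK : K.Normal] (h : ¬ K ≤ A) :
    ∃ e ∈ K, e ∉ A ∧ ∀ g, g * e * g⁻¹ * e⁻¹ ∈ A := by
  have hn : (K.map (QuotientGroup.mk' A)).Normal := hK.map _ (QuotientGroup.mk'_surjective A)
  obtain ⟨e', he', hne, hc⟩ := normal_meets_center (hG.to_quotient A)
    (K := K.map (QuotientGroup.mk' A)) (by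
      intro hb
      apply h
      rw [Subgroup.map_eq_bot_iff, QuotientGroup.ker_mk'] at hb
      exact hb)
  obtain ⟨e, he, rfl⟩ := he'
  refine ⟨e, he, fun hh => hne ((QuotientGroup.eq_one_iff e).2 hh), fun g => ?_⟩
  have := hc (g : G ⧸ A)
  rw [cos_iff, QuotientGroup.mk_mul, QuotientGroup.mk_mul, QuotientGroup.mk_inv,
    mul_inv_eq_iff_eq_mul]
  exact this

/-- maximal abelian normal subgroups are self-centralizing -/
theorem exists_self_centralizing {p : ℕ} [hp : Fact p.Prime] [Finite G] (hG : IsPGroup p G)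
    (W : Subgroup G) [hW : W.Normal] (hWc : W ≤ Subgroup.centralizer (W : Set G)) :
    ∃ A : Subgroup G, W ≤ A ∧ A.Normal ∧ A ≤ Subgroup.centralizer (A : Set G) ∧
      Subgroup.centralizer (A : Set G) ≤ A := by
  obtain ⟨A, hWA, hA⟩ := Finite.exists_le_maximal
    (p := fun A : Subgroup G => A.Normal ∧ A ≤ Subgroup.centralizer (A : Set G)) (a := W) ⟨hW, hWc⟩
  have hAn := hA.1.1
  have hAc := hA.1.2
  refine ⟨A, hWA, hAn, hAc, ?_⟩
  by_contra hcon
  obtain ⟨e, heK, heA, he⟩ := quot_central hG hcon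
  have hz : Subgroup.zpowers e ≤ Subgroup.centralizer (A : Set G) := by
    rwa [Subgroup.zpowers_le]
  have hEA : A ⊔ Subgroup.zpowers e ≤ Subgroup.centralizer (A : Set G) := sup_le hAc hz
  have hzz : Subgroup.zpowers e ≤ Subgroup.centralizer (Subgroup.zpowers e : Set G) := by
    rw [Subgroup.zpowers_le, Subgroup.mem_centralizer_iff]
    rintro _ ⟨i, rfl⟩
    exact ((Commute.refl e).zpow_left i).eq
  have hEe : A ⊔ Subgroup.zpowers e ≤ Subgroup.centralizer (Subgroup.zpowers e : Set G) :=
    sup_le (Subgroup.le_centralizer_iff.1 hz) hzz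
  have hE : (A ⊔ Subgroup.zpowers e).Normal ∧
      A ⊔ Subgroup.zpowers e ≤ Subgroup.centralizer ((A ⊔ Subgroup.zpowers e : Subgroup G) : Set G) := by
    refine ⟨⟨fun n hn g => ?_⟩, sup_le (Subgroup.le_centralizer_iff.1 hEA)
      (Subgroup.le_centralizer_iff.1 hEe)⟩
    have : A ⊔ Subgroup.zpowers e ≤ (A ⊔ Subgroup.zpowers e).comap (MulAut.conj g).toMonoidHom := by
      refine sup_le (fun a ha => ?_) ?_
      · exact Subgroup.mem_sup_left (hAn.conj_mem a ha g)
      · rw [Subgroup.zpowers_le]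
        show g * e * g⁻¹ ∈ A ⊔ Subgroup.zpowers e
        have := (A ⊔ Subgroup.zpowers e).mul_mem (Subgroup.mem_sup_left (he g))
          (Subgroup.mem_sup_right (Subgroup.mem_zpowers e))
        simpa using this
    exact this hn
  have := hA.2 hE le_sup_left
  exact heA (this (Subgroup.mem_sup_right (Subgroup.mem_zpowers e)))

theorem comm_pow {u g ζ : G} (hζ : ∀ g, ζ * g = g * ζ) (h : u * g = ζ * (g * u)) (n : ℕ) :
    u ^ n * g = ζ ^ n * (g * u ^ n) := by
  induction n with
  | zero => simp
  | succ n ih =>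
    have e : ∀ g, ζ ^ n * g = g * ζ ^ n := fun g => (Commute.pow_left (hζ g) n).eq
    calc u ^ (n + 1) * g = u * (u ^ n * g) := by rw [pow_succ']; group
      _ = u * ζ ^ n * (g * u ^ n) := by rw [ih]; group
      _ = ζ ^ n * (u * g) * u ^ n := by rw [← e u]; group
      _ = _ := by rw [h, pow_succ, pow_succ']; group

section main
variable {p : ℕ} [hp : Fact p.Prime] [Finite G] (hG : IsPGroup p G)
  (hZ : ∀ M : Subgroup G, M.index = p → Subgroup.center G ≤ M)
  (hNO : ∀ A : Subgroup G, A.Normal → Subgroup.center G ≤ A →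
    Subgroup.centralizer (A : Set G) ≤ A → P A ⊤)
include hG hZ

theorem cent_le {M : Subgroup G} (hM : M.index = p) {a : G} (ha : ∀ m ∈ M, a * m = m * a) :
    a ∈ M := by
  by_contra h
  have hs := step_of_index hG hM h
  apply h
  apply hZ M hM
  rw [Subgroup.mem_center_iff]
  intro g
  obtain ⟨m, hm, i, rfl⟩ := hs.gen g (Subgroup.mem_top _)
  have h1 : Commute a m := ha m hm
  exact (h1.mul_right ((Commute.refl a).pow_right i)).eq.symm

include hNO

theorem D1 {M : Subgroup G} (hM : M.index = p) {x : G} (hx : x ∉ M) {z : G}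
    (hz : ∀ m ∈ M, z * m = m * z) (h : (z * x) ^ p = x ^ p) :
    ∃ a, (∀ m ∈ M, a * m = m * a) ∧ z = a * x * a⁻¹ * x⁻¹ := by
  have hn := normal_of_index hG hM
  have hP := hNO M hn (hZ M hM) (fun a ha => cent_le hG hZ hM (fun m hm =>
    (Subgroup.mem_centralizer_iff.1 ha m hm).symm))
  obtain ⟨a, -, h1, h2⟩ := kernel_lemma le_rfl (step_of_index hG hM hx) hP (cent_le hG hZ hM hz) hz h
  exact ⟨a, h1, h2⟩

theorem D2 {M : Subgroup G} (hM : M.index = p) {x : G} (hx : x ∉ M) {c : G}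
    (hc : ∀ g, c * g = g * c) (hcp : c ^ p = 1) :
    ∃ a, (∀ m ∈ M, a * m = m * a) ∧ c = a * x * a⁻¹ * x⁻¹ := by
  refine D1 hG hZ hNO hM hx (fun m _ => hc m) ?_
  have : Commute c x := hc x
  rw [this.mul_pow, hcp, one_mul]

theorem D3 {c : G} (hc1 : c ≠ 1) (hc : ∀ g, c * g = g * c) (hcp : c ^ p = 1)
    {M M₂ : Subgroup G} (hM : M.index = p) (hM₂ : M₂.index = p) {a : G}
    (ha : ∀ m ∈ M, a * m = m * a) : a ∈ M₂ := by
  classical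
  by_contra haM₂
  have haM := cent_le hG hZ hM ha
  obtain ⟨b, hb, hcb⟩ := D2 hG hZ hNO hM₂ haM₂ hc hcp
  have hbM₂ := cent_le hG hZ hM₂ hb
  have hba : b * a = c * (a * b) := by rw [hcb]; group
  have hbM : b ∉ M := by
    intro h
    have := ha b h
    rw [← this] at hba
    exact hc1 (by simpa using hba.symm)
  have hgen : ∀ g : G, ∃ n, n ∈ M ∧ n ∈ M₂ ∧ ∃ i j : ℕ, g = n * a ^ i * b ^ j := by
    intro g
    obtain ⟨m, hm, j, rfl⟩ := (step_of_index hG hM hbM).gen g (Subgroup.mem_top _)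
    obtain ⟨n, hn, i, rfl⟩ := (step_of_index hG hM₂ haM₂).gen m (Subgroup.mem_top _)
    exact ⟨n, (M.mul_mem_cancel_right (M.pow_mem haM i)).1 hm, hn, i, j, rfl⟩
  have hcent : ∀ k, (∀ n, n ∈ M → n ∈ M₂ → Commute k n) → Commute k a → Commute k b →
      ∀ g, Commute k g := by
    intro k h1 h2 h3 g
    obtain ⟨n, hn, hn', i, j, rfl⟩ := hgen g
    exact ((h1 n hn hn').mul_right (h2.pow_right i)).mul_right (h3.pow_right j)
  -- elements commuting with the intersection
  let D : G → Prop := fun u => ∀ n, n ∈ M → n ∈ M₂ → Commute u n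
  have hDa : D a := fun n hn _ => ha n hn
  have hDb : D b := fun n _ hn => hb n hn
  have hDmul : ∀ u v, D u → D v → D (u * v) := fun u v hu hv n h1 h2 =>
    (hu n h1 h2).mul_left (hv n h1 h2)
  have hDinv : ∀ u, D u → D u⁻¹ := fun u hu n h1 h2 => (hu n h1 h2).inv_left
  have hDpow : ∀ u, D u → ∀ i : ℕ, D (u ^ i) := fun u hu i n h1 h2 => (hu n h1 h2).pow_left i
  have hDform : ∀ u, D u → ∃ ζ, (∀ g, Commute ζ g) ∧ ∃ i j : ℕ, u = ζ * a ^ i * b ^ j := by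
    intro u hu
    obtain ⟨n, hn, hn', i, j, hh⟩ := hgen u
    refine ⟨n, ?_, i, j, hh⟩
    have hDn : D n := by
      have : n = u * ((b ^ j)⁻¹ * (a ^ i)⁻¹) := by rw [hh]; group
      rw [this]
      exact hDmul _ _ hu (hDmul _ _ (hDinv _ (hDpow _ hDb j)) (hDinv _ (hDpow _ hDa i)))
    exact hcent n hDn (ha n hn).symm (hb n hn').symm
  have hzn : (Subgroup.zpowers c).Normal := by
    refine ⟨fun n hn g => ?_⟩
    obtain ⟨i, rfl⟩ := hn
    have : Commute c g := hc g
    have := (this.zpow_left i).eq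
    simp only
    rw [← this]; simp
  have qc : ((c : G) : G ⧸ Subgroup.zpowers c) = 1 :=
    (QuotientGroup.eq_one_iff c).2 (Subgroup.mem_zpowers c)
  let q := QuotientGroup.mk' (Subgroup.zpowers c)
  have qab : Commute (q b) (q a) := by
    have := congrArg q hba
    rw [map_mul, map_mul, map_mul] at this
    have h1 : q c = 1 := qc
    rw [h1, one_mul] at this
    exact this
  have qcent : ∀ u, D u → Commute (q u) (q a) → Commute (q u) (q b) → ∀ g, Commute (q u) (q g) := by
    intro u hu h1 h2 g
    obtain ⟨n, hn, hn', i, j, rfl⟩ := hgen g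
    rw [map_mul, map_mul, map_pow, map_pow]
    exact (((hu n hn hn').map q).mul_right (h1.pow_right i)).mul_right (h2.pow_right j)
  have hT : ∀ u, D u → ∀ g, u * g * u⁻¹ * g⁻¹ ∈ Subgroup.zpowers c := by
    intro u hu g
    obtain ⟨ζ, hζ, i, j, rfl⟩ := hDform u hu
    have hq : Commute (q (ζ * a ^ i * b ^ j)) (q g) := by
      rw [map_mul, map_mul, map_pow, map_pow]
      exact (((hζ g).map q).mul_left ((qcent a hDa (Commute.refl _) qab.symm g).pow_left i)).mul_left
        ((qcent b hDb qab (Commute.refl _) g).pow_left j)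
    rw [cos_iff, QuotientGroup.mk_mul, QuotientGroup.mk_mul, QuotientGroup.mk_inv,
      mul_inv_eq_iff_eq_mul]
    exact hq.eq
  have hzc : ∀ ζ ∈ Subgroup.zpowers c, (∀ g, ζ * g = g * ζ) ∧ ζ ^ p = 1 := by
    rintro _ ⟨i, rfl⟩
    refine ⟨fun g => ((show Commute c g from hc g).zpow_left i).eq, ?_⟩
    simp only
    rw [← zpow_natCast, ← zpow_mul, mul_comm, zpow_mul, zpow_natCast, hcp, one_zpow]
  have hDp : ∀ u, D u → u ^ p ∈ Subgroup.center G := by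
    intro u hu
    rw [Subgroup.mem_center_iff]
    intro g
    obtain ⟨h1, h2⟩ := hzc _ (hT u hu g)
    have := comm_pow (u := u) (g := g) h1 (by group) p
    rw [h2, one_mul] at this
    exact this.symm
  have hOm : ∀ ζ, (∀ g, ζ * g = g * ζ) → ζ ^ p = 1 → ζ ∈ Subgroup.zpowers c := by
    intro ζ h1 h2
    obtain ⟨w, hw, hwz⟩ := D2 hG hZ hNO hM₂ haM₂ h1 h2
    rw [hwz]
    exact hT w (fun n _ hn => hw n hn) a
  have hordc : orderOf c = p := orderOf_eq_prime hcp hc1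
  have hcardc : Nat.card (Subgroup.zpowers c) = p := by rw [Nat.card_zpowers, hordc]
  -- no two noncommuting elements of D have the same p-th power
  have hno : ∀ X Y, D X → D Y → X ^ p = Y ^ p → Commute X Y := by
    intro X Y hX hY hXY
    by_contra hnc
    set u := Y * X⁻¹ with hu
    have hDu : D u := hDmul _ _ hY (hDinv _ hX)
    let f : G →* G :=
      { toFun := fun g => u * g * u⁻¹ * g⁻¹
        map_one' := by group
        map_mul' := by
          intro g h
          have := (hzc _ (hT u hDu h)).1 g
          calc u * (g * h) * u⁻¹ * (g * h)⁻¹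
              = (u * g * u⁻¹ * g⁻¹) * (g * (u * h * u⁻¹ * h⁻¹)) * g⁻¹ := by group
            _ = _ := by rw [← this]; group }
    have hmem : ∀ g, g ∈ f.ker ↔ u * g = g * u := by
      intro g
      rw [MonoidHom.mem_ker]
      show u * g * u⁻¹ * g⁻¹ = 1 ↔ _
      rw [mul_inv_eq_one, mul_inv_eq_iff_eq_mul]
    have hXk : X ∉ f.ker := by
      rw [hmem]
      intro h
      apply hnc
      have : Commute u X := h
      have h2 : Commute (u * X) X := this.mul_left (Commute.refl X)
      have e : u * X = Y := by rw [hu]; group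
      rw [e] at h2
      exact h2.symm
    have hidx : f.ker.index = p := by
      rw [Subgroup.index_ker]
      have hle : f.range ≤ Subgroup.zpowers c := by
        rintro _ ⟨g, rfl⟩
        exact hT u hDu g
      have hd := Subgroup.card_dvd_of_le hle
      rw [hcardc] at hd
      rcases (Nat.dvd_prime hp.out).1 hd with h1 | h1
      · exfalso
        rw [Subgroup.card_eq_one] at h1
        apply hXk
        have : f X ∈ f.range := ⟨X, rfl⟩
        rw [h1] at this
        exact this
      · exact h1
    obtain ⟨v, hv, hvu⟩ := D1 hG hZ hNO hidx hXk (z := u) (fun m hm => (hmem m).1 hm)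
      (by rw [hXY]; congr 1; rw [hu]; group)
    have hDv : D v := fun n h1 h2 => hv n ((hmem n).2 (hDu n h1 h2))
    have := (hzc _ (hT v hDv X)).1 X
    rw [← hvu] at this
    exact hXk ((hmem X).2 this)
  -- pigeonhole
  have hcc : ∀ x y : Subgroup.center G, x * y = y * x := fun x y =>
    Subtype.ext (Subgroup.mem_center_iff.1 y.2 x)
  let π : (Subgroup.center G) →* (Subgroup.center G) :=
    { toFun := fun z => z ^ p
      map_one' := one_pow p
      map_mul' := fun x y => (show Commute x y from hcc x y).mul_pow p }
  have hπn : π.range.Normal := ⟨fun n hn g => by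
    rw [hcc g n, mul_inv_cancel_right]; exact hn⟩
  have hcard : Nat.card ((Subgroup.center G) ⧸ π.range) ≤ p := by
    have h1 : π.ker.index = Nat.card π.range := Subgroup.index_ker π
    have h2 := π.ker.card_mul_index
    have h3 := π.range.card_mul_index
    have h4 : π.range.index = Nat.card π.ker := by
      rw [h1, mul_comm, ← h3] at h2
      exact (Nat.eq_of_mul_eq_mul_left Nat.card_pos h2).symm
    change π.range.index ≤ p
    rw [h4, ← hcardc]
    refine Nat.card_le_card_of_injective (fun k : π.ker => (⟨((k : (Subgroup.center G)) : G), hOm _ ?_ ?_⟩ :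
      Subgroup.zpowers c)) ?_
    · intro g
      exact (Subgroup.mem_center_iff.1 (k : (Subgroup.center G)).2 g).symm
    · have := congrArg Subtype.val (MonoidHom.mem_ker.1 k.2)
      simpa [π] using this
    · intro k l hkl
      have := congrArg Subtype.val hkl
      exact Subtype.ext (Subtype.ext this)
  let X : Option (Fin p) → G := fun o => o.elim a (fun j => a ^ (j : ℕ) * b)
  have hDX : ∀ o, D (X o) := by
    intro o
    cases o with
    | none => exact hDa
    | some j => exact hDmul _ _ (hDpow _ hDa _) hDb
  have : Fintype ((Subgroup.center G) ⧸ π.range) := Fintype.ofFinite _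
  obtain ⟨o₁, o₂, hne, heq⟩ := Fintype.exists_ne_map_eq_of_card_lt
    (fun o => ((⟨X o ^ p, hDp _ (hDX o)⟩ : (Subgroup.center G)) : (Subgroup.center G) ⧸ π.range)) (by
      rw [← Nat.card_eq_fintype_card, Fintype.card_option, Fintype.card_fin]
      omega)
  have hXcomm : Commute (X o₁) (X o₂) := by
    rw [QuotientGroup.eq_iff_div_mem] at heq
    obtain ⟨ζ, hζ⟩ := heq
    have hζ' : (ζ : G) ^ p = X o₁ ^ p * (X o₂ ^ p)⁻¹ := by
      have := congrArg Subtype.val hζ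
      simpa [π, div_eq_mul_inv] using this
    have hζc : ∀ g, Commute (ζ : G) g := fun g => (Subgroup.mem_center_iff.1 ζ.2 g).symm
    have hDζ : D (ζ : G) := fun n _ _ => hζc n
    have h5 := hno (X o₁) (ζ * X o₂) (hDX _) (hDmul _ _ hDζ (hDX _)) (by
      rw [(hζc (X o₂)).mul_pow, hζ']; group)
    have h6 := (hζc (X o₁)).symm.inv_right.mul_right h5
    simpa using h6
  have hnab : ¬ Commute a b := by
    intro h
    rw [h.eq] at hba
    exact hc1 (by simpa using hba.symm)
  have hlt : ∀ i j : Fin p, i < j → ¬ Commute (X (some i)) (X (some j)) := by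
    intro i j hij h
    have hij' : (i : ℕ) < j := hij
    obtain ⟨k, hk⟩ := Nat.exists_eq_add_of_lt hij'
    have e : X (some j) = a ^ (k + 1) * X (some i) := by
      show a ^ (j : ℕ) * b = a ^ (k + 1) * (a ^ (i : ℕ) * b)
      rw [hk, ← mul_assoc, ← pow_add]; congr 2; omega
    rw [e] at h
    have h2 : Commute (X (some i)) (a ^ (k + 1)) := by
      have := h.mul_right (Commute.refl (X (some i))).inv_right
      simpa using this
    have h3 : Commute b (a ^ (k + 1)) := by
      have h4 : Commute (a ^ (i : ℕ)) (a ^ (k + 1)) := (Commute.refl a).pow_pow _ _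
      have := h4.inv_left.mul_left h2
      simpa [X] using this
    have hci : ∀ g, c⁻¹ * g = g * c⁻¹ := fun g => (show Commute c g from hc g).inv_left.eq
    have h5 := comm_pow (u := a) (g := b) (ζ := c⁻¹) hci (by rw [hba]; group) (k + 1)
    rw [h3.eq] at h5
    have h6 : c⁻¹ ^ (k + 1) = 1 := by simpa using h5.symm
    rw [inv_pow, inv_eq_one] at h6
    have h7 := orderOf_dvd_of_pow_eq_one h6
    rw [hordc] at h7
    have := Nat.le_of_dvd (by omega) h7
    have := j.2
    omega
  have hanone : ∀ j, ¬ Commute a (X (some j)) := by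
    intro j h
    apply hnab
    have := ((Commute.refl a).pow_right (j : ℕ)).inv_right.mul_right h
    simpa [X] using this
  rcases o₁ with _ | i <;> rcases o₂ with _ | j
  · exact hne rfl
  · exact hanone j hXcomm
  · exact hanone i hXcomm.symm
  · rcases lt_trichotomy i j with h | h | h
    · exact hlt i j h hXcomm
    · exact hne (by rw [h])
    · exact hlt j i h hXcomm.symm

theorem D4 [Nontrivial G] : False := by
  have hpc : p ∣ Nat.card (Subgroup.center G) := by
    have := hG.center_nontrivial
    rcases (hG.to_subgroup (Subgroup.center G)).card_eq_or_dvd with h1 | h1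
    · exact absurd h1 (Finite.one_lt_card).ne'
    · exact h1
  obtain ⟨c', hc'⟩ := exists_prime_orderOf_dvd_card' p hpc
  obtain ⟨c, hcZ⟩ := c'
  rw [Subgroup.orderOf_mk] at hc'
  have hc1 : c ≠ 1 := by
    rintro rfl
    rw [orderOf_one] at hc'
    exact hp.out.one_lt.ne hc'
  have hcp : c ^ p = 1 := by rw [← hc', pow_orderOf_eq_one]
  have hc : ∀ g, c * g = g * c := fun g => (Subgroup.mem_center_iff.1 hcZ g).symm
  let F : Subgroup G := sInf {M | M.index = p}
  have hF : ∀ g, g ∈ F ↔ ∀ M : Subgroup G, M.index = p → g ∈ M := by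
    intro g; simp [F, Subgroup.mem_sInf]
  have hFn : F.Normal := by
    refine ⟨fun n hn g => ?_⟩
    rw [hF] at hn ⊢
    intro M hM
    exact (normal_of_index hG hM).conj_mem n (hn M hM) g
  obtain ⟨A, hWA, hAn, hAc, hcA⟩ := exists_self_centralizing hG
    (F ⊓ Subgroup.centralizer (F : Set G)) (by
      intro g hg
      rw [Subgroup.mem_centralizer_iff]
      intro h hh
      exact Subgroup.mem_centralizer_iff.1 hg.2 h hh.1)
  have hCA : ∀ M : Subgroup G, M.index = p → ∀ z, (∀ m ∈ M, z * m = m * z) → z ∈ A := by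
    intro M hM z hz
    apply hWA
    refine ⟨(hF z).2 fun M' hM' => D3 hG hZ hNO hc1 hc hcp hM hM' hz, ?_⟩
    show z ∈ Subgroup.centralizer (F : Set G)
    rw [Subgroup.mem_centralizer_iff]
    intro f hf
    exact (hz f ((hF f).1 hf M hM)).symm
  have hAcomm : ∀ a ∈ A, ∀ b ∈ A, a * b = b * a := fun a ha b hb =>
    (Subgroup.mem_centralizer_iff.1 (hAc ha) b hb).symm
  have hAM : ∀ M : Subgroup G, M.index = p → A ≤ M := by
    intro M hM a ha
    by_contra h
    obtain ⟨z, hz, hcz⟩ := D2 hG hZ hNO hM h hc hcp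
    have := hAcomm z (hCA M hM z hz) a ha
    rw [this] at hcz
    exact hc1 (by rw [hcz]; group)
  obtain ⟨M₀, -, hM₀⟩ := exists_index_prime hG (K := (⊥ : Subgroup G)) bot_ne_top
  have hZA : Subgroup.center G ≤ A := fun z hz =>
    hCA M₀ hM₀ z (fun m _ => (Subgroup.mem_center_iff.1 hz m).symm)
  obtain ⟨ψ, h1, h2, h3⟩ := complement hG hAcomm _ ⊤ rfl le_top (hNO A hAn hZA hcA)
  let Ψ : G →* G := ⟨⟨ψ, h1.one⟩, fun a b => h1 a trivial b trivial⟩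
  have hsurj : Ψ.range = ⊤ := by
    by_contra hne
    obtain ⟨M, hM1, hM⟩ := exists_index_prime hG hne
    have : M = ⊤ := by
      rw [eq_top_iff]
      intro g _
      have h4 := hAM M hM (h3 g trivial)
      have h5 : ψ g ∈ M := hM1 ⟨g, rfl⟩
      have h6 := (M.mul_mem_cancel_left h5).1 h4
      simpa using h6
    rw [this, Subgroup.index_top] at hM
    exact hp.out.one_lt.ne hM
  have hinj : Function.Injective Ψ :=
    Finite.injective_iff_surjective.2 (MonoidHom.range_eq_top.1 hsurj)
  apply hc1
  apply hinj
  rw [map_one]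
  exact h2 c (hZA hcZ)
end main
end Gas

namespace Gas
universe u

theorem mkaut {G : Type*} [Group G] [Finite G] {p : ℕ} [hp : Fact p.Prime] (Φ : G →* G) (k : ℕ)
    (h : ∀ g, Φ^[p ^ k] g = g) : ∃ α : MulAut G, (∀ g, α g = Φ g) ∧ α ^ p ^ k = 1 := by
  have hpos : 0 < p ^ k := pow_pos hp.out.pos k
  have hinj : Function.Injective Φ := by
    have : Function.Injective (Φ^[p ^ k - 1 + 1]) := by
      rw [Nat.sub_add_cancel hpos]
      intro a b hab
      rwa [h, h] at hab
    rw [Function.iterate_succ] at this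
    exact this.of_comp
  let α : MulAut G := MulEquiv.ofBijective Φ ⟨hinj, Finite.injective_iff_surjective.1 hinj⟩
  have hα : ∀ g, α g = Φ g := fun g => rfl
  have hi : ∀ (n : ℕ) g, (α ^ n) g = Φ^[n] g := by
    intro n
    induction n with
    | zero => intro g; rfl
    | succ n ih =>
      intro g
      rw [pow_succ', MulAut.mul_apply, ih, Function.iterate_succ_apply', hα]
  refine ⟨α, hα, ?_⟩
  ext g
  rw [hi, h]; rfl

theorem iter_eq {G : Type*} [Group G] {A : Subgroup G} (Φ : G →* G) (hA : ∀ a ∈ A, Φ a = a)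
    (hΦ : ∀ g, Φ g * g⁻¹ ∈ A) (g : G) (n : ℕ) : Φ^[n] g = (Φ g * g⁻¹) ^ n * g := by
  induction n with
  | zero => simp
  | succ n ih =>
    rw [Function.iterate_succ_apply', ih, map_mul, hA _ (A.pow_mem (hΦ g) n), pow_succ]
    group

theorem aut_of {G : Type*} [Group G] [Finite G] {p : ℕ} [hp : Fact p.Prime] (hG : IsPGroup p G)
    {A : Subgroup G} (Φ : G →* G) (hA : ∀ a ∈ A, Φ a = a)
    (hΦ : ∀ g, Φ g * g⁻¹ ∈ A) : ∃ (α : MulAut G) (k : ℕ), (∀ g, α g = Φ g) ∧ α ^ p ^ k = 1 := by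
  obtain ⟨k, hk⟩ := IsPGroup.iff_card.1 hG
  obtain ⟨α, h1, h2⟩ := mkaut (p := p) Φ k (by
    intro g
    rw [iter_eq Φ hA hΦ, ← hk, pow_card_eq_one', one_mul])
  exact ⟨α, k, h1, h2⟩

theorem core (p : ℕ) [hp : Fact p.Prime] : ∀ (n : ℕ) (G : Type u) [Group G] [Finite G],
    Nat.card G = n → IsPGroup p G → (∃ a b : G, a * b ≠ b * a) →
    ∃ φ : MulAut G, φ ∉ (MulAut.conj : G →* MulAut G).range ∧ (∃ k : ℕ, φ ^ p ^ k = 1) ∧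
      ∀ z ∈ Subgroup.center G, φ z = z := by
  intro n
  induction n using Nat.strong_induction_on with
  | _ n ih =>
    intro G _ _ hn hG hnab
    by_cases hZ : ∀ M : Subgroup G, M.index = p → Subgroup.center G ≤ M
    · by_contra hcon
      have : Nontrivial G := by
        obtain ⟨a, b, hab⟩ := hnab
        exact ⟨_, _, hab⟩
      refine D4 hG hZ ?_
      intro A hAn hZA hcA φ h1 h2 h3
      let Φ : G →* G := ⟨⟨φ, h1.one⟩, fun a b => h1 a trivial b trivial⟩
      obtain ⟨α, k, hα, hk⟩ := aut_of hG (A := A) Φ h2 (fun g => h3 g trivial)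
      have : α ∈ (MulAut.conj : G →* MulAut G).range := by
        by_contra hh
        exact hcon ⟨α, hh, ⟨k, hk⟩, fun z hz => by rw [hα]; exact h2 z (hZA hz)⟩
      obtain ⟨a, ha⟩ := this
      have hag : ∀ g, φ g = a * g * a⁻¹ := by
        intro g
        have := hα g
        rw [← ha, MulAut.conj_apply] at this
        exact this.symm
      refine ⟨a, hcA ?_, fun g _ => hag g⟩
      rw [Subgroup.mem_centralizer_iff]
      intro b hb
      have := hag b
      rw [h2 b hb, eq_mul_inv_iff_mul_eq] at this
      exact this
    · push Not at hZ
      obtain ⟨M, hM, hZM⟩ := hZ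
      obtain ⟨x, hxZ, hxM⟩ := SetLike.not_le_iff_exists.1 hZM
      have hs := step_of_index hG hM hxM
      have hxc : ∀ g, Commute x g := fun g => (Subgroup.mem_center_iff.1 hxZ g).symm
      have hlt : Nat.card M < n := by
        rw [← hn, ← M.card_mul_index, hM]
        exact lt_mul_of_one_lt_right Nat.card_pos hp.out.one_lt
      have hMnab : ∃ a b : M, a * b ≠ b * a := by
        by_contra! hc
        obtain ⟨a, b, hab⟩ := hnab
        apply hab
        obtain ⟨m, hm, i, rfl⟩ := hs.gen a trivial
        obtain ⟨m', hm', j, rfl⟩ := hs.gen b trivial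
        have h1 : Commute m m' := congrArg Subtype.val (hc ⟨m, hm⟩ ⟨m', hm'⟩)
        have h2 : ∀ (i : ℕ) g, Commute (x ^ i) g := fun i g => (hxc g).pow_left i
        exact (((h1.mul_right (h2 j m).symm)).mul_left (h2 i _)).eq
      obtain ⟨φ, hφ1, ⟨k, hφk⟩, hφZ⟩ := ih _ hlt M rfl (hG.to_subgroup M) hMnab
      classical
      let f : G → G := fun g => if h : g ∈ M then ((φ ⟨g, h⟩ : M) : G) else 1
      have hf : ∀ m : M, f m = φ m := by intro m; simp [f]
      have hfhom : HomOn M f := by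
        intro a ha b hb
        have := hf (⟨a, ha⟩ * ⟨b, hb⟩)
        rw [map_mul] at this
        have h1 := hf ⟨a, ha⟩
        have h2 := hf ⟨b, hb⟩
        simp only [Subgroup.coe_mul] at this h1 h2
        rw [this, h1, h2]
      have hfZ : ∀ m ∈ M, m ∈ Subgroup.center G → f m = m := by
        intro m hm hmZ
        have := hf ⟨m, hm⟩
        rw [hφZ ⟨m, hm⟩ (by
          rw [Subgroup.mem_center_iff]
          intro g
          exact Subtype.ext (Subgroup.mem_center_iff.1 hmZ g))] at this
        exact this
      obtain ⟨Φ', h1, h2⟩ := ext hs hfhom (y := x) (by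
        intro m hm
        rw [(hxc m).eq, mul_inv_cancel_right, (hxc (f m)).eq, mul_inv_cancel_right])
        (hfZ _ hs.pow ((Subgroup.center G).pow_mem hxZ p))
      let Φ : G →* G := ⟨⟨Φ', h1.one⟩, fun a b => h1 a trivial b trivial⟩
      have hΦ : ∀ (m : M) (i : ℕ), Φ (m * x ^ i) = φ m * x ^ i := by
        intro m i
        rw [← hf]
        exact h2 m m.2 i
      have hit : ∀ (N : ℕ) (m : M) (i : ℕ), Φ^[N] (m * x ^ i) = ((φ ^ N) m : M) * x ^ i := by
        intro N
        induction N with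
        | zero => intro m i; simp
        | succ N ihN =>
          intro m i
          rw [Function.iterate_succ_apply', ihN, hΦ, pow_succ', MulAut.mul_apply]
      obtain ⟨α, hα, hαk⟩ := mkaut (p := p) Φ k (by
        intro g
        obtain ⟨m, hm, i, rfl⟩ := hs.gen g trivial
        have := hit (p ^ k) ⟨m, hm⟩ i
        rw [hφk] at this
        simpa using this)
      refine ⟨α, ?_, ⟨k, hαk⟩, ?_⟩
      · rintro ⟨a, ha⟩
        apply hφ1
        obtain ⟨m, hm, i, rfl⟩ := hs.gen a trivial
        refine ⟨⟨m, hm⟩, ?_⟩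
        ext g
        have h3 := hα g
        have h4 := hΦ g 0
        rw [pow_zero, mul_one, mul_one] at h4
        rw [h4, ← ha, MulAut.conj_apply] at h3
        rw [← h3, MulAut.conj_apply]
        have h5 : x ^ i * (g : G) = g * x ^ i := ((hxc g).pow_left i).eq
        calc m * (g : G) * m⁻¹ = m * (g * x ^ i) * (x ^ i)⁻¹ * m⁻¹ := by group
          _ = _ := by rw [← h5]; group
      · intro z hz
        obtain ⟨m, hm, i, rfl⟩ := hs.gen z trivial
        have hmZ : m ∈ Subgroup.center G :=
          ((Subgroup.center G).mul_mem_cancel_right ((Subgroup.center G).pow_mem hxZ i)).1 hz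
        rw [hα]
        show Φ' (m * x ^ i) = _
        rw [h2 m hm, hfZ m hm hmZ]

theorem final (p : ℕ) [hp : Fact p.Prime] (G : Type*) [Group G]
    [Finite G] (hG : IsPGroup p G) (hcard : p ^ 2 ≤ Nat.card G) :
    ∃ φ : MulAut G, φ ∉ (MulAut.conj : G →* MulAut G).range ∧ ∃ k : ℕ, orderOf φ = p ^ k := by
  suffices h : ∃ φ : MulAut G, φ ∉ (MulAut.conj : G →* MulAut G).range ∧ ∃ k : ℕ, φ ^ p ^ k = 1 by
    obtain ⟨φ, h1, k, h2⟩ := h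
    obtain ⟨j, -, hj⟩ := (Nat.dvd_prime_pow hp.out).1 (orderOf_dvd_of_pow_eq_one h2)
    exact ⟨φ, h1, j, hj⟩
  by_cases hab : ∃ a b : G, a * b ≠ b * a
  · obtain ⟨φ, h1, h2, -⟩ := core p _ G rfl hG hab
    exact ⟨φ, h1, h2⟩
  push Not at hab
  have hp2 : p < p ^ 2 := by nlinarith [hp.out.one_lt]
  have hp1 := hp.out.one_lt
  have hne : (⊥ : Subgroup G) ≠ ⊤ := by
    intro h
    have h1 : Nat.card (⊥ : Subgroup G) = Nat.card (⊤ : Subgroup G) := by rw [h]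
    rw [Subgroup.card_bot, Subgroup.card_top] at h1
    omega
  obtain ⟨M, -, hM⟩ := exists_index_prime hG hne
  have hMc : Nat.card M ≠ 1 := by
    intro h
    have := M.card_mul_index
    rw [h, hM] at this
    omega
  have hd : p ∣ Nat.card M := ((hG.to_subgroup M).card_eq_or_dvd).resolve_left hMc
  obtain ⟨⟨z, hzM⟩, hz⟩ := exists_prime_orderOf_dvd_card' p hd
  rw [Subgroup.orderOf_mk] at hz
  have hz1 : z ≠ 1 := by
    rintro rfl
    rw [orderOf_one] at hz
    omega
  have hzp : z ^ p = 1 := by rw [← hz, pow_orderOf_eq_one]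
  obtain ⟨x, hx⟩ : ∃ x, x ∉ M := by
    by_contra! h
    have : M = ⊤ := eq_top_iff.2 fun x _ => h x
    rw [this, Subgroup.index_top] at hM
    omega
  have hs := step_of_index hG hM hx
  obtain ⟨Φ', h1, h2⟩ := ext hs (φ := fun g => g) (fun _ _ _ _ => rfl) (y := z * x) (by
    intro m _
    rw [hab x m, hab (z * x) m]; group) (by
    have : Commute z x := hab z x
    rw [this.mul_pow, hzp, one_mul])
  let Φ : G →* G := ⟨⟨Φ', h1.one⟩, fun a b => h1 a trivial b trivial⟩
  obtain ⟨α, k, hα, hk⟩ := aut_of hG (A := M) Φ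
    (fun m hm => by show Φ' m = m; simpa using h2 m hm 0) (by
      intro g
      obtain ⟨m, hm, i, rfl⟩ := hs.gen g trivial
      have e : Φ (m * x ^ i) = m * (z * x) ^ i := h2 m hm i
      have hc : Commute z x := hab z x
      rw [e, hc.mul_pow]
      have : m * (z ^ i * x ^ i) * (m * x ^ i)⁻¹ = m * z ^ i * m⁻¹ := by group
      rw [this]
      exact M.mul_mem (M.mul_mem hm (M.pow_mem hzM i)) (M.inv_mem hm))
  refine ⟨α, ?_, k, hk⟩
  rintro ⟨a, ha⟩
  apply hz1
  have e1 := hα x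
  have e2 := h2 1 M.one_mem 1
  simp only [one_mul, pow_one] at e2
  have e3 : Φ x = z * x := e2
  rw [← ha, MulAut.conj_apply, hab a x, mul_inv_cancel_right, e3] at e1
  simpa using e1.symm
end Gas

/-- A noncyclic finite `p`-group of order at least `p ^ 2` has an outer automorphism of
`p`-power order. -/
theorem exists_outer_automorphism_p_power_order (p : ℕ) [Fact p.Prime] (G : Type*) [Group G]
    [Finite G] (hG : IsPGroup p G) (hcyc : ¬ IsCyclic G) (hcard : p ^ 2 ≤ Nat.card G) :
    ∃ φ : MulAut G, φ ∉ (MulAut.conj : G →* MulAut G).range ∧ ∃ k : ℕ, orderOf φ = p ^ k := by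
  exact Gas.final p G hG hcard
end

section
/- For each prime p and each positive integer n, there are exactly two isomorphism classes of extraspecial p-groups of order p^(2n+1). -/
universe u

/-- A finite `p`-group is extraspecial if its center, commutator subgroup and Frattini
subgroup coincide and have order `p`. -/
def IsExtraspecial (p : ℕ) (G : Type u) [Group G] : Prop :=
  IsPGroup p G ∧ Subgroup.center G = commutator G ∧ Subgroup.center G = frattini G ∧
    Nat.card (Subgroup.center G) = p


/-- kernel of two functionals -/
lemma es_two_ker {F V : Type*} [Field F] [AddCommGroup V] [Module F V] [FiniteDimensional F V]
    (h : 2 < Module.finrank F V) (a b : V →ₗ[F] F) : ∃ x : V, x ≠ 0 ∧ a x = 0 ∧ b x = 0 := by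
  have h1 : LinearMap.ker (a.prod b) ≠ ⊥ :=
    LinearMap.ker_ne_bot_of_finrank_lt (by simpa using h)
  obtain ⟨x, hx, hx0⟩ := (Submodule.ne_bot_iff _).1 h1
  refine ⟨x, hx0, ?_⟩
  simpa using hx

lemma es_z2_cases : ∀ a : ZMod 2, a = 0 ∨ a = 1 := by decide

lemma es_z2_add : (1 : ZMod 2) + 1 = 0 := by decide

/-- data -/
structure EsData (p : ℕ) [Fact p.Prime] (V : Type*) [AddCommGroup V] [Module (ZMod p) V]
    (B : V →ₗ[ZMod p] V →ₗ[ZMod p] ZMod p) (q : V → ZMod p) (c : ZMod p) : Prop where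
  alt : ∀ x, B x x = 0
  nd : ∀ x, (∀ y, B x y = 0) → x = 0
  qa : ∀ x y, q (x + y) = q x + q y + c * B x y
  hc : (p ≠ 2 ∧ c = 0) ∨ (p = 2 ∧ c = 1)

namespace EsData
variable {p : ℕ} [Fact p.Prime] {V : Type*} [AddCommGroup V] [Module (ZMod p) V]
    {B : V →ₗ[ZMod p] V →ₗ[ZMod p] ZMod p} {q : V → ZMod p} {c : ZMod p}

lemma skew (h : EsData p V B q c) (x y : V) : B x y = - B y x := by
  have := h.alt (x + y)
  simp only [map_add, LinearMap.add_apply, h.alt] at this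
  linear_combination this

lemma q_lin (h : EsData p V B q c) (hc : c = 0) : ∃ l : V →ₗ[ZMod p] ZMod p, ∀ x, q x = l x :=
  ⟨(AddMonoidHom.mk' q (by intro x y; rw [h.qa, hc]; ring)).toZModLinearMap p, fun x => rfl⟩

lemma exists_pair (h : EsData p V B q c) {x : V} (hx : x ≠ 0) : ∃ y, B x y = 1 := by
  by_contra! hh
  apply hx
  apply h.nd
  intro y
  by_contra h0
  apply hh ((B x y)⁻¹ • y)
  simp [h0]

lemma two_cases (h2 : p = 2) (a : ZMod p) : a = 0 ∨ a = 1 := by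
  subst h2
  exact es_z2_cases a

lemma two_add (h2 : p = 2) : (1 : ZMod p) + 1 = 0 := by
  subst h2
  exact es_z2_add

lemma hyp (h : EsData p V B q c) [FiniteDimensional (ZMod p) V]
    (hd : 2 < Module.finrank (ZMod p) V) : ∃ e f, B e f = 1 ∧ q e = 0 ∧ q f = 0 := by
  rcases h.hc with ⟨_, hc⟩ | ⟨h2, hc⟩
  · obtain ⟨l, hl⟩ := h.q_lin hc
    simp only [hl]
    by_cases h0 : l = 0
    · obtain ⟨x, hx, -, -⟩ := es_two_ker hd l l
      obtain ⟨y, hy⟩ := h.exists_pair hx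
      exact ⟨x, y, hy, by simp [h0], by simp [h0]⟩
    · obtain ⟨u, hu⟩ : ∃ u, l u ≠ 0 := by
        by_contra! hh
        exact h0 (LinearMap.ext hh)
      obtain ⟨x, hx, hx1, hx2⟩ := es_two_ker hd l (B u)
      obtain ⟨y, hy⟩ := h.exists_pair hx
      refine ⟨x, y - (l y / l u) • u, ?_, hx1, ?_⟩
      · rw [map_sub, map_smul, h.skew x u, hx2, hy]; simp
      · simp [hu]
  · have : Nontrivial V := Module.nontrivial_of_finrank_pos (R := ZMod p) (by omega)
    have key : ∃ x, x ≠ 0 ∧ q x = 0 := by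
      obtain ⟨u, hu⟩ := exists_ne (0 : V)
      obtain ⟨y, hy⟩ := h.exists_pair hu
      obtain ⟨w, hw, hw1, hw2⟩ := es_two_ker hd (B u) (B y)
      rcases two_cases h2 (q u) with hqu | hqu
      · exact ⟨u, hu, hqu⟩
      rcases two_cases h2 (q w) with hqw | hqw
      · exact ⟨w, hw, hqw⟩
      refine ⟨u + w, ?_, ?_⟩
      · intro h0
        have : B y (u + w) = 0 := by rw [h0]; simp
        rw [map_add, hw2, h.skew, hy] at this
        simp at this
      · rw [h.qa, hqu, hqw, hw1, two_add h2]; simp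
    obtain ⟨x, hx, hqx⟩ := key
    obtain ⟨y, hy⟩ := h.exists_pair hx
    rcases two_cases h2 (q y) with hqy | hqy
    · exact ⟨x, y, hy, hqx, hqy⟩
    · refine ⟨x, x + y, ?_, hqx, ?_⟩
      · rw [map_add, h.alt, hy]; simp
      · rw [h.qa, hqx, hqy, hy, hc, mul_one, zero_add, two_add h2]

lemma base (h : EsData p V B q c) [Nontrivial V] :
    ∃ e f, B e f = 1 ∧ ((q e = 0 ∧ q f = 0) ∨ (q e = 1 ∧ q f = 1)) := by
  obtain ⟨e, he⟩ := exists_ne (0 : V)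
  obtain ⟨f, hf⟩ := h.exists_pair he
  have hfe : B f e = -1 := by rw [h.skew, hf]
  rcases h.hc with ⟨_, hc⟩ | ⟨h2, hc⟩
  · obtain ⟨l, hl⟩ := h.q_lin hc
    simp only [hl]
    by_cases ha : l e = 0
    · by_cases hb : l f = 0
      · exact ⟨e, f, hf, Or.inl ⟨ha, hb⟩⟩
      · refine ⟨l f • e + (l f)⁻¹ • f, (l f)⁻¹ • f, ?_, Or.inr ⟨?_, ?_⟩⟩
        · simp [hf, hb, h.alt]
        · simp [ha, hb]
        · simp [hb]
    · refine ⟨l f • e - l e • f + (l e)⁻¹ • e, (l e)⁻¹ • e, ?_, Or.inr ⟨?_, ?_⟩⟩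
      · simp [hfe, ha, h.alt]
      · simp only [map_add, map_sub, map_smul, smul_eq_mul]; field_simp; ring
      · simp [ha]
  · rcases two_cases h2 (q e) with hqe | hqe <;> rcases two_cases h2 (q f) with hqf | hqf
    · exact ⟨e, f, hf, Or.inl ⟨hqe, hqf⟩⟩
    · refine ⟨e, e + f, ?_, Or.inl ⟨hqe, ?_⟩⟩
      · rw [map_add, h.alt, hf]; simp
      · rw [h.qa, hqe, hqf, hf, hc, mul_one, zero_add, two_add h2]
    · refine ⟨e + f, f, ?_, Or.inl ⟨?_, hqf⟩⟩
      · rw [map_add, LinearMap.add_apply, h.alt, hf]; simp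
      · rw [h.qa, hqe, hqf, hf, hc, mul_one, add_zero, two_add h2]
    · exact ⟨e, f, hf, Or.inr ⟨hqe, hqf⟩⟩

end EsData

/-- symplectic family -/
structure EsFam {p : ℕ} [Fact p.Prime] {V : Type*} [AddCommGroup V] [Module (ZMod p) V]
    (B : V →ₗ[ZMod p] V →ₗ[ZMod p] ZMod p) (q : V → ZMod p) (n : ℕ) (ε : ZMod p)
    (e f : Fin n → V) : Prop where
  ee : ∀ i j, B (e i) (e j) = 0
  ff : ∀ i j, B (f i) (f j) = 0
  ef : ∀ i j, B (e i) (f j) = if i = j then 1 else 0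
  qe : ∀ i, q (e i) = if i.val + 1 = n then ε else 0
  qf : ∀ i, q (f i) = if i.val + 1 = n then ε else 0

lemma EsData.exists_fam {p : ℕ} [Fact p.Prime] {c : ZMod p} (n : ℕ) :
    ∀ {V : Type u} [AddCommGroup V] [Module (ZMod p) V] [FiniteDimensional (ZMod p) V]
    {B : V →ₗ[ZMod p] V →ₗ[ZMod p] ZMod p} {q : V → ZMod p},
    EsData p V B q c → Module.finrank (ZMod p) V = 2 * (n + 1) →
    ∃ ε : ZMod p, (ε = 0 ∨ ε = 1) ∧ ∃ e f, EsFam B q (n + 1) ε e f := by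
  induction n with
  | zero =>
    intro V _ _ _ B q h hd
    have : Nontrivial V := Module.nontrivial_of_finrank_pos (R := ZMod p) (by omega)
    obtain ⟨e, f, hef, hq⟩ := h.base
    rcases hq with ⟨h1, h2⟩ | ⟨h1, h2⟩
    · exact ⟨0, Or.inl rfl, fun _ => e, fun _ => f, fun _ _ => h.alt _, fun _ _ => h.alt _,
        fun i j => by rw [if_pos (Fin.ext (by omega)), hef], fun i => by simpa using h1,
        fun i => by simpa using h2⟩
    · exact ⟨1, Or.inr rfl, fun _ => e, fun _ => f, fun _ _ => h.alt _, fun _ _ => h.alt _,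
        fun i j => by rw [if_pos (Fin.ext (by omega)), hef], fun i => by simpa using h1,
        fun i => by simpa using h2⟩
  | succ n ih =>
    intro V _ _ _ B q h hd
    obtain ⟨e, f, hef, hqe, hqf⟩ := h.hyp (by omega)
    have hfe : B f e = -1 := by rw [h.skew, hef]
    let L : V →ₗ[ZMod p] ZMod p × ZMod p := (B e).prod (B f)
    have hLs : Function.Surjective L := by
      rintro ⟨a, b⟩
      refine ⟨a • f - b • e, ?_⟩
      simp [L, hef, hfe, h.alt]
    have hW : Module.finrank (ZMod p) (LinearMap.ker L) = 2 * (n + 1) := by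
      have := L.finrank_range_add_finrank_ker
      rw [LinearMap.range_eq_top.2 hLs, finrank_top, hd] at this
      simp at this
      omega
    have hWm : ∀ x : LinearMap.ker L, B e x = 0 ∧ B f x = 0 := by
      rintro ⟨x, hx⟩
      simpa [L] using hx
    have hD : EsData p (LinearMap.ker L)
        (B.compl₁₂ (LinearMap.ker L).subtype (LinearMap.ker L).subtype) (fun x => q x) c := by
      refine ⟨fun x => h.alt _, ?_, fun x y => h.qa _ _, h.hc⟩
      rintro x hx
      apply Subtype.ext
      apply h.nd
      intro v
      have hv : v - (B e v) • f + (B f v) • e ∈ LinearMap.ker L := by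
        simp [L, hef, hfe, h.alt]
      have := hx ⟨_, hv⟩
      simp only [LinearMap.compl₁₂_apply, Submodule.subtype_apply, map_add, map_sub, map_smul] at this
      rw [h.skew x e, h.skew x f, (hWm x).1, (hWm x).2] at this
      simpa using this
    obtain ⟨ε, hε, e', f', hF⟩ := ih hD hW
    have he0 : ∀ x : LinearMap.ker L, B x e = 0 := fun x => by rw [h.skew, (hWm x).1, neg_zero]
    have hf0 : ∀ x : LinearMap.ker L, B x f = 0 := fun x => by rw [h.skew, (hWm x).2, neg_zero]
    refine ⟨ε, hε, Fin.cons e (fun i => (e' i : V)), Fin.cons f (fun i => (f' i : V)),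
      ?_, ?_, ?_, ?_, ?_⟩
    · intro i j
      cases i using Fin.cases <;> cases j using Fin.cases <;>
        simp only [Fin.cons_zero, Fin.cons_succ, h.alt, (hWm _).1, he0]
      exact hF.ee _ _
    · intro i j
      cases i using Fin.cases <;> cases j using Fin.cases <;>
        simp only [Fin.cons_zero, Fin.cons_succ, h.alt, (hWm _).2, hf0]
      exact hF.ff _ _
    · intro i j
      cases i using Fin.cases <;> cases j using Fin.cases <;>
        simp only [Fin.cons_zero, Fin.cons_succ, hef, (hWm _).1, hf0, if_true, Fin.succ_ne_zero,
          (Fin.succ_ne_zero _).symm, if_false, Fin.succ_inj]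
      exact hF.ef _ _
    · intro i
      cases i using Fin.cases
      · simp [hqe]
      · simpa using hF.qe _
    · intro i
      cases i using Fin.cases
      · simp [hqf]
      · simpa using hF.qf _

lemma EsFam.span {p : ℕ} [Fact p.Prime] {V : Type*} [AddCommGroup V] [Module (ZMod p) V]
    [FiniteDimensional (ZMod p) V]
    {B : V →ₗ[ZMod p] V →ₗ[ZMod p] ZMod p} {q : V → ZMod p} {n : ℕ} {ε : ZMod p}
    {e f : Fin n → V} (h : EsFam B q n ε e f)
    (hd : Module.finrank (ZMod p) V = 2 * n) :
    Submodule.span (ZMod p) (Set.range (Sum.elim e f)) = ⊤ := by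
  apply LinearIndependent.span_eq_top_of_card_eq_finrank'
  · rw [Fintype.linearIndependent_iff]
    intro g hg
    rw [Fintype.sum_sum_type] at hg
    simp only [Sum.elim_inl, Sum.elim_inr] at hg
    rintro (j | j)
    · have := congrArg (fun v => B v (f j)) hg
      simpa [h.ef, h.ff] using this
    · have := congrArg (fun v => B (e j) v) hg
      simpa [h.ef, h.ee] using this
  · simp [hd]; omega
open scoped commutatorElement

lemma es_card_mod {V : Type*} [AddCommGroup V] {p : ℕ} [Fact p.Prime] [Module (ZMod p) V]
    [Finite V] {ι : Type*} [Fintype ι] (s : ι → V)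
    (hs : AddSubgroup.closure (Set.range s) = ⊤) :
    Nat.card V ≤ p ^ Fintype.card ι := by
  have hspan : Submodule.span (ZMod p) (Set.range s) = ⊤ := by
    rw [eq_top_iff]
    intro x _
    have : AddSubgroup.closure (Set.range s) ≤
        (Submodule.span (ZMod p) (Set.range s)).toAddSubgroup := by
      rw [AddSubgroup.closure_le]
      exact Submodule.subset_span
    exact this (by rw [hs]; trivial)
  have hf : Module.finrank (ZMod p) V ≤ Fintype.card ι := by
    have := finrank_range_le_card (R := ZMod p) s
    rw [Set.finrank, hspan, finrank_top] at this
    exact this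
  rw [Module.natCard_eq_pow_finrank (K := ZMod p), Nat.card_zmod]
  exact Nat.pow_le_pow_right (Fact.out : p.Prime).pos hf

lemma es_card_elem {A : Type*} [CommGroup A] [Finite A] {p : ℕ} [Fact p.Prime] {ι : Type*}
    [Fintype ι] (s : ι → A) (hs : Subgroup.closure (Set.range s) = ⊤) (hp : ∀ i, s i ^ p = 1) :
    Nat.card A ≤ p ^ Fintype.card ι := by
  have hx : ∀ x : A, x ^ p = 1 := by
    have : (⊤ : Subgroup A) ≤ (powMonoidHom p : A →* A).ker := by
      rw [← hs, Subgroup.closure_le]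
      rintro _ ⟨i, rfl⟩
      exact hp i
    exact fun x => this (Subgroup.mem_top x)
  let _ : Module (ZMod p) (Additive A) := AddCommGroup.zmodModule (fun x => hx x.toMul)
  have := es_card_mod (p := p) (V := Additive A) (fun i => Additive.ofMul (s i)) ?_
  · exact this
  · rw [eq_top_iff]
    intro x _
    have : ∀ y : A, y ∈ Subgroup.closure (Set.range s) →
      Additive.ofMul y ∈ AddSubgroup.closure (Set.range (fun i => Additive.ofMul (s i))) := by
      intro y hy
      induction hy using Subgroup.closure_induction with
      | mem y hy => obtain ⟨i, rfl⟩ := hy; exact AddSubgroup.subset_closure ⟨i, rfl⟩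
      | one => exact AddSubgroup.zero_mem _
      | mul a b _ _ ha hb => exact AddSubgroup.add_mem _ ha hb
      | inv a _ ha => exact AddSubgroup.neg_mem _ ha
    exact this x.toMul (by rw [hs]; trivial)

/-- generators and relations -/
structure EsSys (p : ℕ) {ι : Type*} (c : ι → ι → ℕ) (d : ι → ℕ) {G : Type*} [Group G]
    (s : ι → G) (z : G) : Prop where
  zc : ∀ g, z * g = g * z
  zp : z ^ p = 1
  sc : ∀ i j, ⁅s i, s j⁆ = z ^ c i j
  sp : ∀ i, s i ^ p = z ^ d i

lemma EsSys.card_le {p : ℕ} [Fact p.Prime] {ι : Type*} [Fintype ι] {c : ι → ι → ℕ} {d : ι → ℕ}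
    {G : Type*} [Group G] [Finite G] {s : ι → G} {z : G} (h : EsSys p c d s z)
    (hs : Subgroup.closure (insert z (Set.range s)) = ⊤) :
    Nat.card G ≤ p ^ (Fintype.card ι + 1) := by
  let N := Subgroup.zpowers z
  have hzN : z ∈ N := Subgroup.mem_zpowers z
  have hNc : N ≤ Subgroup.center G := by
    rw [Subgroup.zpowers_le, Subgroup.mem_center_iff]
    exact fun g => (h.zc g).symm
  have hN : N.Normal := ⟨fun x hx g => by
    rw [Subgroup.mem_center_iff.1 (hNc hx) g, mul_inv_cancel_right]; exact hx⟩
  let t : ι → G ⧸ N := fun i => QuotientGroup.mk (s i)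
  have ht : Subgroup.closure (Set.range t) = ⊤ := by
    rw [eq_top_iff, ← (Subgroup.map_top_of_surjective (QuotientGroup.mk' N)
      (QuotientGroup.mk'_surjective N)), ← hs, MonoidHom.map_closure, Subgroup.closure_le]
    rintro _ ⟨x, hx, rfl⟩
    rcases hx with rfl | ⟨i, rfl⟩
    · rw [QuotientGroup.mk'_apply, (QuotientGroup.eq_one_iff x).2 hzN]
      exact Subgroup.one_mem _
    · exact Subgroup.subset_closure ⟨i, rfl⟩
  have hcomm : ∀ i j, t i * t j = t j * t i := by
    intro i j
    rw [← commutatorElement_eq_one_iff_mul_comm]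
    have : ⁅t i, t j⁆ = ((⁅s i, s j⁆ : G) : G ⧸ N) := rfl
    rw [this, h.sc, QuotientGroup.eq_one_iff]
    exact N.pow_mem hzN _
  have hab : ∀ x y : G ⧸ N, x * y = y * x := by
    have h1 : ∀ i, ∀ y, t i * y = y * t i := by
      intro i
      have : (⊤ : Subgroup (G ⧸ N)) ≤ Subgroup.centralizer {t i} := by
        rw [← ht, Subgroup.closure_le]
        rintro _ ⟨j, rfl⟩
        rw [SetLike.mem_coe, Subgroup.mem_centralizer_singleton_iff]
        exact hcomm _ _
      intro y
      exact (Subgroup.mem_centralizer_singleton_iff.1 (this (Subgroup.mem_top y))).symm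
    have : (⊤ : Subgroup (G ⧸ N)) ≤ Subgroup.center _ := by
      rw [← ht, Subgroup.closure_le]
      rintro _ ⟨j, rfl⟩
      rw [SetLike.mem_coe, Subgroup.mem_center_iff]
      exact fun g => (h1 j g).symm
    intro x y
    exact (Subgroup.mem_center_iff.1 (this (Subgroup.mem_top x)) y).symm
  let : CommGroup (G ⧸ N) := { (inferInstance : Group (G ⧸ N)) with mul_comm := hab }
  have h1 : Nat.card (G ⧸ N) ≤ p ^ Fintype.card ι := by
    refine es_card_elem (p := p) t ht ?_
    intro i
    have : t i ^ p = ((s i ^ p : G) : G ⧸ N) := rfl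
    rw [this, h.sp, QuotientGroup.eq_one_iff]
    exact N.pow_mem hzN _
  have h2 : Nat.card N ≤ p := by
    rw [Nat.card_zpowers]
    exact Nat.le_of_dvd (Fact.out : p.Prime).pos (orderOf_dvd_of_pow_eq_one h.zp)
  rw [Subgroup.card_eq_card_quotient_mul_card_subgroup N, pow_succ]
  exact Nat.mul_le_mul h1 h2

lemma EsSys.fst_bij {p : ℕ} [Fact p.Prime] {ι : Type*} [Fintype ι] {c : ι → ι → ℕ} {d : ι → ℕ}
    {G K : Type*} [Group G] [Group K] [Finite G] [Finite K]
    {s : ι → G} {z : G} {r : ι → K} {y : K} (hK : EsSys p c d r y)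
    (hr : Subgroup.closure (insert y (Set.range r)) = ⊤)
    (hs : Subgroup.closure (insert z (Set.range s)) = ⊤)
    (hG : Nat.card G = p ^ (Fintype.card ι + 1))
    (φ : K →* G) (hφ : ∀ i, φ (r i) = s i) (hz : φ y = z) : Nonempty (K ≃* G) := by
  have hsurj : Function.Surjective φ := by
    rw [← MonoidHom.range_eq_top, eq_top_iff, ← hs, Subgroup.closure_le]
    rintro x (rfl | ⟨i, rfl⟩)
    · exact ⟨y, hz⟩
    · exact ⟨r i, hφ i⟩
  have hc : Nat.card K ≤ Nat.card G := by rw [hG]; exact hK.card_le hr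
  have hb : Function.Bijective φ :=
    hsurj.bijective_of_nat_card_le hc
  exact ⟨MulEquiv.ofBijective φ hb⟩

lemma EsSys.iso {p : ℕ} [Fact p.Prime] {ι : Type*} [Fintype ι] {c : ι → ι → ℕ} {d : ι → ℕ}
    {G H : Type*} [Group G] [Group H] [Finite G] [Finite H]
    {s : ι → G} {z : G} {t : ι → H} {w : H} (h : EsSys p c d s z) (h' : EsSys p c d t w)
    (hs : Subgroup.closure (insert z (Set.range s)) = ⊤)
    (ht : Subgroup.closure (insert w (Set.range t)) = ⊤)
    (hG : Nat.card G = p ^ (Fintype.card ι + 1)) (hH : Nat.card H = p ^ (Fintype.card ι + 1)) :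
    Nonempty (G ≃* H) := by
  let S : Set (G × H) := insert (z, w) (Set.range fun i => (s i, t i))
  let K := Subgroup.closure S
  let y : K := ⟨(z, w), Subgroup.subset_closure (Set.mem_insert _ _)⟩
  let r : ι → K := fun i => ⟨(s i, t i), Subgroup.subset_closure (Set.mem_insert_of_mem _ ⟨i, rfl⟩)⟩
  have hK : EsSys p c d r y := by
    refine ⟨?_, ?_, ?_, ?_⟩
    · rintro ⟨⟨a, b⟩, hab⟩
      exact Subtype.ext (Prod.ext (h.zc a) (h'.zc b))
    · exact Subtype.ext (Prod.ext h.zp h'.zp)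
    · exact fun i j => Subtype.ext (Prod.ext (h.sc i j) (h'.sc i j))
    · exact fun i => Subtype.ext (Prod.ext (h.sp i) (h'.sp i))
  have hr : Subgroup.closure (insert y (Set.range r)) = ⊤ := by
    have := Subgroup.closure_closure_coe_preimage (k := S)
    convert this using 2
    ext ⟨x, hx⟩
    simp only [Set.mem_insert_iff, Set.mem_range, Set.mem_preimage, S, y, r, Subtype.mk.injEq]
  obtain ⟨e1⟩ := EsSys.fst_bij hK hr hs hG ((MonoidHom.fst G H).comp K.subtype)
    (fun _ => rfl) rfl
  obtain ⟨e2⟩ := EsSys.fst_bij hK hr ht hH ((MonoidHom.snd G H).comp K.subtype)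
    (fun _ => rfl) rfl
  exact ⟨e1.symm.trans e2⟩

lemma es_comm_mul_left {H : Type*} [Group H] (hZ : ∀ g h : H, ⁅g, h⁆ ∈ Subgroup.center H)
    (a b c : H) : ⁅a * b, c⁆ = ⁅a, c⁆ * ⁅b, c⁆ := by
  have h1 : ⁅a * b, c⁆ = a * ⁅b, c⁆ * a⁻¹ * ⁅a, c⁆ := by simp [commutatorElement_def]; group
  rw [h1, Subgroup.mem_center_iff.1 (hZ b c) a, mul_inv_cancel_right,
    Subgroup.mem_center_iff.1 (hZ b c)]

lemma es_comm_mul_right {H : Type*} [Group H] (hZ : ∀ g h : H, ⁅g, h⁆ ∈ Subgroup.center H)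
    (a b c : H) : ⁅a, b * c⁆ = ⁅a, b⁆ * ⁅a, c⁆ := by
  have h1 : ⁅a, b * c⁆ = ⁅a, b⁆ * (b * ⁅a, c⁆ * b⁻¹) := by simp [commutatorElement_def]; group
  rw [h1, Subgroup.mem_center_iff.1 (hZ a c) b, mul_inv_cancel_right]

lemma es_comm_pow_left {H : Type*} [Group H] (hZ : ∀ g h : H, ⁅g, h⁆ ∈ Subgroup.center H)
    (a c : H) (m : ℕ) : ⁅a ^ m, c⁆ = ⁅a, c⁆ ^ m := by
  induction m with
  | zero => simp
  | succ m ih => rw [pow_succ, es_comm_mul_left hZ, ih, pow_succ]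

lemma es_comm_central_left {H : Type*} [Group H] {k : H} (hk : k ∈ Subgroup.center H) (c : H) :
    ⁅k, c⁆ = 1 :=
  commutatorElement_eq_one_iff_mul_comm.2 (Subgroup.mem_center_iff.1 hk c).symm

lemma es_comm_central_right {H : Type*} [Group H] {k : H} (hk : k ∈ Subgroup.center H) (c : H) :
    ⁅c, k⁆ = 1 :=
  commutatorElement_eq_one_iff_mul_comm.2 (Subgroup.mem_center_iff.1 hk c)

lemma es_mul_pow {H : Type*} [Group H] (hZ : ∀ g h : H, ⁅g, h⁆ ∈ Subgroup.center H)
    (g h : H) (m : ℕ) : (g * h) ^ m = g ^ m * h ^ m * ⁅h, g⁆ ^ (m.choose 2) := by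
  induction m with
  | zero => simp
  | succ m ih =>
    have hc : ∀ x, x * ⁅h, g⁆ ^ (m.choose 2) = ⁅h, g⁆ ^ (m.choose 2) * x :=
      Subgroup.mem_center_iff.1 (Subgroup.pow_mem _ (hZ h g) _)
    have hd : ∀ x, x * ⁅h, g⁆ ^ m = ⁅h, g⁆ ^ m * x :=
      Subgroup.mem_center_iff.1 (Subgroup.pow_mem _ (hZ h g) _)
    have h1 : h ^ m * g = g * h ^ m * ⁅h, g⁆ ^ m := by
      rw [hd, ← es_comm_pow_left hZ]
      simp [commutatorElement_def]
    rw [pow_succ, ih, mul_assoc, ← hc, Nat.choose_succ_succ' m 1, Nat.choose_one_right]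
    calc g ^ m * h ^ m * (g * h * ⁅h, g⁆ ^ (m.choose 2))
        = g ^ m * (h ^ m * g) * h * ⁅h, g⁆ ^ (m.choose 2) := by group
      _ = g ^ m * (g * h ^ m) * (⁅h, g⁆ ^ m * h) * ⁅h, g⁆ ^ (m.choose 2) := by
        rw [h1]; simp only [mul_assoc]
      _ = _ := by rw [← hd, pow_succ g, pow_succ h, pow_add]; simp only [mul_assoc]

lemma es_exists_log {H : Type*} [Group H] {p : ℕ} [Fact p.Prime]
    (hp : Nat.card (Subgroup.center H) = p) :
    ∃ z ∈ Subgroup.center H, z ^ p = 1 ∧ ∃ l : H → ZMod p,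
      (∀ x ∈ Subgroup.center H, ∀ y ∈ Subgroup.center H, l (x * y) = l x + l y) ∧
      (∀ x ∈ Subgroup.center H, x = z ^ (l x).val) := by
  classical
  let L : Subgroup.center H ≃* Multiplicative (ZMod p) :=
    mulEquivOfPrimeCardEq (p := p) hp (by simp)
  refine ⟨(L.symm (Multiplicative.ofAdd 1)).1, (L.symm (Multiplicative.ofAdd 1)).2, ?_,
    fun x => if h : x ∈ Subgroup.center H then (L ⟨x, h⟩).toAdd else 0, ?_, ?_⟩
  · rw [← Subgroup.coe_pow, ← map_pow, ← ofAdd_nsmul]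
    simp
  · intro x hx y hy
    have h3 : L ⟨x * y, mul_mem hx hy⟩ = L ⟨x, hx⟩ * L ⟨y, hy⟩ := by
      rw [← map_mul]; rfl
    simp only [hx, hy, mul_mem hx hy, dif_pos, h3, toAdd_mul]
  · intro x hx
    simp only [hx, dif_pos]
    rw [← Subgroup.coe_pow, ← map_pow, ← ofAdd_nsmul]
    simp

/-- structure constants -/
def esC (p n : ℕ) : Fin n ⊕ Fin n → Fin n ⊕ Fin n → ℕ
  | Sum.inl i, Sum.inr j => (if i = j then (1 : ZMod p) else 0).val
  | Sum.inr i, Sum.inl j => (-(if j = i then (1 : ZMod p) else 0)).val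
  | _, _ => (0 : ZMod p).val

/-- power constants -/
def esD (p n : ℕ) (ε : ZMod p) : Fin n ⊕ Fin n → ℕ
  | Sum.inl i => (if i.val + 1 = n then ε else 0).val
  | Sum.inr i => (if i.val + 1 = n then ε else 0).val

/-- `G` has a generating system of type ε -/
def EsType (p n : ℕ) (ε : ZMod p) (G : Type*) [Group G] : Prop :=
  ∃ (s : Fin n ⊕ Fin n → G) (z : G), EsSys p (esC p n) (esD p n ε) s z ∧
    Subgroup.closure (insert z (Set.range s)) = ⊤

lemma es_extract_aux {p : ℕ} [Fact p.Prime] {n : ℕ} (hn : 0 < n) {H : Type*} [Group H]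
    {V : Type*} [AddCommGroup V] [Module (ZMod p) V] [Finite V]
    (hZ : ∀ g h : H, ⁅g, h⁆ ∈ Subgroup.center H)
    (hp : Nat.card (Subgroup.center H) = p)
    (π : H → V) (hπm : ∀ g h, π (g * h) = π g + π h) (hπs : Function.Surjective π)
    (hπk : ∀ g, π g = 0 ↔ g ∈ Subgroup.center H) (hV : Nat.card V = p ^ (2 * n)) :
    ∃ ε : ZMod p, (ε = 0 ∨ ε = 1) ∧ EsType p n ε H := by
  obtain ⟨z, hzc, hzp, l, hl, hlz⟩ := es_exists_log hp
  have hl0 : ∀ x ∈ Subgroup.center H, l x = 0 → x = 1 := by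
    intro x hx h0
    rw [hlz x hx, h0]; simp
  have hl1 : l 1 = 0 := by
    have := hl 1 (one_mem _) 1 (one_mem _)
    rw [mul_one] at this
    linear_combination -this
  have hlpow : ∀ x ∈ Subgroup.center H, ∀ m : ℕ, l (x ^ m) = m * l x := by
    intro x hx m
    induction m with
    | zero => simp [hl1]
    | succ m ih => rw [pow_succ, hl _ (pow_mem hx m) _ hx, ih]; push_cast; ring
  have hkp : ∀ x ∈ Subgroup.center H, x ^ p = 1 := by
    intro x hx
    rw [hlz x hx, ← pow_mul, mul_comm, pow_mul, hzp, one_pow]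
  have hgp : ∀ g : H, g ^ p ∈ Subgroup.center H := by
    intro g
    rw [Subgroup.mem_center_iff]
    intro h
    have := es_comm_pow_left hZ g h p
    rw [hkp _ (hZ g h)] at this
    exact (commutatorElement_eq_one_iff_mul_comm.1 this).symm
  have hπ1 : π 1 = 0 := (hπk 1).2 (one_mem _)
  have hπeq : ∀ g g', π g = π g' → ∃ k ∈ Subgroup.center H, g' = g * k := by
    intro g g' h
    refine ⟨g⁻¹ * g', ?_, by group⟩
    rw [← hπk, hπm, ← h, ← hπm, inv_mul_cancel, hπ1]
  let σ : V → H := Function.surjInv hπs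
  have hσ : ∀ v, π (σ v) = v := Function.surjInv_eq hπs
  have hcl : ∀ g g' h : H, π g = π g' → ⁅g, h⁆ = ⁅g', h⁆ := by
    intro g g' h e
    obtain ⟨k, hk, rfl⟩ := hπeq g g' e
    rw [es_comm_mul_left hZ, es_comm_central_left hk, mul_one]
  have hcr : ∀ g g' h : H, π g = π g' → ⁅h, g⁆ = ⁅h, g'⁆ := by
    intro g g' h e
    obtain ⟨k, hk, rfl⟩ := hπeq g g' e
    rw [es_comm_mul_right hZ, es_comm_central_right hk, mul_one]
  have hpw : ∀ g g', π g = π g' → g ^ p = g' ^ p := by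
    intro g g' e
    obtain ⟨k, hk, rfl⟩ := hπeq g g' e
    rw [Commute.mul_pow (Subgroup.mem_center_iff.1 hk g), hkp k hk, mul_one]
  let B0 : V →+ V →+ ZMod p := AddMonoidHom.mk' (fun x => AddMonoidHom.mk'
      (fun y => l ⁅σ x, σ y⁆) (by
        intro a b
        rw [← hl _ (hZ _ _) _ (hZ _ _), ← es_comm_mul_right hZ]
        congr 1
        apply hcr
        rw [hπm, hσ, hσ, hσ])) (by
      intro a b
      ext y
      change l _ = l _ + l _
      rw [← hl _ (hZ _ _) _ (hZ _ _), ← es_comm_mul_left hZ]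
      congr 1
      apply hcl
      rw [hπm, hσ, hσ, hσ])
  let B1 : V →+ (V →ₗ[ZMod p] ZMod p) :=
    (AddMonoidHom.toZModLinearMapEquiv p).toAddMonoidHom.comp B0
  let B : V →ₗ[ZMod p] V →ₗ[ZMod p] ZMod p := B1.toZModLinearMap p
  have hB : ∀ x y, B x y = l ⁅σ x, σ y⁆ := fun _ _ => rfl
  let q : V → ZMod p := fun x => l (σ x ^ p)
  have hD : EsData p V B q (-(p.choose 2 : ZMod p)) := by
    refine ⟨?_, ?_, ?_, ?_⟩
    · intro x
      rw [hB, commutatorElement_self, hl1]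
    · intro x hx
      rw [← hσ x, hπk, Subgroup.mem_center_iff]
      intro h
      have h1 := hx (π h)
      rw [hB] at h1
      have h2 := hl0 _ (hZ _ _) h1
      rw [hcr _ h _ (hσ _)] at h2
      exact (commutatorElement_eq_one_iff_mul_comm.1 h2).symm
    · intro x y
      have h1 : σ (x + y) ^ p = (σ x * σ y) ^ p := hpw _ _ (by rw [hπm, hσ, hσ, hσ])
      have h2 : l ⁅σ y, σ x⁆ = - l ⁅σ x, σ y⁆ := by
        have h3 := hl _ (hZ (σ x) (σ y)) _ (hZ (σ y) (σ x))
        rw [← commutatorElement_inv (σ x) (σ y), mul_inv_cancel, hl1,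
          commutatorElement_inv] at h3
        linear_combination -h3
      change l _ = l _ + l _ + _
      rw [h1, es_mul_pow hZ, hl _ (mul_mem (hgp _) (hgp _)) _ (pow_mem (hZ _ _) _),
        hl _ (hgp _) _ (hgp _), hlpow _ (hZ _ _), h2, hB]
      ring
    · by_cases h2 : p = 2
      · right
        refine ⟨h2, ?_⟩
        subst h2
        simp
      · left
        refine ⟨h2, ?_⟩
        rw [neg_eq_zero, ZMod.natCast_eq_zero_iff]
        have h3 : 2 < p := lt_of_le_of_ne (Fact.out : p.Prime).two_le (Ne.symm h2)
        exact (Fact.out : p.Prime).dvd_choose_self (by norm_num) h3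
  have hfin : Module.finrank (ZMod p) V = 2 * n := by
    have := Module.natCard_eq_pow_finrank (K := ZMod p) (V := V)
    rw [hV, Nat.card_zmod] at this
    exact (Nat.pow_right_injective (Fact.out : p.Prime).two_le this).symm
  obtain ⟨m, rfl⟩ : ∃ m, n = m + 1 := ⟨n - 1, by omega⟩
  obtain ⟨ε, hε, e, f, hF⟩ := hD.exists_fam m hfin
  have hspan := hF.span hfin
  refine ⟨ε, hε, fun i => σ (Sum.elim e f i), z, ⟨?_, hzp, ?_, ?_⟩, ?_⟩
  · exact fun g => (Subgroup.mem_center_iff.1 hzc g).symm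
  · intro i j
    rw [hlz _ (hZ _ _), ← hB]
    rcases i with i | i <;> rcases j with j | j <;> simp only [Sum.elim_inl, Sum.elim_inr, esC]
    · rw [hF.ee]
    · rw [hF.ef]
    · rw [hD.skew, hF.ef]
    · rw [hF.ff]
  · intro i
    rw [hlz _ (hgp _)]
    change z ^ (q _).val = _
    rcases i with i | i <;> simp only [Sum.elim_inl, Sum.elim_inr, esD]
    · rw [hF.qe]
    · rw [hF.qf]
  · set K := Subgroup.closure (insert z (Set.range fun i => σ (Sum.elim e f i))) with hK
    have hzK : z ∈ K := Subgroup.subset_closure (Set.mem_insert _ _)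
    have hcK : ∀ x ∈ Subgroup.center H, x ∈ K := by
      intro x hx
      rw [hlz x hx]
      exact pow_mem hzK _
    let S : AddSubgroup V :=
      { carrier := {v | ∃ k ∈ K, π k = v}
        zero_mem' := ⟨1, one_mem _, hπ1⟩
        add_mem' := by
          rintro _ _ ⟨a, ha, rfl⟩ ⟨b, hb, rfl⟩
          exact ⟨a * b, mul_mem ha hb, hπm _ _⟩
        neg_mem' := by
          rintro _ ⟨a, ha, rfl⟩
          refine ⟨a⁻¹, inv_mem ha, ?_⟩
          rw [eq_neg_iff_add_eq_zero, ← hπm, inv_mul_cancel, hπ1] }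
    have hS : Submodule.span (ZMod p) (Set.range (Sum.elim e f)) ≤ AddSubgroup.toZModSubmodule p S := by
      rw [Submodule.span_le]
      rintro _ ⟨i, rfl⟩
      exact ⟨σ (Sum.elim e f i), Subgroup.subset_closure (Set.mem_insert_of_mem _ ⟨i, rfl⟩), hσ _⟩
    rw [eq_top_iff]
    intro g _
    have : π g ∈ Submodule.span (ZMod p) (Set.range (Sum.elim e f)) := by rw [hspan]; trivial
    obtain ⟨k, hk, hkg⟩ := hS this
    obtain ⟨c, hc, rfl⟩ := hπeq k g hkg
    exact mul_mem hk (hcK c hc)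

lemma es_extract {p : ℕ} [Fact p.Prime] {n : ℕ} (hn : 0 < n) {H : Type*} [Group H] [Finite H]
    (hZ : ∀ g h : H, ⁅g, h⁆ ∈ Subgroup.center H)
    (hp : Nat.card (Subgroup.center H) = p) (hH : Nat.card H = p ^ (2 * n + 1)) :
    ∃ ε : ZMod p, (ε = 0 ∨ ε = 1) ∧ EsType p n ε H := by
  let _ : CommGroup (H ⧸ Subgroup.center H) :=
    { (inferInstance : Group (H ⧸ Subgroup.center H)) with
      mul_comm := by
        intro x y
        induction x using QuotientGroup.induction_on with | _ g
        induction y using QuotientGroup.induction_on with | _ h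
        rw [← commutatorElement_eq_one_iff_mul_comm]
        exact (QuotientGroup.eq_one_iff _).2 (hZ g h) }
  have hx : ∀ x : H ⧸ Subgroup.center H, x ^ p = 1 := by
    intro x
    induction x using QuotientGroup.induction_on with | _ g
    refine (QuotientGroup.eq_one_iff (g ^ p)).2 ?_
    rw [Subgroup.mem_center_iff]
    intro h
    have := es_comm_pow_left hZ g h p
    have h1 : (⟨_, hZ g h⟩ : Subgroup.center H) ^ p = 1 := by
      rw [← hp]; exact pow_card_eq_one'
    have h2 : ⁅g, h⁆ ^ p = 1 := congrArg Subtype.val h1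
    rw [h2] at this
    exact (commutatorElement_eq_one_iff_mul_comm.1 this).symm
  let _ : Module (ZMod p) (Additive (H ⧸ Subgroup.center H)) :=
    AddCommGroup.zmodModule (fun x => hx x.toMul)
  refine es_extract_aux (V := Additive (H ⧸ Subgroup.center H)) hn hZ hp
    (fun g => Additive.ofMul (QuotientGroup.mk g)) (fun _ _ => rfl) ?_ ?_ ?_
  · intro v
    obtain ⟨g, hg⟩ := QuotientGroup.mk_surjective (s := Subgroup.center H) v.toMul
    exact ⟨g, hg⟩
  · intro g
    exact QuotientGroup.eq_one_iff g
  · have := Subgroup.card_eq_card_quotient_mul_card_subgroup (Subgroup.center H)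
    rw [hH, hp, pow_succ] at this
    exact (Nat.eq_of_mul_eq_mul_right (Fact.out : p.Prime).pos this).symm

/-- carry -/
def esCarry {p : ℕ} (x y : ZMod p) : ZMod p := ((x.val + y.val) / p : ℕ)

lemma esCarry_assoc {p : ℕ} [Fact p.Prime] (x y w : ZMod p) :
    esCarry x y + esCarry (x + y) w = esCarry y w + esCarry x (y + w) := by
  have hp : 0 < p := (Fact.out : p.Prime).pos
  have key : ∀ a b c : ℕ, (a + b) / p + ((a + b) % p + c) / p = (a + b + c) / p := by
    intro a b c
    conv_rhs => rw [← Nat.div_add_mod (a + b) p, add_assoc, Nat.mul_add_div hp]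
  unfold esCarry
  rw [ZMod.val_add, ZMod.val_add]
  norm_cast
  rw [key, add_comm x.val ((y.val + w.val) % p), key]
  congr 2
  ring

lemma esCarry_comm {p : ℕ} (x y : ZMod p) : esCarry x y = esCarry y x := by
  unfold esCarry; rw [add_comm]

lemma esCarry_zero {p : ℕ} [Fact p.Prime] (x : ZMod p) : esCarry 0 x = 0 := by
  unfold esCarry
  rw [ZMod.val_zero, zero_add, Nat.div_eq_of_lt (ZMod.val_lt x), Nat.cast_zero]

lemma esCarry_zero' {p : ℕ} [Fact p.Prime] (x : ZMod p) : esCarry x 0 = 0 := by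
  rw [esCarry_comm, esCarry_zero]

/-- cocycle -/
def esF {p n : ℕ} (κ : Fin n → ZMod p) (v w : Fin n → ZMod p × ZMod p) : ZMod p :=
  ∑ i, ((v i).1 * (w i).2 + κ i * (esCarry (v i).1 (w i).1 + esCarry (v i).2 (w i).2))

lemma esF_assoc {p n : ℕ} [Fact p.Prime] (κ : Fin n → ZMod p) (a b c : Fin n → ZMod p × ZMod p) :
    esF κ a b + esF κ (a + b) c = esF κ b c + esF κ a (b + c) := by
  unfold esF
  rw [← Finset.sum_add_distrib, ← Finset.sum_add_distrib]
  apply Finset.sum_congr rfl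
  intro i _
  simp only [Pi.add_apply, Prod.fst_add, Prod.snd_add]
  linear_combination κ i * esCarry_assoc (a i).1 (b i).1 (c i).1 +
    κ i * esCarry_assoc (a i).2 (b i).2 (c i).2

lemma esF_zero_left {p n : ℕ} [Fact p.Prime] (κ : Fin n → ZMod p) (a : Fin n → ZMod p × ZMod p) :
    esF κ 0 a = 0 := by
  simp [esF, esCarry_zero]

lemma esF_zero_right {p n : ℕ} [Fact p.Prime] (κ : Fin n → ZMod p) (a : Fin n → ZMod p × ZMod p) :
    esF κ a 0 = 0 := by
  simp [esF, esCarry_zero']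

lemma esF_sub {p n : ℕ} (κ : Fin n → ZMod p) (v w : Fin n → ZMod p × ZMod p) :
    esF κ v w - esF κ w v = ∑ i, ((v i).1 * (w i).2 - (w i).1 * (v i).2) := by
  unfold esF
  rw [← Finset.sum_sub_distrib]
  apply Finset.sum_congr rfl
  intro i _
  rw [esCarry_comm (w i).1, esCarry_comm (w i).2]
  ring

/-- the models -/
@[ext]
structure EsExt (p n : ℕ) (κ : Fin n → ZMod p) : Type u where
  v : Fin n → ZMod p × ZMod p
  c : ZMod p

namespace EsExt
variable {p n : ℕ} [Fact p.Prime] {κ : Fin n → ZMod p}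

instance : Mul (EsExt.{u} p n κ) := ⟨fun g h => ⟨g.v + h.v, g.c + h.c + esF κ g.v h.v⟩⟩
instance : One (EsExt.{u} p n κ) := ⟨⟨0, 0⟩⟩
instance : Inv (EsExt.{u} p n κ) := ⟨fun g => ⟨-g.v, -g.c - esF κ (-g.v) g.v⟩⟩

lemma mul_v (g h : EsExt.{u} p n κ) : (g * h).v = g.v + h.v := rfl
lemma mul_c (g h : EsExt.{u} p n κ) : (g * h).c = g.c + h.c + esF κ g.v h.v := rfl
lemma one_v : (1 : EsExt.{u} p n κ).v = 0 := rfl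
lemma one_c : (1 : EsExt.{u} p n κ).c = 0 := rfl
lemma inv_v (g : EsExt.{u} p n κ) : (g⁻¹).v = - g.v := rfl
lemma inv_c (g : EsExt.{u} p n κ) : (g⁻¹).c = -g.c - esF κ (-g.v) g.v := rfl

instance : Group (EsExt.{u} p n κ) := Group.ofLeftAxioms
  (by
    intro a b c
    ext1
    · simp only [mul_v, add_assoc]
    · simp only [mul_v, mul_c]
      linear_combination esF_assoc κ a.v b.v c.v)
  (by
    intro a
    ext1
    · simp only [mul_v, one_v, zero_add]
    · simp only [mul_c, one_c, one_v, zero_add, esF_zero_left, add_zero])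
  (by
    intro a
    ext1
    · simp only [mul_v, one_v, inv_v, neg_add_cancel]
    · simp only [mul_c, one_c, inv_v, inv_c]; ring)

/-- underlying product -/
def eqv : EsExt.{u} p n κ ≃ (Fin n → ZMod p × ZMod p) × ZMod p where
  toFun g := (g.v, g.c)
  invFun x := ⟨x.1, x.2⟩
  left_inv _ := rfl
  right_inv _ := rfl

instance : Fintype (EsExt.{u} p n κ) := Fintype.ofEquiv _ eqv.symm

lemma card  : Nat.card (EsExt.{u} p n κ) = p ^ (2 * n + 1) := by
  rw [Nat.card_congr eqv, Nat.card_prod, Nat.card_fun, Nat.card_prod]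
  simp only [Nat.card_zmod, Nat.card_fin]
  rw [← sq, ← pow_mul, pow_succ]

lemma mem_center (g : EsExt.{u} p n κ) : g ∈ Subgroup.center (EsExt.{u} p n κ) ↔ g.v = 0 := by
  rw [Subgroup.mem_center_iff]
  constructor
  · intro h
    have key : ∀ w : Fin n → ZMod p × ZMod p, ∑ i, ((g.v i).1 * (w i).2 - (w i).1 * (g.v i).2) = 0 := by
      intro w
      have := congrArg EsExt.c (h ⟨w, 0⟩)
      simp only [mul_c] at this
      rw [← esF_sub κ]
      linear_combination -this
    ext i
    · have := key (Pi.single i (0, 1))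
      rw [Fintype.sum_eq_single i (by intro j hj; simp [hj])] at this
      simpa using this
    · have := key (Pi.single i (1, 0))
      rw [Fintype.sum_eq_single i (by intro j hj; simp [hj])] at this
      simpa using this
  · intro h a
    ext1
    · rw [mul_v, mul_v, h, add_zero, zero_add]
    · rw [mul_c, mul_c, h, esF_zero_left, esF_zero_right]; ring

lemma card_center : Nat.card (Subgroup.center (EsExt.{u} p n κ)) = p := by
  let e : Subgroup.center (EsExt.{u} p n κ) ≃ ZMod p :=
    { toFun := fun g => g.1.c
      invFun := fun c => ⟨⟨0, c⟩, (mem_center _).2 rfl⟩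
      left_inv := fun g => Subtype.ext (EsExt.ext ((mem_center _).1 g.2).symm rfl)
      right_inv := fun _ => rfl }
  rw [Nat.card_congr e, Nat.card_zmod]

lemma comm_v (g h : EsExt.{u} p n κ) : (⁅g, h⁆ : EsExt.{u} p n κ).v = 0 := by
  rw [commutatorElement_def]
  simp only [mul_v, inv_v]
  abel

lemma comm_eq (g h : EsExt.{u} p n κ) : ⁅g, h⁆ = ⟨0, esF κ g.v h.v - esF κ h.v g.v⟩ := by
  have h1 : g * h = ⟨0, esF κ g.v h.v - esF κ h.v g.v⟩ * (h * g) := by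
    ext1
    · simp only [mul_v]; rw [zero_add, add_comm]
    · simp only [mul_v, mul_c, esF_zero_left]; ring
  rw [commutatorElement_def, h1]; group

lemma center_eq (hn : 0 < n) : Subgroup.center (EsExt.{u} p n κ) = commutator (EsExt.{u} p n κ) := by
  apply le_antisymm
  · intro g hg
    rw [mem_center] at hg
    have : g = ⁅(⟨Pi.single ⟨0, hn⟩ (g.c, 0), 0⟩ : EsExt.{u} p n κ),
        (⟨Pi.single ⟨0, hn⟩ (0, 1), 0⟩ : EsExt.{u} p n κ)⁆ := by
      rw [comm_eq]
      ext1
      · exact hg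
      · simp only
        rw [esF_sub, Fintype.sum_eq_single ⟨0, hn⟩ (by intro j hj; simp [hj])]
        simp
    rw [this]
    exact Subgroup.commutator_mem_commutator (Subgroup.mem_top _) (Subgroup.mem_top _)
  · rw [commutator_def, Subgroup.commutator_le]
    intro g _ h _
    rw [mem_center, comm_v]

end EsExt

lemma es_coatom_ker {G : Type*} [Group G] {p : ℕ} [Fact p.Prime] (φ : G →* Multiplicative (ZMod p))
    {g : G} (hg : φ g ≠ 1) : IsCoatom φ.ker := by
  constructor
  · intro h
    apply hg
    have : g ∈ φ.ker := by rw [h]; trivial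
    exact this
  · intro K hK
    obtain ⟨hle, hne⟩ := SetLike.lt_iff_le_and_exists.1 hK
    obtain ⟨k, hk, hk1⟩ := hne
    rw [eq_top_iff]
    intro h _
    have h1 : φ h ∈ Subgroup.zpowers (φ k) :=
      mem_zpowers_of_prime_card (p := p) (by simp) (fun h => hk1 h)
    obtain ⟨m, hm⟩ := h1
    have h2 : h * (k ^ m)⁻¹ ∈ φ.ker := by
      rw [MonoidHom.mem_ker, map_mul, map_inv, map_zpow]
      simp only at hm
      rw [hm, mul_inv_cancel]
    have h3 := K.mul_mem (hle h2) (K.zpow_mem hk m)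
    simpa using h3

lemma es_center_le_frattini {G : Type*} [Group G] (h : Subgroup.center G = commutator G) :
    Subgroup.center G ≤ frattini G := by
  unfold frattini Order.radical
  refine le_iInf₂ fun M hM => ?_
  by_contra hc
  have htop : M ⊔ Subgroup.center G = ⊤ := hM.2 _ (by
    rw [left_lt_sup]; exact hc)
  apply hc
  rw [h, commutator_def, Subgroup.commutator_le]
  have key : ∀ g : G, ∃ m ∈ M, ∃ c ∈ Subgroup.center G, m * c = g := by
    intro g
    have : g ∈ M ⊔ Subgroup.center G := by rw [htop]; trivial
    exact Subgroup.mem_sup_of_normal_right.1 this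
  intro a _ b _
  obtain ⟨m, hm, c, hc, rfl⟩ := key a
  obtain ⟨m', hm', c', hc', rfl⟩ := key b
  have : ⁅m * c, m' * c'⁆ = ⁅m, m'⁆ := by
    have hZ : ∀ g h : G, ⁅g, h⁆ ∈ Subgroup.center G := by
      intro a b
      rw [h]
      exact Subgroup.commutator_mem_commutator (Subgroup.mem_top _) (Subgroup.mem_top _)
    rw [es_comm_mul_left hZ, es_comm_mul_right hZ, es_comm_central_left hc,
      es_comm_central_right hc', mul_one, mul_one]
  rw [this, commutatorElement_def]
  exact mul_mem (mul_mem (mul_mem hm hm') (inv_mem hm)) (inv_mem hm')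

namespace EsExt
variable {p n : ℕ} [Fact p.Prime] {κ : Fin n → ZMod p}

lemma isExtraspecial (hn : 0 < n) : IsExtraspecial p (EsExt.{u} p n κ) := by
  refine ⟨IsPGroup.of_card card, center_eq hn, ?_, card_center⟩
  apply le_antisymm (es_center_le_frattini (center_eq hn))
  intro g hg
  rw [mem_center]
  let φ1 : Fin n → EsExt.{u} p n κ →* Multiplicative (ZMod p) := fun i =>
    { toFun := fun g => Multiplicative.ofAdd (g.v i).1, map_one' := rfl, map_mul' := fun _ _ => rfl }
  let φ2 : Fin n → EsExt.{u} p n κ →* Multiplicative (ZMod p) := fun i =>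
    { toFun := fun g => Multiplicative.ofAdd (g.v i).2, map_one' := rfl, map_mul' := fun _ _ => rfl }
  have key : ∀ φ : EsExt.{u} p n κ →* Multiplicative (ZMod p), φ g = 1 := by
    intro φ
    by_contra h
    exact h (frattini_le_coatom (es_coatom_ker φ h) hg)
  ext i
  · exact key (φ1 i)
  · exact key (φ2 i)

lemma pow_zero_kappa (g : EsExt.{u} p n 0) (k : ℕ) :
    g ^ k = ⟨k • g.v, k * g.c + (k.choose 2 : ℕ) * ∑ i, (g.v i).1 * (g.v i).2⟩ := by
  induction k with
  | zero => ext1 <;> simp [one_v, one_c]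
  | succ k ih =>
    rw [pow_succ, ih]
    ext1
    · rw [mul_v, succ_nsmul]
    · rw [mul_c]
      have : esF (0 : Fin n → ZMod p) (k • g.v) g.v = k * ∑ i, (g.v i).1 * (g.v i).2 := by
        unfold esF
        rw [Finset.mul_sum]
        apply Finset.sum_congr rfl
        intro i _
        simp [mul_assoc]
      simp only [this]
      rw [Nat.choose_succ_succ' k 1, Nat.choose_one_right]
      push_cast
      ring

lemma pow_one_kappa {i₀ : Fin n} (hκ : κ i₀ = 1) (k : ℕ) (hk : k < p) :
    (⟨Pi.single i₀ (1, 0), 0⟩ : EsExt.{u} p n κ) ^ k = ⟨Pi.single i₀ ((k : ZMod p), 0), 0⟩ ∧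
    (⟨Pi.single i₀ (1, 0), 0⟩ : EsExt.{u} p n κ) ^ (k + 1) =
      ⟨Pi.single i₀ (((k + 1 : ℕ) : ZMod p), 0), (((k + 1) / p : ℕ) : ZMod p)⟩ := by
  have h2 := (Fact.out : p.Prime).two_le
  have : Fact (1 < p) := ⟨h2⟩
  have step : ∀ k : ℕ, k < p → (⟨Pi.single i₀ ((k : ZMod p), 0), 0⟩ : EsExt.{u} p n κ) *
      ⟨Pi.single i₀ (1, 0), 0⟩ = 
      ⟨Pi.single i₀ (((k + 1 : ℕ) : ZMod p), 0), (((k + 1) / p : ℕ) : ZMod p)⟩ := by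
    intro k hk
    ext1
    · rw [mul_v]
      simp only
      rw [← Pi.single_add]
      simp
    · rw [mul_c]
      simp only [esF]
      rw [Fintype.sum_eq_single i₀ (by intro j hj; simp [hj, esCarry_zero])]
      simp [hκ, esCarry, ZMod.val_natCast, Nat.mod_eq_of_lt hk, ZMod.val_one]
  have h00 : (Pi.single i₀ (((0 : ℕ) : ZMod p), 0) : Fin n → ZMod p × ZMod p) = 0 := by
    rw [Nat.cast_zero]; exact Pi.single_zero i₀
  induction k with
  | zero =>
    refine ⟨?_, ?_⟩
    · rw [h00]; rfl
    · rw [← step 0 hk, h00, zero_add, pow_one]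
      exact (one_mul _).symm
  | succ k ih =>
    have h1 := (ih (by omega)).2
    rw [Nat.div_eq_of_lt hk] at h1
    simp only [Nat.cast_zero] at h1
    refine ⟨h1, ?_⟩
    rw [pow_succ, h1, step _ hk]

end EsExt

/-- sign -/
def esChi (x : ZMod 2) : ℤ := if x = 0 then 1 else -1

lemma esChi_add : ∀ x y : ZMod 2, esChi (x + y) = esChi x * esChi y := by decide

lemma esChi_sum {ι : Type*} (s : Finset ι) (f : ι → ZMod 2) :
    esChi (∑ i ∈ s, f i) = ∏ i ∈ s, esChi (f i) := by
  classical
  induction s using Finset.induction_on with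
  | empty => rfl
  | insert a s ha ih => rw [Finset.sum_insert ha, Finset.prod_insert ha, esChi_add, ih]

lemma es_zz : ∀ x : ZMod 2, x + x = 0 := by decide

lemma es_plane : ∀ k : ZMod 2, ∑ x : ZMod 2 × ZMod 2,
      esChi (x.1 * x.2 + k * (esCarry x.1 x.1 + esCarry x.2 x.2)) = 2 * esChi k := by decide

open Classical in
lemma es_sum_two {n : ℕ} [Fact (Nat.Prime 2)] (κ : Fin n → ZMod 2) :
    ∑ g : EsExt.{u} 2 n κ, (if g * g = 1 then (1 : ℤ) else -1) =
      (∏ i, (2 * esChi (κ i))) * 2 := by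
  classical
  have h1 : ∀ g : EsExt.{u} 2 n κ, (if g * g = 1 then (1 : ℤ) else -1) =
      ∏ i, esChi ((g.v i).1 * (g.v i).2 +
        κ i * (esCarry (g.v i).1 (g.v i).1 + esCarry (g.v i).2 (g.v i).2)) := by
    intro g
    rw [← esChi_sum]
    have hz : ∀ x : ZMod 2, x + x = 0 := es_zz
    have : g * g = 1 ↔ esF κ g.v g.v = 0 := by
      rw [EsExt.ext_iff, EsExt.mul_v, EsExt.mul_c, EsExt.one_v, EsExt.one_c, hz, zero_add]
      constructor
      · exact fun h => h.2
      · refine fun h => ⟨?_, h⟩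
        ext i
        · exact hz _
        · exact hz _
    rw [esChi]
    simp only [this]
    rfl
  simp only [h1]
  let F : Fin n → ZMod 2 × ZMod 2 → ℤ := fun i x =>
    esChi (x.1 * x.2 + κ i * (esCarry x.1 x.1 + esCarry x.2 x.2))
  have h2 : ∀ i, ∑ x, F i x = 2 * esChi (κ i) := by
    intro i
    exact es_plane (κ i)
  calc ∑ g : EsExt.{u} 2 n κ, ∏ i, F i (g.v i)
      = ∑ x : (Fin n → ZMod 2 × ZMod 2) × ZMod 2, ∏ i, F i (x.1 i) :=
        Equiv.sum_comp EsExt.eqv (fun x => ∏ i, F i (x.1 i))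
    _ = (∑ v : Fin n → ZMod 2 × ZMod 2, ∏ i, F i (v i)) * 2 := by
        rw [Fintype.sum_prod_type]
        simp [ZMod.card, Finset.mul_sum, mul_comm]
    _ = _ := by
        rw [← Fintype.prod_sum]
        simp only [h2]

lemma es_not_iso {p n : ℕ} [Fact p.Prime] (hn : 0 < n) :
    IsEmpty (EsExt.{u} p n 0 ≃* EsExt.{u} p n (Pi.single ⟨0, hn⟩ 1)) := by
  classical
  refine ⟨fun e => ?_⟩
  by_cases h2 : p = 2
  · subst h2
    have h1 : ∑ g : EsExt.{u} 2 n 0, (if g * g = 1 then (1 : ℤ) else -1) =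
        ∑ g : EsExt.{u} 2 n (Pi.single ⟨0, hn⟩ 1), (if g * g = 1 then (1 : ℤ) else -1) := by
      rw [← Equiv.sum_comp e.toEquiv]
      apply Finset.sum_congr rfl
      intro g _
      have : g * g = 1 ↔ e g * e g = 1 := by
        rw [← map_mul]; exact (map_eq_one_iff e e.injective).symm
      simp only [this]
      rfl
    rw [es_sum_two, es_sum_two] at h1
    have h3 : ∏ i : Fin n, (2 * esChi ((Pi.single ⟨0, hn⟩ 1 : Fin n → ZMod 2) i)) =
        - ∏ i : Fin n, (2 * esChi ((0 : Fin n → ZMod 2) i)) := by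
      have h5 : ∏ i : Fin n, esChi ((Pi.single ⟨0, hn⟩ 1 : Fin n → ZMod 2) i) = -1 := by
        rw [Fintype.prod_eq_single (⟨0, hn⟩ : Fin n) (by intro j hj; simp [hj, esChi])]
        simp [esChi]
      rw [Finset.prod_mul_distrib, Finset.prod_mul_distrib, h5]
      simp [esChi]
    rw [h3] at h1
    have h4 : ∏ i : Fin n, (2 * esChi ((0 : Fin n → ZMod 2) i)) ≠ 0 := by
      simp [esChi]
    apply h4
    linarith
  · have hp := (Fact.out : p.Prime)
    have h3 : 2 < p := lt_of_le_of_ne hp.two_le (Ne.symm h2)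
    have h1 : ∀ g : EsExt.{u} p n 0, g ^ p = 1 := by
      intro g
      rw [EsExt.pow_zero_kappa]
      have : ((p.choose 2 : ℕ) : ZMod p) = 0 := by
        rw [ZMod.natCast_eq_zero_iff]
        exact hp.dvd_choose_self (by norm_num) h3
      rw [this]
      ext1
      · ext i <;> simp [EsExt.one_v]
      · simp [EsExt.one_c]
    let g : EsExt.{u} p n (Pi.single ⟨0, hn⟩ 1) := ⟨Pi.single ⟨0, hn⟩ (1, 0), 0⟩
    have h4 := (EsExt.pow_one_kappa.{u} (p := p) (κ := Pi.single ⟨0, hn⟩ 1) (i₀ := ⟨0, hn⟩)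
      (by simp) (p - 1) (by omega)).2
    rw [Nat.sub_add_cancel hp.one_le, Nat.div_self hp.pos] at h4
    have h5 : g ^ p = 1 := by
      have := congrArg e (h1 (e.symm g))
      simpa using this
    rw [show (⟨Pi.single ⟨0, hn⟩ (1, 0), 0⟩ : EsExt.{u} p n (Pi.single ⟨0, hn⟩ 1)) = g from rfl,
      h5] at h4
    have := congrArg EsExt.c h4
    rw [EsExt.one_c] at this
    simp at this

lemma EsType.iso {p n : ℕ} [Fact p.Prime] {ε : ZMod p} {G H : Type*} [Group G] [Group H]
    [Finite G] [Finite H] (hG : EsType p n ε G) (hH : EsType p n ε H)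
    (cG : Nat.card G = p ^ (2 * n + 1)) (cH : Nat.card H = p ^ (2 * n + 1)) :
    Nonempty (G ≃* H) := by
  obtain ⟨s, z, h, hs⟩ := hG
  obtain ⟨t, w, h', ht⟩ := hH
  refine h.iso h' hs ht ?_ ?_
  · rw [cG]; simp [two_mul]
  · rw [cH]; simp [two_mul]

lemma IsExtraspecial.exists_type {p n : ℕ} [Fact p.Prime] (hn : 0 < n) {H : Type u} [Group H]
    [Finite H] (h : IsExtraspecial p H) (hH : Nat.card H = p ^ (2 * n + 1)) :
    ∃ ε : ZMod p, (ε = 0 ∨ ε = 1) ∧ EsType p n ε H := by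
  refine es_extract hn ?_ h.2.2.2 hH
  intro a b
  rw [h.2.1]
  exact Subgroup.commutator_mem_commutator (Subgroup.mem_top _) (Subgroup.mem_top _)

/-- For each prime `p` and positive integer `n` there are exactly two isomorphism classes of
extraspecial `p`-groups of order `p ^ (2n + 1)`. -/
theorem two_extraspecial_classes (p : ℕ) [Fact p.Prime] (n : ℕ) (hn : 0 < n) :
    ∃ (G₁ G₂ : Type u) (_ : Group G₁) (_ : Group G₂) (_ : Finite G₁) (_ : Finite G₂),
      IsExtraspecial p G₁ ∧ Nat.card G₁ = p ^ (2 * n + 1) ∧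
      IsExtraspecial p G₂ ∧ Nat.card G₂ = p ^ (2 * n + 1) ∧
      IsEmpty (G₁ ≃* G₂) ∧
      ∀ (H : Type u) (_ : Group H) (_ : Finite H),
        IsExtraspecial p H → Nat.card H = p ^ (2 * n + 1) →
        (Nonempty (H ≃* G₁) ∨ Nonempty (H ≃* G₂)) := by
  refine ⟨EsExt.{u} p n 0, EsExt.{u} p n (Pi.single ⟨0, hn⟩ 1), inferInstance, inferInstance,
    inferInstance, inferInstance, EsExt.isExtraspecial hn, EsExt.card, EsExt.isExtraspecial hn,
    EsExt.card, es_not_iso hn, ?_⟩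
  intro H _ _ hH cH
  obtain ⟨a, ha, hA⟩ := (EsExt.isExtraspecial.{u} (p := p) (κ := 0) hn).exists_type hn EsExt.card
  obtain ⟨b, hb, hB⟩ := (EsExt.isExtraspecial.{u} (p := p)
    (κ := Pi.single ⟨0, hn⟩ 1) hn).exists_type hn EsExt.card
  obtain ⟨c, hc, hC⟩ := hH.exists_type hn cH
  have hab : a ≠ b := by
    rintro rfl
    obtain ⟨e⟩ := hA.iso hB EsExt.card EsExt.card
    exact (es_not_iso hn).false e
  by_cases hca : c = a
  · subst hca
    exact Or.inl (hC.iso hA cH EsExt.card)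
  · have : c = b := by
      rcases ha with rfl | rfl <;> rcases hb with rfl | rfl <;> rcases hc with rfl | rfl <;>
        first | rfl | (exact absurd rfl hca) | (exact absurd rfl hab)
    subst this
    exact Or.inr (hC.iso hB cH EsExt.card)
end
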